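/- arXiv:math/0601317 — 4 statements merged into one kernel-verified Lean document; each statement's English description precedes it below -/
import Mathlib

section
/- Let K ⊆ S. Then Σ(W) = Ker(Res_K) ⊕ Σ(W)x_K, and Ker(Res_K) = {x ∈ Σ(W) : x x_K = 0}. -/
open MonoidAlgebra

variable {B W : Type*} [DecidableEq B] [Fintype B] [Group W] [Fintype W] [DecidableEq W]

/-- `x_I`: the sum, in the group algebra `ℚW`, of the minimal length coset
representatives of the standard parabolic subgroup `W_I` in `W`, i.e. the sum of the
`w ∈ W` such that `ws > w` for all `s ∈ I`. -/
noncomputable def descentBasis {M : CoxeterMatrix B} (cs : CoxeterSystem M W)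
    (I : Finset B) : MonoidAlgebra ℚ W :=
  ∑ w : W, if ∀ i ∈ I, cs.length w < cs.length (w * cs.simple i)
    then MonoidAlgebra.single w (1 : ℚ) else 0

/-- `A` is the Solomon descent algebra `Σ(W)` of `(W,S)`: a subalgebra of the group
algebra `ℚW` whose underlying set is the span of the elements `x_I`, `I ⊆ S`.
(By Solomon's theorem this span is indeed closed under multiplication.) -/
def IsDescentAlgebra {M : CoxeterMatrix B} (cs : CoxeterSystem M W)
    (A : Subalgebra ℚ (MonoidAlgebra ℚ W)) : Prop :=
  (A : Set (MonoidAlgebra ℚ W)) = Submodule.span ℚ (Set.range (descentBasis cs))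

/-- The standard parabolic subgroup `W_I` generated by the simple reflections in `I`. -/
def parabolic {M : CoxeterMatrix B} (cs : CoxeterSystem M W) (I : Finset B) : Subgroup W :=
  Subgroup.closure (cs.simple '' I)

open scoped Classical in
/-- `x^K_I`: the sum of the elements `w` of the standard parabolic subgroup `W_K` such
that `ws > w` for all `s ∈ I`; for `I ⊆ K` these are the minimal length coset
representatives of `W_I` in `W_K`, and this is the basis element of the descent
algebra `Σ(W_K)` (viewed inside `ℚW`). -/
noncomputable def parDescentBasis {M : CoxeterMatrix B} (cs : CoxeterSystem M W)
    (K I : Finset B) : MonoidAlgebra ℚ W :=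
  ∑ w : W, if w ∈ parabolic cs K ∧ ∀ i ∈ I, cs.length w < cs.length (w * cs.simple i)
    then MonoidAlgebra.single w (1 : ℚ) else 0

/-- `d ∈ X_{KI} = X_K⁻¹ ∩ X_I`. -/
def memXKI {M : CoxeterMatrix B} (cs : CoxeterSystem M W) (K I : Finset B) (d : W) : Prop :=
  (∀ i ∈ K, cs.length d⁻¹ < cs.length (d⁻¹ * cs.simple i)) ∧
    (∀ i ∈ I, cs.length d < cs.length (d * cs.simple i))

open scoped Classical in
/-- The defining property of the restriction morphism `Res_K : Σ(W) → Σ(W_K)`,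
`Res_K(x_I) = Σ_{d ∈ X_{KI}} x^K_{K ∩ dId⁻¹}`, where `R` is a linear extension of it. -/
def IsResK {M : CoxeterMatrix B} (cs : CoxeterSystem M W) (K : Finset B)
    (R : MonoidAlgebra ℚ W →ₗ[ℚ] MonoidAlgebra ℚ W) : Prop :=
  ∀ I : Finset B, R (descentBasis cs I) =
    ∑ d : W, if memXKI cs K I d
      then parDescentBasis cs K
        (K.filter (fun j => ∃ i ∈ I, cs.simple j = d * cs.simple i * d⁻¹))
      else 0


namespace DescentAux

variable {M : CoxeterMatrix B} (cs : CoxeterSystem M W)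

/-- The generator action on pairs `(t, ε)` used to prove the strong exchange condition. -/
def gact (i : B) : Function.End (W × ZMod 2) := fun p =>
  (cs.simple i * p.1 * cs.simple i, p.2 + if p.1 = cs.simple i then 1 else 0)

theorem simple_mul_pow (i j : B) (n : ℕ) :
    cs.simple j * (cs.simple i * cs.simple j) ^ n
      = ((cs.simple i * cs.simple j) ^ n)⁻¹ * cs.simple j := by
  induction n with
  | zero => simp
  | succ n ih =>
    have h : (cs.simple i * cs.simple j) ^ n * (cs.simple i * cs.simple j)
      = (cs.simple i * cs.simple j) * (cs.simple i * cs.simple j) ^ n := by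
      rw [← pow_succ, pow_succ']
    rw [pow_succ, ← mul_assoc, ih, h, mul_inv_rev, mul_inv_rev, cs.inv_simple, cs.inv_simple]
    simp only [mul_assoc]

theorem end_mul_apply {α : Type*} (f g : Function.End α) (x : α) : (f * g) x = f (g x) := rfl

theorem end_one_apply {α : Type*} (x : α) : (1 : Function.End α) x = x := rfl

theorem gact_pow (i j : B) (n : ℕ) (t : W) (e : ZMod 2) :
    ((gact cs i * gact cs j) ^ n) (t, e) =
      ((cs.simple i * cs.simple j) ^ n * t * ((cs.simple i * cs.simple j) ^ n)⁻¹,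
        e + ∑ k ∈ Finset.range (2 * n),
          if t = cs.simple j * (cs.simple i * cs.simple j) ^ k then 1 else 0) := by
  induction n with
  | zero => simp [end_one_apply]
  | succ n ih =>
    rw [pow_succ', end_mul_apply, ih, end_mul_apply]
    set r := cs.simple i * cs.simple j with hr
    have hrinv : r⁻¹ = cs.simple j * cs.simple i := by simp [hr]
    have h1 : (r ^ n * t * (r ^ n)⁻¹ = cs.simple j) ↔ t = cs.simple j * r ^ (2 * n) := by
      rw [two_mul, pow_add, ← mul_assoc, simple_mul_pow, mul_inv_eq_iff_eq_mul,
        ← eq_inv_mul_iff_mul_eq, mul_assoc]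
    have h2 : (cs.simple j * (r ^ n * t * (r ^ n)⁻¹) * cs.simple j = cs.simple i) ↔
        t = cs.simple j * r ^ (2 * n + 1) := by
      have : cs.simple j * r ^ (2 * n + 1) =
          (r ^ n)⁻¹ * (cs.simple j * (cs.simple i * cs.simple j)) * r ^ n := by
        rw [show 2 * n + 1 = n + (1 + n) by ring, pow_add, ← mul_assoc, simple_mul_pow, pow_add,
          pow_one, ← hr]
        simp only [mul_assoc]
      rw [this]
      generalize r ^ n = q
      constructor
      · intro h
        rw [← h]
        simp [mul_assoc]
      · intro h
        rw [h]
        simp [mul_assoc]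
    rw [show 2 * (n + 1) = 2 * n + 1 + 1 by ring, Finset.sum_range_succ, Finset.sum_range_succ]
    simp only [gact, Prod.mk.injEq, h1, h2]
    constructor
    · rw [pow_succ', mul_inv_rev, hrinv, hr]
      simp [mul_assoc]
    · ring

theorem gact_liftable : M.IsLiftable (gact cs) := by
  intro i j
  funext ⟨t, e⟩
  rw [gact_pow]
  have hm : (cs.simple i * cs.simple j) ^ (M i j) = 1 := cs.simple_mul_simple_pow i j
  rw [two_mul, Finset.sum_range_add]
  simp only [pow_add, hm, one_mul, inv_one, mul_one, CharTwo.add_self_eq_zero, add_zero]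
  rfl

/-- The lifted action. -/
noncomputable def act : W →* Function.End (W × ZMod 2) := cs.lift ⟨gact cs, gact_liftable cs⟩

theorem act_simple (i : B) : act cs (cs.simple i) = gact cs i :=
  cs.lift_apply_simple (gact_liftable cs) i

/-- The inversion parity. -/
noncomputable def par (w t : W) : ZMod 2 := (act cs w (t, 0)).2

theorem act_apply (w t : W) (e : ZMod 2) : act cs w (t, e) = (w * t * w⁻¹, e + par cs w t) := by
  have key : ∀ w : W, ∀ t e, act cs w (t, e) = (w * t * w⁻¹, e + (act cs w (t, 0)).2) := by
    intro w
    refine cs.simple_induction (p := fun w => ∀ t e, act cs w (t, e) =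
      (w * t * w⁻¹, e + (act cs w (t, 0)).2)) w ?_ ?_ ?_
    · intro i t e
      rw [act_simple]
      simp [gact]
    · intro t e
      rw [map_one]
      simp [end_one_apply]
    · intro x y hx hy t e
      rw [map_mul, end_mul_apply, end_mul_apply,
        hy t e, hy t 0, hx, hx _ (0 + _)]
      simp [mul_assoc, add_assoc]
  exact key w t e

theorem par_mul (x y t : W) : par cs (x * y) t = par cs y t + par cs x (y * t * y⁻¹) := by
  have h : act cs (x * y) (t, 0) = act cs x (act cs y (t, 0)) := by
    rw [map_mul, end_mul_apply]
  rw [act_apply, act_apply, act_apply] at h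
  simpa using congrArg Prod.snd h

theorem par_one (t : W) : par cs 1 t = 0 := by
  simp [par, end_one_apply]

theorem par_simple (i : B) (t : W) :
    par cs (cs.simple i) t = if t = cs.simple i then 1 else 0 := by
  simp [par, act_simple, gact]

theorem mem_ris_of_par (ω : List B) (t : W) (h : par cs (cs.wordProd ω) t ≠ 0) :
    t ∈ cs.rightInvSeq ω := by
  induction ω with
  | nil => simp [par_one] at h
  | cons i ω ih =>
    rw [CoxeterSystem.rightInvSeq, List.mem_cons]
    by_cases h' : par cs (cs.wordProd ω) t = 0
    · left
      rw [cs.wordProd_cons, par_mul, h', par_simple] at h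
      have : cs.wordProd ω * t * (cs.wordProd ω)⁻¹ = cs.simple i := by
        by_contra hc
        simp [hc] at h
      rw [← this]
      simp [mul_assoc]
    · exact Or.inr (ih h')

theorem par_self {t : W} (ht : cs.IsReflection t) : par cs t t = 1 := by
  obtain ⟨g, i, rfl⟩ := ht
  have h0 := par_mul cs g g⁻¹ (g * cs.simple i * g⁻¹)
  rw [mul_inv_cancel, par_one] at h0
  rw [par_mul, par_mul, par_simple]
  have e1 : g⁻¹ * (g * cs.simple i * g⁻¹) * g⁻¹⁻¹ = cs.simple i := by simp [mul_assoc]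
  rw [e1] at h0 ⊢
  simp only [↓reduceIte, mul_inv_cancel_right]
  rw [add_left_comm, ← h0, add_zero]

theorem lt_of_par {w t : W} (h : par cs w t ≠ 0) : cs.length (w * t) < cs.length w := by
  obtain ⟨ω, hω, rfl⟩ := cs.exists_isReduced w
  exact (cs.isRightInversion_of_mem_rightInvSeq hω (mem_ris_of_par cs ω t h)).2

theorem gt_of_par {w t : W} (ht : cs.IsReflection t) (h : par cs w t = 0) :
    cs.length w < cs.length (w * t) := by
  have h1 : par cs (w * t) t ≠ 0 := by
    rw [par_mul, par_self cs ht, mul_inv_cancel_right, h]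
    simp
  have := lt_of_par cs h1
  rwa [mul_assoc, ht.mul_self, mul_one] at this

theorem par_zero_iff {w t : W} (ht : cs.IsReflection t) :
    par cs w t = 0 ↔ cs.length w < cs.length (w * t) := by
  refine ⟨gt_of_par cs ht, fun h => ?_⟩
  by_contra hc
  exact absurd (lt_of_par cs hc) (by omega)

theorem par_zero_iff_simple {w : W} {i : B} :
    par cs w (cs.simple i) = 0 ↔ cs.length w < cs.length (w * cs.simple i) :=
  par_zero_iff cs (cs.isReflection_simple i)

/-- The exchange condition. -/
theorem exchange {ω : List B} {t : W} (h : cs.length (cs.wordProd ω * t) < cs.length (cs.wordProd ω))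
    (ht : cs.IsReflection t) :
    ∃ j < ω.length, cs.wordProd ω * t = cs.wordProd (ω.eraseIdx j) := by
  have h1 : par cs (cs.wordProd ω) t ≠ 0 := by
    intro h0
    have := gt_of_par cs ht h0
    omega
  obtain ⟨j, hj, rfl⟩ := List.mem_iff_getElem.mp (mem_ris_of_par cs ω t h1)
  refine ⟨j, by simpa using hj, ?_⟩
  rw [← List.getD_eq_getElem _ 1 hj, cs.wordProd_mul_getD_rightInvSeq]

/-- membership in `X_I`. -/
def X (I : Finset B) (w : W) : Prop := ∀ i ∈ I, cs.length w < cs.length (w * cs.simple i)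

theorem simple_mem {I : Finset B} {i : B} (hi : i ∈ I) : cs.simple i ∈ parabolic cs I :=
  Subgroup.subset_closure ⟨i, hi, rfl⟩

theorem par_ind (I : Finset B) {P : W → Prop} (h1 : P 1)
    (hs : ∀ w, w ∈ parabolic cs I → P w → ∀ i ∈ I, P (w * cs.simple i)) :
    ∀ p ∈ parabolic cs I, P p := by
  intro p hp
  refine Subgroup.closure_induction_right (p := fun x _ => P x) h1 ?_ ?_ hp
  · rintro x hx _ ⟨i, hi, rfl⟩ h
    exact hs x hx h i hi
  · rintro x hx _ ⟨i, hi, rfl⟩ h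
    rw [cs.inv_simple]
    exact hs x hx h i hi

theorem exists_reduced (I : Finset B) : ∀ p ∈ parabolic cs I,
    ∃ ω : List B, (∀ i ∈ ω, i ∈ I) ∧ cs.IsReduced ω ∧ p = cs.wordProd ω := by
  refine par_ind cs I ⟨[], by simp, by simp [CoxeterSystem.IsReduced], by simp⟩ ?_
  rintro w hw ⟨ω, hωI, hω, rfl⟩ i hi
  rcases cs.length_mul_simple (cs.wordProd ω) i with h | h
  · refine ⟨ω ++ [i], ?_, ?_, by simp [cs.wordProd_append]⟩
    · intro k hk
      rcases List.mem_append.1 hk with hk | hk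
      · exact hωI k hk
      · simp at hk; exact hk ▸ hi
    · unfold CoxeterSystem.IsReduced at *
      rw [cs.wordProd_append, cs.wordProd_singleton, h, hω]
      simp
  · obtain ⟨j, hj, hj2⟩ := exchange cs (ω := ω) (t := cs.simple i) (by omega)
      (cs.isReflection_simple i)
    refine ⟨ω.eraseIdx j, fun k hk => hωI k (List.mem_of_mem_eraseIdx hk), ?_, hj2⟩
    unfold CoxeterSystem.IsReduced at *
    rw [← hj2]
    have := List.length_eraseIdx_add_one hj
    omega

theorem eq_one_of_X {I : Finset B} {p : W} (hp : p ∈ parabolic cs I) (hX : X cs I p) : p = 1 := by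
  obtain ⟨ω, hωI, hω, rfl⟩ := exists_reduced cs I p hp
  rcases List.eq_nil_or_concat ω with rfl | ⟨ω', i, rfl⟩
  · simp
  · exfalso
    have h := hX i (hωI i (by simp))
    rw [hω] at h
    simp only [List.concat_eq_append, cs.wordProd_append, cs.wordProd_singleton,
      cs.simple_mul_simple_cancel_right] at h
    have := cs.length_wordProd_le ω'
    simp at h
    omega

theorem len_add_min {I : Finset B} {a : W}
    (ha : ∀ q ∈ parabolic cs I, cs.length a ≤ cs.length (a * q)) :
    ∀ p ∈ parabolic cs I, cs.length (a * p) = cs.length a + cs.length p := by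
  refine par_ind cs I (by simp) ?_
  intro w hw ih i hi
  have hr : cs.IsReflection (w * cs.simple i * w⁻¹) := ⟨w, i, rfl⟩
  have hmem : w * cs.simple i * w⁻¹ ∈ parabolic cs I :=
    mul_mem (mul_mem hw (simple_mem cs hi)) (inv_mem hw)
  have h0 : par cs a (w * cs.simple i * w⁻¹) = 0 := by
    by_contra hc
    have := lt_of_par cs hc
    have := ha _ hmem
    omega
  have h1 := par_mul cs a w (cs.simple i)
  rw [h0, add_zero] at h1
  have e1 := par_zero_iff_simple cs (w := a * w) (i := i)
  have e2 := par_zero_iff_simple cs (w := w) (i := i)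
  rw [h1, e2] at e1
  rw [← mul_assoc]
  rcases cs.length_mul_simple (a * w) i with h | h <;>
  rcases cs.length_mul_simple w i with h' | h' <;> omega

theorem exists_min (I : Finset B) (w : W) : ∃ a p, p ∈ parabolic cs I ∧ w = a * p ∧
    ∀ q ∈ parabolic cs I, cs.length a ≤ cs.length (a * q) := by
  classical
  obtain ⟨q, hq, hmin⟩ := Finset.exists_min_image
    (Finset.univ.filter (fun q => q ∈ parabolic cs I)) (fun q => cs.length (w * q))
    ⟨1, by simp [one_mem]⟩
  simp only [Finset.mem_filter, Finset.mem_univ, true_and] at hq hmin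
  refine ⟨w * q, q⁻¹, inv_mem hq, by simp, fun r hr => ?_⟩
  rw [mul_assoc]
  exact hmin _ (mul_mem hq hr)

theorem min_of_X {I : Finset B} {a : W} (ha : X cs I a) :
    ∀ q ∈ parabolic cs I, cs.length a ≤ cs.length (a * q) := by
  obtain ⟨b, p, hp, rfl, hb⟩ := exists_min cs I a
  have h := len_add_min cs hb
  have : p = 1 := by
    apply eq_one_of_X cs hp
    intro i hi
    have h1 := ha i hi
    rw [mul_assoc, h _ hp, h _ (mul_mem hp (simple_mem cs hi))] at h1
    omega
  subst this
  simpa using hb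

theorem len_add {I : Finset B} {a : W} (ha : X cs I a) {p : W} (hp : p ∈ parabolic cs I) :
    cs.length (a * p) = cs.length a + cs.length p :=
  len_add_min cs (min_of_X cs ha) p hp

theorem decomp (I : Finset B) (w : W) : ∃ a p, X cs I a ∧ p ∈ parabolic cs I ∧ w = a * p := by
  obtain ⟨a, p, hp, h, ha⟩ := exists_min cs I w
  refine ⟨a, p, ?_, hp, h⟩
  intro i hi
  have := len_add_min cs ha _ (simple_mem cs hi)
  rw [this, cs.length_simple]
  omega

theorem decomp_unique {I : Finset B} {a p a' p' : W} (ha : X cs I a) (ha' : X cs I a')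
    (hp : p ∈ parabolic cs I) (hp' : p' ∈ parabolic cs I) (h : a * p = a' * p') :
    a = a' ∧ p = p' := by
  have hq : p * p'⁻¹ ∈ parabolic cs I := mul_mem hp (inv_mem hp')
  have e : a * (p * p'⁻¹) = a' := by rw [← mul_assoc, h, mul_inv_cancel_right]
  have e' : a' * (p * p'⁻¹)⁻¹ = a := by rw [← e, mul_inv_cancel_right]
  have h1 := len_add cs ha hq
  have h2 := len_add cs ha' (inv_mem hq)
  rw [e] at h1
  rw [e'] at h2
  have h3 : p * p'⁻¹ = 1 := cs.length_eq_zero_iff.1 (by omega)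
  rw [h3, mul_one] at e
  exact ⟨e, by rwa [mul_inv_eq_one] at h3⟩

theorem X_mul_iff {I J : Finset B} (hJ : J ⊆ I) {a p : W} (ha : X cs I a)
    (hp : p ∈ parabolic cs I) : X cs J (a * p) ↔ X cs J p := by
  refine forall₂_congr fun i hi => ?_
  rw [mul_assoc, len_add cs ha hp, len_add cs ha (mul_mem hp (simple_mem cs (hJ hi)))]
  omega

/-- lengths add on the left. -/
theorem len_add_left {I : Finset B} {d : W} (hd : X cs I d) {p : W} (hp : p ∈ parabolic cs I) :
    cs.length (p * d⁻¹) = cs.length p + cs.length d := by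
  have := len_add cs hd (inv_mem hp)
  rw [← cs.length_inv, mul_inv_rev, inv_inv, this, cs.length_inv, add_comm]

open scoped Classical in
/-- `I ∩ d⁻¹ K d`. -/
noncomputable def JI (K I : Finset B) (d : W) : Finset B :=
  I.filter (fun i => ∃ j ∈ K, cs.simple j = d * cs.simple i * d⁻¹)

open scoped Classical in
/-- `K ∩ d I d⁻¹`. -/
noncomputable def JK (K I : Finset B) (d : W) : Finset B :=
  K.filter (fun j => ∃ i ∈ I, cs.simple j = d * cs.simple i * d⁻¹)

theorem X_double_iff {K I : Finset B} {d p : W} (hd : X cs I d) (hp : p ∈ parabolic cs I) :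
    X cs K (p * d⁻¹) ↔ (X cs K d⁻¹ ∧ X cs (JI cs K I d) p) := by
  have hl := len_add_left cs hd hp
  constructor
  · intro h
    constructor
    · intro k hk
      have h1 := h k hk
      have h2 := cs.length_mul_le p (d⁻¹ * cs.simple k)
      rw [← mul_assoc] at h2
      have h3 := cs.length_mul_simple_ne d⁻¹ k
      rw [cs.length_inv] at *
      omega
    · intro i hi
      simp only [JI, Finset.mem_filter] at hi
      obtain ⟨hi, j, hj, hij⟩ := hi
      have h1 := h j hj
      have e : p * d⁻¹ * cs.simple j = (p * cs.simple i) * d⁻¹ := by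
        rw [hij]; simp [mul_assoc]
      rw [e, hl, len_add_left cs hd (mul_mem hp (simple_mem cs hi))] at h1
      omega
  · rintro ⟨hc, hpJ⟩ k hk
    by_cases h : ∃ i ∈ I, cs.simple k = d * cs.simple i * d⁻¹
    · obtain ⟨i, hi, hki⟩ := h
      have h1 := hpJ i (by simp only [JI, Finset.mem_filter]; exact ⟨hi, k, hk, hki⟩)
      have e : p * d⁻¹ * cs.simple k = (p * cs.simple i) * d⁻¹ := by
        rw [hki]; simp [mul_assoc]
      rw [e, hl, len_add_left cs hd (mul_mem hp (simple_mem cs hi))]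
      omega
    · have hX : X cs I (cs.simple k * d) := by
        intro i hi
        by_contra hcon
        apply h
        refine ⟨i, hi, ?_⟩
        -- `s_i` is a descent of `s_k d`, not of `d`
        have h0 : par cs (cs.simple k * d) (cs.simple i) ≠ 0 := by
          intro h0
          exact hcon ((par_zero_iff_simple cs).1 h0)
        rw [par_mul, (par_zero_iff_simple cs).2 (hd i hi), par_simple] at h0
        by_contra hne
        rw [if_neg (fun h' => hne h'.symm)] at h0
        simp at h0
      have h1 := len_add_left cs hX hp
      have h2 := hc k hk
      rw [← cs.length_inv (d⁻¹ * cs.simple k)] at h2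
      simp only [mul_inv_rev, cs.inv_simple, inv_inv, cs.length_inv] at h2 h1
      rw [← mul_assoc] at h1
      omega

theorem X_conj_iff {K I : Finset B} {d y : W} (hd : X cs K d⁻¹) :
    X cs (JI cs K I d) y ↔ X cs (JK cs K I d) (y * d⁻¹) := by
  have key : ∀ i j, j ∈ K → cs.simple j = d * cs.simple i * d⁻¹ →
      (cs.length y < cs.length (y * cs.simple i) ↔
        cs.length (y * d⁻¹) < cs.length (y * d⁻¹ * cs.simple j)) := by
    intro i j hj hij
    rw [← par_zero_iff_simple, ← par_zero_iff_simple, par_mul,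
      (par_zero_iff_simple cs).2 (hd j hj), zero_add]
    have : d⁻¹ * cs.simple j * d⁻¹⁻¹ = cs.simple i := by rw [hij]; simp [mul_assoc]
    rw [this]
  constructor
  · intro h j hj
    simp only [JK, Finset.mem_filter] at hj
    obtain ⟨hj, i, hi, hij⟩ := hj
    refine (key i j hj hij).1 (h i ?_)
    simp only [JI, Finset.mem_filter]
    exact ⟨hi, j, hj, hij⟩
  · intro h i hi
    simp only [JI, Finset.mem_filter] at hi
    obtain ⟨hi, j, hj, hij⟩ := hi
    refine (key i j hj hij).2 (h j ?_)
    simp only [JK, Finset.mem_filter]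
    exact ⟨hj, i, hi, hij⟩

open scoped Classical in
/-- The sum in the group algebra of the elements satisfying `P`. -/
noncomputable def ind (P : W → Prop) : MonoidAlgebra ℚ W :=
  ∑ w ∈ Finset.univ.filter P, MonoidAlgebra.single w (1 : ℚ)

theorem descentBasis_eq (I : Finset B) : descentBasis cs I = ind (X cs I) := by
  classical
  rw [ind, descentBasis, Finset.sum_filter]
  refine Finset.sum_congr rfl fun w _ => ?_
  exact if_congr Iff.rfl rfl rfl

theorem parDescentBasis_eq (K I : Finset B) :
    parDescentBasis cs K I = ind (fun w => w ∈ parabolic cs K ∧ X cs I w) := by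
  classical
  rw [ind, parDescentBasis, Finset.sum_filter]
  refine Finset.sum_congr rfl fun w _ => ?_
  by_cases h : w ∈ parabolic cs K ∧ X cs I w
  · rw [if_pos h]
    exact if_pos h
  · rw [if_neg h]
    exact if_neg h

theorem ind_mul_ind {P Q T : W → Prop} (h1 : ∀ a p, P a → Q p → T (a * p))
    (h2 : ∀ w, T w → ∃ a p, P a ∧ Q p ∧ w = a * p)
    (h3 : ∀ a p a' p', P a → Q p → P a' → Q p' → a * p = a' * p' → a = a' ∧ p = p') :
    (ind P * ind Q : MonoidAlgebra ℚ W) = ind T := by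
  classical
  simp only [ind]
  rw [Finset.sum_mul_sum, ← Finset.sum_product']
  refine Finset.sum_bij (fun x _ => x.1 * x.2) ?_ ?_ ?_ ?_
  · rintro ⟨a, p⟩ h
    simp only [Finset.mem_product, Finset.mem_filter, Finset.mem_univ, true_and] at h ⊢
    exact h1 a p h.1 h.2
  · rintro ⟨a, p⟩ h ⟨a', p'⟩ h' e
    simp only [Finset.mem_product, Finset.mem_filter, Finset.mem_univ, true_and] at h h'
    obtain ⟨rfl, rfl⟩ := h3 a p a' p' h.1 h.2 h'.1 h'.2 e
    rfl
  · intro w hw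
    simp only [Finset.mem_filter, Finset.mem_univ, true_and] at hw
    obtain ⟨a, p, ha, hp, rfl⟩ := h2 w hw
    exact ⟨(a, p), by simp [ha, hp], rfl⟩
  · rintro ⟨a, p⟩ h
    simp [MonoidAlgebra.single_mul_single]

theorem basis_mul_par {I J : Finset B} (hJ : J ⊆ I) :
    descentBasis cs I * parDescentBasis cs I J = descentBasis cs J := by
  rw [descentBasis_eq, descentBasis_eq, parDescentBasis_eq]
  apply ind_mul_ind
  · intro a p ha hp
    exact (X_mul_iff cs hJ ha hp.1).2 hp.2
  · intro w hw
    obtain ⟨a, p, ha, hp, rfl⟩ := decomp cs I w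
    exact ⟨a, p, ha, ⟨hp, (X_mul_iff cs hJ ha hp).1 hw⟩, rfl⟩
  · intro a p a' p' ha hp ha' hp' e
    exact decomp_unique cs ha ha' hp.1 hp'.1 e

theorem basis_conj {K I : Finset B} {d : W} (hd : X cs K d⁻¹) :
    descentBasis cs (JI cs K I d) * MonoidAlgebra.single d⁻¹ 1
      = descentBasis cs (JK cs K I d) := by
  classical
  have : (MonoidAlgebra.single d⁻¹ 1 : MonoidAlgebra ℚ W) = ind (fun w => w = d⁻¹) := by
    unfold ind
    rw [Finset.sum_eq_single_of_mem d⁻¹ (by simp)]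
    intro b hb hne
    exact absurd (by simpa using hb) hne
  rw [this, descentBasis_eq, descentBasis_eq]
  apply ind_mul_ind
  · rintro a p ha rfl
    exact (X_conj_iff cs hd).1 ha
  · intro w hw
    refine ⟨w * d, d⁻¹, (X_conj_iff cs hd).2 (by simpa using hw), rfl, by simp⟩
  · rintro a p a' p' ha rfl ha' rfl e
    exact ⟨by simpa using e, rfl⟩

open scoped Classical in
theorem basis_double (K I : Finset B) :
    descentBasis cs K = ∑ d : W, if memXKI cs K I d then
      parDescentBasis cs I (JI cs K I d) * MonoidAlgebra.single d⁻¹ 1 else 0 := by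
  rw [← Finset.sum_filter, descentBasis_eq]
  simp only [parDescentBasis_eq, ind, Finset.sum_mul, MonoidAlgebra.single_mul_single, mul_one]
  rw [Finset.sum_sigma']
  symm
  refine Finset.sum_bij (fun x _ => x.2 * x.1⁻¹) ?_ ?_ ?_ ?_
  · rintro ⟨d, p⟩ h
    simp only [Finset.mem_sigma, Finset.mem_filter, Finset.mem_univ, true_and] at h ⊢
    exact (X_double_iff cs h.1.2 h.2.1).2 ⟨h.1.1, h.2.2⟩
  · rintro ⟨d, p⟩ h ⟨d', p'⟩ h' e
    simp only [Finset.mem_sigma, Finset.mem_filter, Finset.mem_univ, true_and] at h h' e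
    have e' := congrArg (·⁻¹) e
    simp only [mul_inv_rev, inv_inv] at e'
    obtain ⟨h1, h2⟩ := decomp_unique cs h.1.2 h'.1.2 (inv_mem h.2.1) (inv_mem h'.2.1) e'
    rw [inv_inj] at h2
    rw [h1, h2]
  · intro w hw
    simp only [Finset.mem_filter, Finset.mem_univ, true_and] at hw
    obtain ⟨d, p, hd, hp, e⟩ := decomp cs I w⁻¹
    have e2 : w = p⁻¹ * d⁻¹ := by rw [← mul_inv_rev, ← e, inv_inv]
    rw [e2] at hw
    have := (X_double_iff cs hd (inv_mem hp)).1 hw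
    refine ⟨⟨d, p⁻¹⟩, ?_, e2.symm⟩
    simp only [Finset.mem_sigma, Finset.mem_filter, Finset.mem_univ, true_and]
    exact ⟨⟨this.1, hd⟩, inv_mem hp, this.2⟩
  · rintro ⟨d, p⟩ h
    rfl

theorem JI_subset (K I : Finset B) (d : W) : JI cs K I d ⊆ I := by
  classical
  exact Finset.filter_subset _ _

theorem JK_subset (K I : Finset B) (d : W) : JK cs K I d ⊆ K := by
  classical
  exact Finset.filter_subset _ _

open scoped Classical in
/-- Solomon's product formula. -/
theorem solomon (I K : Finset B) :
    descentBasis cs I * descentBasis cs K =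
      ∑ d : W, if memXKI cs K I d then descentBasis cs (JK cs K I d) else 0 := by
  rw [basis_double cs K I, Finset.mul_sum]
  refine Finset.sum_congr rfl fun d _ => ?_
  split_ifs with h
  · rw [← mul_assoc, basis_mul_par cs (JI_subset cs K I d), basis_conj cs h.1]
  · simp

theorem res_basis {K : Finset B} {R : MonoidAlgebra ℚ W →ₗ[ℚ] MonoidAlgebra ℚ W}
    (hR : IsResK cs K R) (I : Finset B) :
    descentBasis cs K * R (descentBasis cs I) = descentBasis cs I * descentBasis cs K := by
  classical
  rw [hR I, solomon, Finset.mul_sum]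
  refine Finset.sum_congr rfl fun d _ => ?_
  by_cases h : memXKI cs K I d
  · rw [if_pos h, if_pos h]
    exact basis_mul_par cs (JK_subset cs K I d)
  · rw [if_neg h, if_neg h, mul_zero]

/-- elements of the group algebra supported on `W_K`. -/
noncomputable def suppK (K : Finset B) : Submodule ℚ (MonoidAlgebra ℚ W) :=
  Submodule.span ℚ ((fun w => MonoidAlgebra.single w (1 : ℚ)) '' (parabolic cs K : Set W))

theorem par_mem_suppK (K J : Finset B) : parDescentBasis cs K J ∈ suppK cs K := by
  classical
  rw [parDescentBasis_eq]
  refine Submodule.sum_mem _ fun w hw => Submodule.subset_span ⟨w, ?_, rfl⟩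
  simp only [Finset.mem_filter] at hw
  exact hw.2.1

theorem res_mem_suppK {K : Finset B} {R : MonoidAlgebra ℚ W →ₗ[ℚ] MonoidAlgebra ℚ W}
    (hR : IsResK cs K R) (I : Finset B) : R (descentBasis cs I) ∈ suppK cs K := by
  classical
  rw [hR I]
  refine Submodule.sum_mem _ fun d _ => ?_
  split_ifs
  · exact par_mem_suppK cs K _
  · exact zero_mem _

open scoped Classical in
/-- The projection onto the span of `W_K`. -/
noncomputable def proj (K : Finset B) : MonoidAlgebra ℚ W →ₗ[ℚ] MonoidAlgebra ℚ W :=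
  (Finsupp.linearCombination ℚ (fun w : W =>
    if w ∈ parabolic cs K then (MonoidAlgebra.single w 1 : MonoidAlgebra ℚ W) else 0)) ∘ₗ
  (MonoidAlgebra.coeffLinearEquiv ℚ).toLinearMap

open scoped Classical in
theorem proj_single (K : Finset B) (w : W) : proj cs K (MonoidAlgebra.single w 1) =
    if w ∈ parabolic cs K then MonoidAlgebra.single w 1 else 0 := by
  simp [proj]

theorem proj_mul {K : Finset B} {y : MonoidAlgebra ℚ W} (hy : y ∈ suppK cs K) :
    proj cs K (descentBasis cs K * y) = y := by
  classical
  induction hy using Submodule.span_induction with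
  | mem x hx =>
    obtain ⟨v, hv, rfl⟩ := hx
    rw [descentBasis_eq]
    simp only [ind, Finset.sum_mul, MonoidAlgebra.single_mul_single, mul_one, map_sum, proj_single]
    rw [Finset.sum_eq_single 1]
    · rw [one_mul]
      exact if_pos hv
    · intro a ha hne
      refine if_neg fun hav => hne ?_
      simp only [Finset.mem_filter, Finset.mem_univ, true_and] at ha
      refine eq_one_of_X cs ?_ ha
      exact (Subgroup.mul_mem_cancel_right _ hv).1 hav
    · intro h
      exfalso
      apply h
      simp only [Finset.mem_filter, Finset.mem_univ, true_and]
      intro i _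
      simp
  | zero => simp
  | add x y _ _ hx hy => rw [mul_add, map_add, hx, hy]
  | smul a x _ hx => rw [mul_smul_comm, map_smul, hx]

theorem left_inj {K : Finset B} {y : MonoidAlgebra ℚ W} (hy : y ∈ suppK cs K)
    (h : descentBasis cs K * y = 0) : y = 0 := by
  rw [← proj_mul cs hy, h, map_zero]

/-- The subsets whose parabolic subgroup is conjugate into `W_K`. -/
def Good (K J : Finset B) : Prop := ∃ d, memXKI cs J K d ∧ JK cs J K d = J

theorem good_JK {K J : Finset B} {d : W} (h : memXKI cs J K d) : Good cs K (JK cs J K d) := by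
  classical
  refine ⟨d, ⟨fun i hi => h.1 i (JK_subset cs J K d hi), h.2⟩, ?_⟩
  refine Finset.filter_true_of_mem fun j hj => ?_
  simp only [JK, Finset.mem_filter] at hj
  exact hj.2

theorem good_self (K : Finset B) : Good cs K K := by
  classical
  refine ⟨1, ⟨fun i _ => by simp, fun i _ => by simp⟩, ?_⟩
  exact Finset.filter_true_of_mem fun j hj => ⟨j, hj, by simp⟩

/-- The span of the basis elements for good subsets. -/
noncomputable def V (K : Finset B) : Submodule ℚ (MonoidAlgebra ℚ W) :=
  Submodule.span ℚ {x | ∃ J, Good cs K J ∧ x = descentBasis cs J}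

theorem V_le (K : Finset B) :
    V cs K ≤ (V cs K).map (LinearMap.mulLeft ℚ (descentBasis cs K)) := by
  classical
  have key : ∀ n : ℕ, ∀ J : Finset B, J.card = n → Good cs K J →
      descentBasis cs J ∈ (V cs K).map (LinearMap.mulLeft ℚ (descentBasis cs K)) := by
    intro n
    induction n using Nat.strong_induction_on with
    | _ n ih =>
      intro J hJn hJ
      set U := (V cs K).map (LinearMap.mulLeft ℚ (descentBasis cs K)) with hU
      have h1 : descentBasis cs K * descentBasis cs J ∈ U :=
        ⟨descentBasis cs J, Submodule.subset_span ⟨J, hJ, rfl⟩, rfl⟩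
      rw [solomon, ← Finset.sum_filter,
        ← Finset.sum_filter_add_sum_filter_not _ (fun d => JK cs J K d = J)] at h1
      have h2 : ∑ d ∈ (Finset.univ.filter (fun d => memXKI cs J K d)).filter
          (fun d => ¬ JK cs J K d = J), descentBasis cs (JK cs J K d) ∈ U := by
        refine Submodule.sum_mem _ fun d hd => ?_
        simp only [Finset.mem_filter, Finset.mem_univ, true_and] at hd
        refine ih _ ?_ _ rfl (good_JK cs hd.1)
        rw [← hJn]
        exact Finset.card_lt_card ((JK_subset cs J K d).ssubset_of_ne hd.2)
      have h3 := (Submodule.add_mem_iff_left _ h2).1 h1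
      rw [Finset.sum_congr rfl (g := fun _ => descentBasis cs J)
        (fun d hd => by rw [(Finset.mem_filter.1 hd).2]), Finset.sum_const,
        ← Nat.cast_smul_eq_nsmul ℚ] at h3
      refine (Submodule.smul_mem_iff _ ?_).1 h3
      obtain ⟨d, hd1, hd2⟩ := hJ
      rw [Nat.cast_ne_zero]
      refine Finset.card_ne_zero_of_mem (a := d) ?_
      simp only [Finset.mem_filter, Finset.mem_univ, true_and]
      exact ⟨hd1, hd2⟩
  refine Submodule.span_le.2 ?_
  rintro x ⟨J, hJ, rfl⟩
  exact key _ J rfl hJ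

/-- `x_K ∈ x_K² ℚW`. -/
theorem exists_sq (K : Finset B) : ∃ c, descentBasis cs K =
    descentBasis cs K * (descentBasis cs K * c) := by
  have h0 : descentBasis cs K ∈ V cs K := Submodule.subset_span ⟨K, good_self cs K, rfl⟩
  obtain ⟨y, hy, hy2⟩ := V_le cs K h0
  obtain ⟨z, hz, hz2⟩ := V_le cs K hy
  refine ⟨z, ?_⟩
  simp only [LinearMap.mulLeft_apply] at hy2 hz2
  rw [hz2, hy2]

theorem mul_sq_zero {K : Finset B} {b : MonoidAlgebra ℚ W}
    (h : b * descentBasis cs K * descentBasis cs K = 0) : b * descentBasis cs K = 0 := by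
  obtain ⟨c, hc⟩ := exists_sq cs K
  rw [hc, ← mul_assoc, ← mul_assoc, h, zero_mul]

theorem res_iff {A : Subalgebra ℚ (MonoidAlgebra ℚ W)} (hA : IsDescentAlgebra cs A)
    {K : Finset B} {R : MonoidAlgebra ℚ W →ₗ[ℚ] MonoidAlgebra ℚ W} (hR : IsResK cs K R)
    {x : MonoidAlgebra ℚ W} (hx : x ∈ A) : R x = 0 ↔ x * descentBasis cs K = 0 := by
  have hx' : x ∈ Submodule.span ℚ (Set.range (descentBasis cs)) := by
    have h : x ∈ (A : Set (MonoidAlgebra ℚ W)) := hx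
    rw [hA] at h
    exact h
  have key : R x ∈ suppK cs K ∧ descentBasis cs K * R x = x * descentBasis cs K := by
    clear hx
    induction hx' using Submodule.span_induction with
    | mem x hx =>
      obtain ⟨I, rfl⟩ := hx
      exact ⟨res_mem_suppK cs hR I, res_basis cs hR I⟩
    | zero => simp
    | add x y _ _ hx hy =>
      rw [map_add, mul_add, add_mul, hx.2, hy.2]
      exact ⟨add_mem hx.1 hy.1, rfl⟩
    | smul a x _ hx =>
      rw [map_smul, mul_smul_comm, smul_mul_assoc, hx.2]
      exact ⟨Submodule.smul_mem _ _ hx.1, rfl⟩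
  rw [← key.2]
  exact ⟨fun h => by rw [h, mul_zero], left_inj cs key.1⟩

theorem exists_split {A : Subalgebra ℚ (MonoidAlgebra ℚ W)} (hA : IsDescentAlgebra cs A)
    (K : Finset B) {x : MonoidAlgebra ℚ W} (hx : x ∈ A) :
    ∃ b ∈ A, x * descentBasis cs K = b * descentBasis cs K * descentBasis cs K := by
  have hK : descentBasis cs K ∈ A := by
    have h : descentBasis cs K ∈ (A : Set (MonoidAlgebra ℚ W)) := by
      rw [hA]
      exact Submodule.subset_span ⟨K, rfl⟩
    exact h
  have hfin : Module.Finite ℚ (MonoidAlgebra ℚ W) :=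
    Module.Finite.equiv (MonoidAlgebra.coeffLinearEquiv (M := W) (S := ℚ) ℚ).symm
  let ρ : MonoidAlgebra ℚ W →ₗ[ℚ] MonoidAlgebra ℚ W := LinearMap.mulRight ℚ (descentBasis cs K)
  let U : Submodule ℚ (MonoidAlgebra ℚ W) := A.toSubmodule.map ρ
  have hU : ∀ u ∈ U, ρ u ∈ U := by
    rintro _ ⟨b, hb, rfl⟩
    exact ⟨b * descentBasis cs K, A.mul_mem hb hK, rfl⟩
  have hinj : Function.Injective (ρ.restrict hU) := by
    rw [← LinearMap.ker_eq_bot, LinearMap.ker_eq_bot']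
    rintro ⟨_, b, hb, rfl⟩ h
    have h' := congrArg Subtype.val h
    apply Subtype.ext
    exact mul_sq_zero cs (b := b) h'
  have hsurj := LinearMap.injective_iff_surjective.1 hinj
  obtain ⟨⟨_, b, hb, rfl⟩, h⟩ := hsurj ⟨x * descentBasis cs K, x, hx, rfl⟩
  exact ⟨b, hb, (congrArg Subtype.val h).symm⟩

end DescentAux

set_option synthInstance.maxHeartbeats 1000000 in
set_option maxHeartbeats 1000000 in
/-- `Σ(W) = Ker(Res_K) ⊕ Σ(W)x_K`, and `Ker(Res_K)` is exactly the set of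
`x ∈ Σ(W)` with `x·x_K = 0`. -/
theorem resK_kernel_decomposition {M : CoxeterMatrix B}
    (cs : CoxeterSystem M W) (A : Subalgebra ℚ (MonoidAlgebra ℚ W))
    (hA : IsDescentAlgebra cs A) (K : Finset B)
    (R : MonoidAlgebra ℚ W →ₗ[ℚ] MonoidAlgebra ℚ W) (hR : IsResK cs K R) :
    (∀ x ∈ A, (R x = 0 ↔ x * descentBasis cs K = 0)) ∧
    (∀ x ∈ A, ∃ u v : MonoidAlgebra ℚ W, u ∈ A ∧ R u = 0 ∧
      (∃ b ∈ A, v = b * descentBasis cs K) ∧ x = u + v) ∧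
    (∀ u ∈ A, R u = 0 → (∃ b ∈ A, u = b * descentBasis cs K) → u = 0) := by
  refine ⟨fun x hx => DescentAux.res_iff cs hA hR hx, ?_, ?_⟩
  · intro x hx
    obtain ⟨b, hb, h⟩ := DescentAux.exists_split cs hA K hx
    have hK : descentBasis cs K ∈ A := by
      have h : descentBasis cs K ∈ (A : Set (MonoidAlgebra ℚ W)) := by
        rw [hA]
        exact Submodule.subset_span ⟨K, rfl⟩
      exact h
    have hu : x - b * descentBasis cs K ∈ A := A.sub_mem hx (A.mul_mem hb hK)
    refine ⟨x - b * descentBasis cs K, b * descentBasis cs K, hu, ?_, ⟨b, hb, rfl⟩, by simp⟩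
    rw [DescentAux.res_iff cs hA hR hu, sub_mul, h, sub_self]
  · rintro u hu hRu ⟨b, hb, rfl⟩
    rw [DescentAux.res_iff cs hA hR hu] at hRu
    exact DescentAux.mul_sq_zero cs hRu
end

section
/- Let K ⊆ S. The following are equivalent: (1) Res_K : Σ(W) → Σ(W_K) is surjective; (2) dim_Q Σ(W)x_K = 2^{|K|}; (3) Σ(W)x_K = Σ_{P(K)}(W), the span of {x_I : I ⊆ K}. -/
open MonoidAlgebra

variable {B W : Type*} [DecidableEq B] [Fintype B] [Group W] [Fintype W] [DecidableEq W]

namespace RK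
variable {B W : Type*} [Group W] {M : CoxeterMatrix B}

section cocycle
open Classical

noncomputable def pm (cs : CoxeterSystem M W) (i : B) : Equiv.Perm (W × ZMod 2) where
  toFun p := (cs.simple i * p.1 * cs.simple i, p.2 + if p.1 = cs.simple i then 1 else 0)
  invFun p := (cs.simple i * p.1 * cs.simple i, p.2 + if p.1 = cs.simple i then 1 else 0)
  left_inv := by
    rintro ⟨t, z⟩
    have h : (cs.simple i * t * cs.simple i = cs.simple i) ↔ t = cs.simple i := by
      constructor
      · intro h
        have := congrArg (fun x => cs.simple i * x) h
        simp only [← mul_assoc, cs.simple_mul_simple_self, one_mul] at this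
        have h2 := congrArg (fun x => x * cs.simple i) this
        simpa [mul_assoc] using h2
      · rintro rfl; simp
    ext
    · simp [mul_assoc]
    · simp only [h]
      by_cases h' : t = cs.simple i <;> simp [h', add_assoc, CharTwo.add_self_eq_zero]
  right_inv := by
    rintro ⟨t, z⟩
    have h : (cs.simple i * t * cs.simple i = cs.simple i) ↔ t = cs.simple i := by
      constructor
      · intro h
        have := congrArg (fun x => cs.simple i * x) h
        simp only [← mul_assoc, cs.simple_mul_simple_self, one_mul] at this
        have h2 := congrArg (fun x => x * cs.simple i) this
        simpa [mul_assoc] using h2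
      · rintro rfl; simp
    ext
    · simp [mul_assoc]
    · simp only [h]
      by_cases h' : t = cs.simple i <;> simp [h', add_assoc, CharTwo.add_self_eq_zero]

theorem pm_apply (cs : CoxeterSystem M W) (i : B) (t : W) (z : ZMod 2) :
    pm cs i (t, z) = (cs.simple i * t * cs.simple i, z + if t = cs.simple i then 1 else 0) := rfl

theorem simple_mul_pow (cs : CoxeterSystem M W) (i j : B) (n : ℕ) :
    (cs.simple i * cs.simple j) ^ n * cs.simple i =
      cs.simple i * ((cs.simple i * cs.simple j) ^ n)⁻¹ := by
  induction n with
  | zero => simp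
  | succ n ih =>
    rw [pow_succ', mul_assoc, ih, ← pow_succ', pow_succ]
    simp [mul_assoc]

theorem pm_pow (cs : CoxeterSystem M W) (i j : B) (n : ℕ) (t : W) (z : ZMod 2) :
    ((pm cs i * pm cs j) ^ n) (t, z) =
      ((cs.simple i * cs.simple j) ^ n * t * ((cs.simple i * cs.simple j) ^ n)⁻¹,
        z + ∑ k ∈ Finset.range (2 * n),
          if (cs.simple i * cs.simple j) ^ k * t = cs.simple j then 1 else 0) := by
  induction n with
  | zero => simp
  | succ n ih =>
    rw [pow_succ', Equiv.Perm.mul_apply, ih, Equiv.Perm.mul_apply, pm_apply, pm_apply]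
    set c := cs.simple i * cs.simple j with hc
    have hj : cs.simple j * c = c⁻¹ * cs.simple j := by simp [hc, mul_assoc]
    have hjn : ∀ n : ℕ, cs.simple j * c ^ n = (c ^ n)⁻¹ * cs.simple j := by
      intro n
      induction n with
      | zero => simp
      | succ n ih => rw [pow_succ, ← mul_assoc, ih, mul_assoc, hj, ← mul_assoc, ← mul_inv_rev,
          ← pow_succ', ← pow_succ]
    have e1 : (c ^ n * t * (c ^ n)⁻¹ = cs.simple j) ↔ c ^ (2 * n) * t = cs.simple j := by
      rw [mul_inv_eq_iff_eq_mul, hjn, eq_inv_mul_iff_mul_eq, ← mul_assoc, ← pow_add, two_mul]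
    have e2 : (cs.simple j * (c ^ n * t * (c ^ n)⁻¹) * cs.simple j = cs.simple i) ↔
        c ^ (2 * n + 1) * t = cs.simple j := by
      have e3 : ∀ P : W, cs.simple j * P * cs.simple j = cs.simple i ↔ c * P = cs.simple j := by
        intro P
        constructor
        · intro h
          rw [← mul_right_inj (cs.simple i), cs.simple_mul_simple_self,
            ← mul_assoc, ← mul_assoc, ← hc] at h
          rw [eq_inv_of_mul_eq_one_left h, cs.inv_simple]
        · intro h
          rw [hc] at h
          rw [← mul_right_inj (cs.simple i), ← mul_assoc, ← mul_assoc, h]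
          simp
      rw [e3, ← mul_assoc, ← mul_assoc, ← pow_succ', mul_inv_eq_iff_eq_mul, hjn,
        eq_inv_mul_iff_mul_eq, ← mul_assoc, ← pow_add, show n + (n + 1) = 2 * n + 1 by ring]
    rw [show 2 * (n + 1) = 2 * n + 1 + 1 by ring, Finset.sum_range_succ, Finset.sum_range_succ]
    ext
    · simp [pow_succ', mul_assoc, hc]
    · simp only [e1, e2, add_assoc]

theorem pm_liftable (cs : CoxeterSystem M W) : M.IsLiftable (pm cs) := by
  intro i j
  ext1 ⟨t, z⟩
  rw [pm_pow, cs.simple_mul_simple_pow, two_mul, Finset.sum_range_add]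
  simp [pow_add, cs.simple_mul_simple_pow, CharTwo.add_self_eq_zero]

noncomputable def eta (cs : CoxeterSystem M W) : W →* Equiv.Perm (W × ZMod 2) :=
  cs.lift ⟨pm cs, pm_liftable cs⟩

noncomputable def N (cs : CoxeterSystem M W) (w t : W) : ZMod 2 := (eta cs w (t, 0)).2

theorem eta_simple (cs : CoxeterSystem M W) (i : B) : eta cs (cs.simple i) = pm cs i :=
  cs.lift_apply_simple _ i

theorem eta_apply (cs : CoxeterSystem M W) (w t : W) (z : ZMod 2) :
    eta cs w (t, z) = (w * t * w⁻¹, z + N cs w t) := by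
  unfold N
  induction w using cs.simple_induction_left generalizing t z with
  | one => simp
  | mul_simple_left w i ih =>
    rw [map_mul, Equiv.Perm.mul_apply, Equiv.Perm.mul_apply, ih t z, ih t 0, eta_simple, pm_apply,
      pm_apply]
    simp [mul_assoc, add_assoc]

theorem N_mul (cs : CoxeterSystem M W) (u w t : W) :
    N cs (u * w) t = N cs w t + N cs u (w * t * w⁻¹) := by
  conv_lhs => rw [N, map_mul, Equiv.Perm.mul_apply, eta_apply, eta_apply]
  simp

theorem N_one (cs : CoxeterSystem M W) (t : W) : N cs 1 t = 0 := by simp [N]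

theorem N_simple (cs : CoxeterSystem M W) (i : B) (t : W) :
    N cs (cs.simple i) t = if t = cs.simple i then 1 else 0 := by
  rw [N, eta_simple, pm_apply]; simp

theorem exists_erase (cs : CoxeterSystem M W) (ω : List B) (t : W)
    (h : N cs (cs.wordProd ω) t ≠ 0) :
    ∃ j < ω.length, cs.wordProd ω * t = cs.wordProd (ω.eraseIdx j) := by
  induction ω with
  | nil => simp [N_one] at h
  | cons i ω ih =>
    rw [cs.wordProd_cons, N_mul, N_simple] at h
    by_cases h1 : N cs (cs.wordProd ω) t = 0
    · have h2 : cs.wordProd ω * t * (cs.wordProd ω)⁻¹ = cs.simple i := by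
        by_contra h2; simp [h1, h2] at h
      refine ⟨0, by simp, ?_⟩
      rw [mul_inv_eq_iff_eq_mul] at h2
      simp [cs.wordProd_cons, mul_assoc, h2]
    · obtain ⟨j, hj, e⟩ := ih h1
      refine ⟨j + 1, by simpa using hj, ?_⟩
      simp [cs.wordProd_cons, mul_assoc, e]

theorem N_refl (cs : CoxeterSystem M W) {t : W} (ht : cs.IsReflection t) : N cs t t = 1 := by
  obtain ⟨w, i, rfl⟩ := ht
  have h := N_mul cs w w⁻¹ (w * cs.simple i * w⁻¹)
  rw [mul_inv_cancel, N_one] at h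
  rw [mul_assoc w, N_mul, N_mul, N_simple]
  simp only [inv_inv, mul_assoc, inv_mul_cancel, mul_one, inv_mul_cancel_left, if_true, mul_inv_rev,
    cs.simple_mul_simple_cancel_left, cs.inv_simple] at h ⊢
  rw [add_right_comm, ← h, zero_add]

theorem lt_of_N_ne (cs : CoxeterSystem M W) (w t : W) (h : N cs w t ≠ 0) :
    cs.length (w * t) < cs.length w := by
  obtain ⟨ω, hω, rfl⟩ := cs.exists_isReduced w
  obtain ⟨j, hj, e⟩ := exists_erase cs ω t h
  rw [e, hω.eq]
  refine (cs.length_wordProd_le _).trans_lt ?_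
  rw [List.length_eraseIdx_of_lt hj]; omega

theorem lt_iff (cs : CoxeterSystem M W) {w t : W} (ht : cs.IsReflection t) :
    cs.length w < cs.length (w * t) ↔ N cs w t = 0 := by
  constructor
  · intro h
    by_contra h1
    have := lt_of_N_ne cs w t h1
    omega
  · intro h
    have := lt_of_N_ne cs (w * t) t (by rw [N_mul, N_refl cs ht]; simp [h])
    rwa [mul_assoc, ht.mul_self, mul_one] at this

theorem lt_iff' (cs : CoxeterSystem M W) {w : W} (i : B) :
    cs.length w < cs.length (w * cs.simple i) ↔ N cs w (cs.simple i) = 0 :=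
  lt_iff cs (cs.isReflection_simple i)

end cocycle
end RK

namespace RK
section geom
open Module Real
variable {B W : Type*} [Group W] {M : CoxeterMatrix B}

noncomputable def gf (M : CoxeterMatrix B) (i : B) : Dual ℝ (B →₀ ℝ) :=
  Finsupp.linearCombination ℝ (fun j => -2 * cos (π / M i j))

theorem gf_single (i j : B) : gf M i (Finsupp.single j 1) = -2 * cos (π / M i j) := by
  simp [gf]

theorem gf_self (i : B) : gf M i (Finsupp.single i 1) = 2 := by
  rw [gf_single]; simp

open Polynomial.Chebyshev in
theorem dih_pow {V : Type*} [AddCommGroup V] [Module ℝ V] {x y : V} {f g : Dual ℝ V}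
    (hf : f x = 2) (hg : g y = 2) (m : ℕ) (hm : 2 ≤ m) (hfy : f y = -2 * cos (π / m))
    (hgx : g x = -2 * cos (π / m)) : (reflection hf * reflection hg) ^ m = 1 := by
  rcases hm.eq_or_lt with rfl | hm
  · have h0 : cos (π / (2 : ℕ)) = 0 := by simp
    rw [h0, mul_zero] at hfy hgx
    ext z
    simp [pow_two, LinearEquiv.mul_apply, reflection_apply, hf, hg, hfy, hgx]
    module
  · have hm0 : (m : ℝ) ≠ 0 := by positivity
    have ht : 2 * cos (2 * π / m) = f y * g x - 2 := by
      rw [hfy, hgx, mul_div_assoc, cos_two_mul]; ring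
    have hs : sin (2 * π / m) ≠ 0 := by
      apply ne_of_gt
      apply sin_pos_of_pos_of_lt_pi (by positivity)
      rw [div_lt_iff₀ (by positivity)]
      have : (3 : ℝ) ≤ m := by exact_mod_cast hm
      nlinarith [pi_pos]
    have hS := fun n : ℤ => S_two_mul_real_cos (2 * π / m) n
    ext z
    rw [reflection_mul_reflection_pow_apply hf hg m z _ ht]
    obtain ⟨k, hk | hk⟩ := m.even_or_odd'
    · have h1 : (S ℝ ((k : ℤ) - 1)).eval (2 * cos (2 * π / m)) = 0 := by
        have h := hS (k - 1)
        rw [show (((k : ℤ) - 1 : ℤ) + 1 : ℝ) * (2 * π / m) = π by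
          have hk0 : (k : ℝ) ≠ 0 := by
            have : k ≠ 0 := by omega
            exact_mod_cast this
          rw [hk]; push_cast; field_simp; ring, sin_pi] at h
        exact (mul_eq_zero.mp h).resolve_right hs
      rw [show ((m : ℤ) - 2) / 2 = k - 1 by omega, show ((m : ℤ) - 1) / 2 = k - 1 by omega, h1]
      simp
    · have h1 : (S ℝ (k : ℤ)).eval (2 * cos (2 * π / m)) +
          (S ℝ ((k : ℤ) - 1)).eval (2 * cos (2 * π / m)) = 0 := by
        have h := hS (k - 1)
        have h' := hS k
        rw [show (((k : ℤ) - 1 : ℤ) + 1 : ℝ) * (2 * π / m) =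
          2 * π - (((k : ℤ) : ℝ) + 1) * (2 * π / m) by
          rw [hk] at hm0 ⊢; push_cast at hm0 ⊢; field_simp; ring, sin_two_pi_sub, ← h'] at h
        have : ((S ℝ (k : ℤ)).eval (2 * cos (2 * π / m)) +
          (S ℝ ((k : ℤ) - 1)).eval (2 * cos (2 * π / m))) * sin (2 * π / m) = 0 := by
          linear_combination h
        exact (mul_eq_zero.mp this).resolve_right hs
      rw [show ((m : ℤ) - 2) / 2 = k - 1 by omega, show ((m : ℤ) - 1) / 2 = k by omega,
        show ((m : ℤ) - 3) / 2 = k - 1 by omega, show (m : ℤ) / 2 = k by omega, h1]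
      simp

theorem geom_liftable (M : CoxeterMatrix B) :
    M.IsLiftable (fun i => reflection (gf_self (M := M) i)) := by
  intro i j
  by_cases hij : i = j
  · subst hij
    show (reflection (gf_self (M := M) i) * reflection (gf_self (M := M) i)) ^ M i i = 1
    rw [M.diagonal, pow_one]
    refine LinearEquiv.ext fun z => ?_
    rw [LinearEquiv.mul_apply]
    exact involutive_reflection (gf_self (M := M) i) z
  · by_cases h0 : M i j = 0
    · rw [h0, pow_zero]
    · have h1 := M.off_diagonal i j hij
      exact dih_pow _ _ _ (by omega) (gf_single i j) (by rw [gf_single, M.symmetric])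

theorem simple_inj (cs : CoxeterSystem M W) {i j : B} (h : cs.simple i = cs.simple j) : i = j := by
  by_contra hij
  have h1 := congrArg (cs.lift ⟨_, geom_liftable M⟩) h
  rw [cs.lift_apply_simple, cs.lift_apply_simple] at h1
  have h2 := DFunLike.congr_fun (DFunLike.congr_fun h1 (Finsupp.single i 1)) i
  rw [reflection_apply_self, reflection_apply] at h2
  simp [Ne.symm hij] at h2
  norm_num at h2

end geom
end RK

namespace RK
set_option linter.unusedSectionVars false
section par
variable {B W : Type*} [DecidableEq B] [Fintype B] [Group W] [Fintype W] [DecidableEq W]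
  {M : CoxeterMatrix B}

/-- `w` is a minimal length representative of `w W_I`. -/
def asc (cs : CoxeterSystem M W) (I : Finset B) (w : W) : Prop :=
  ∀ i ∈ I, cs.length w < cs.length (w * cs.simple i)

theorem asc_iff (cs : CoxeterSystem M W) (I : Finset B) (w : W) :
    asc cs I w ↔ ∀ i ∈ I, N cs w (cs.simple i) = 0 := by
  simp only [asc, lt_iff']

theorem exists_word (cs : CoxeterSystem M W) (K : Finset B) {w : W} (hw : w ∈ parabolic cs K) :
    ∃ ω : List B, (∀ i ∈ ω, i ∈ K) ∧ cs.wordProd ω = w := by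
  induction hw using Subgroup.closure_induction with
  | mem x hx =>
    obtain ⟨i, hi, rfl⟩ := hx
    exact ⟨[i], by simpa using hi, by simp⟩
  | one => exact ⟨[], by simp, by simp⟩
  | mul x y _ _ hx hy =>
    obtain ⟨a, ha, rfl⟩ := hx
    obtain ⟨b, hb, rfl⟩ := hy
    refine ⟨a ++ b, ?_, cs.wordProd_append a b⟩
    intro i hi
    rcases List.mem_append.mp hi with h | h
    exacts [ha i h, hb i h]
  | inv x _ hx =>
    obtain ⟨a, ha, rfl⟩ := hx
    exact ⟨a.reverse, by simpa using ha, by simp⟩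

theorem word_mem (cs : CoxeterSystem M W) (K : Finset B) (ω : List B) (h : ∀ i ∈ ω, i ∈ K) :
    cs.wordProd ω ∈ parabolic cs K := by
  induction ω with
  | nil => simp [one_mem]
  | cons i ω ih =>
    rw [cs.wordProd_cons]
    refine mul_mem (Subgroup.subset_closure ⟨i, ?_, rfl⟩) (ih fun j hj => h j (by simp [hj]))
    exact h i (by simp)

theorem simple_mem (cs : CoxeterSystem M W) {K : Finset B} {i : B} (h : i ∈ K) :
    cs.simple i ∈ parabolic cs K := Subgroup.subset_closure ⟨i, h, rfl⟩

/-- Inversions of elements of `W_K` are in `W_K`. -/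
theorem mem_of_N (cs : CoxeterSystem M W) (K : Finset B) {u t : W} (hu : u ∈ parabolic cs K)
    (h : N cs u t ≠ 0) : t ∈ parabolic cs K := by
  obtain ⟨ω, hω, rfl⟩ := exists_word cs K hu
  obtain ⟨j, hj, e⟩ := exists_erase cs ω t h
  rw [← Subgroup.mul_mem_cancel_left _ hu, e]
  exact word_mem cs K _ fun i hi => hω i (List.mem_of_mem_eraseIdx hi)

theorem eq_one_of_asc (cs : CoxeterSystem M W) (K : Finset B) {u : W} (hu : u ∈ parabolic cs K)
    (h : asc cs K u) : u = 1 := by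
  classical
  have hex : ∃ n, ∃ ω : List B, (∀ i ∈ ω, i ∈ K) ∧ cs.wordProd ω = u ∧ ω.length = n := by
    obtain ⟨ω, h1, h2⟩ := exists_word cs K hu
    exact ⟨_, ω, h1, h2, rfl⟩
  obtain ⟨ω, h1, h2, h3⟩ := Nat.find_spec hex
  rcases List.eq_nil_or_concat ω with rfl | ⟨ω', i, rfl⟩
  · simpa using h2.symm
  · exfalso
    rw [cs.wordProd_concat] at h2
    have hiK : i ∈ K := h1 i (by simp)
    have hN := (asc_iff cs K u).mp h i hiK
    rw [← h2, N_mul, N_simple] at hN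
    have h4 : N cs (cs.wordProd ω') (cs.simple i) ≠ 0 := by
      intro h5
      simp [h5] at hN
    obtain ⟨j, hj, e⟩ := exists_erase cs ω' _ h4
    refine Nat.find_min hex (m := (ω'.eraseIdx j).length) ?_ ⟨_, ?_, e.symm.trans h2, rfl⟩
    · rw [← h3, List.length_eraseIdx_of_lt hj]; simp
    · intro k hk
      exact h1 k (by simp [List.mem_of_mem_eraseIdx hk])

theorem N_of_min (cs : CoxeterSystem M W) (K : Finset B) {y : W}
    (hy : ∀ v ∈ parabolic cs K, cs.length y ≤ cs.length (y * v)) {t : W}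
    (ht : cs.IsReflection t) (htK : t ∈ parabolic cs K) : N cs y t = 0 := by
  rw [← lt_iff cs ht]
  exact lt_of_le_of_ne (hy t htK) (ht.length_mul_left_ne y).symm

theorem N_mul_of_min (cs : CoxeterSystem M W) (K : Finset B) {y : W}
    (hy : ∀ v ∈ parabolic cs K, cs.length y ≤ cs.length (y * v)) {u : W}
    (hu : u ∈ parabolic cs K) {i : B} (hi : i ∈ K) :
    N cs (y * u) (cs.simple i) = N cs u (cs.simple i) := by
  rw [N_mul, N_of_min cs K hy ((cs.isReflection_simple i).conj u), add_zero]
  exact mul_mem (mul_mem hu (simple_mem cs hi)) (inv_mem hu)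

theorem exists_min (cs : CoxeterSystem M W) (K : Finset B) (w : W) :
    ∃ v ∈ parabolic cs K, ∀ v' ∈ parabolic cs K,
      cs.length (w * v) ≤ cs.length (w * v * v') := by
  obtain ⟨v, hv, h⟩ := Set.exists_min_image (parabolic cs K : Set W)
    (fun v => cs.length (w * v)) (Set.toFinite _) ⟨1, one_mem _⟩
  exact ⟨v, hv, fun v' hv' => by rw [mul_assoc]; exact h _ (mul_mem hv hv')⟩

theorem asc_of_min (cs : CoxeterSystem M W) (K : Finset B) {y : W}
    (hy : ∀ v ∈ parabolic cs K, cs.length y ≤ cs.length (y * v)) : asc cs K y := by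
  rw [asc_iff]
  intro i hi
  exact N_of_min cs K hy (cs.isReflection_simple i) (simple_mem cs hi)

theorem min_of_asc (cs : CoxeterSystem M W) (K : Finset B) {x : W} (hx : asc cs K x) :
    ∀ v ∈ parabolic cs K, cs.length x ≤ cs.length (x * v) := by
  obtain ⟨v, hv, h⟩ := exists_min cs K x
  have h1 : v⁻¹ = 1 := by
    refine eq_one_of_asc cs K (inv_mem hv) ?_
    rw [asc_iff] at hx ⊢
    intro i hi
    rw [← N_mul_of_min cs K h (inv_mem hv) hi, mul_inv_cancel_right, hx i hi]
  rw [inv_eq_one] at h1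
  simpa [h1] using h

theorem exists_decomp (cs : CoxeterSystem M W) (K : Finset B) (w : W) :
    ∃ x u, asc cs K x ∧ u ∈ parabolic cs K ∧ x * u = w := by
  obtain ⟨v, hv, h⟩ := exists_min cs K w
  exact ⟨w * v, v⁻¹, asc_of_min cs K h, inv_mem hv, by simp⟩

theorem decomp_unique (cs : CoxeterSystem M W) (K : Finset B) {x u x' u' : W} (hx : asc cs K x)
    (hu : u ∈ parabolic cs K) (hx' : asc cs K x') (hu' : u' ∈ parabolic cs K)
    (h : x * u = x' * u') : x = x' ∧ u = u' := by
  have hv : u * u'⁻¹ ∈ parabolic cs K := mul_mem hu (inv_mem hu')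
  have e : x' = x * (u * u'⁻¹) := by rw [← mul_assoc, h]; simp
  have h1 : u * u'⁻¹ = 1 := by
    refine eq_one_of_asc cs K hv ?_
    rw [asc_iff] at hx' ⊢
    intro i hi
    rw [← N_mul_of_min cs K (min_of_asc cs K hx) hv hi, ← e, hx' i hi]
  rw [h1, mul_one] at e
  exact ⟨e.symm, mul_inv_eq_one.mp h1⟩

theorem length_add (cs : CoxeterSystem M W) (K : Finset B) {x : W} (hx : asc cs K x) :
    ∀ n : ℕ, ∀ u ∈ parabolic cs K, cs.length u = n →
      cs.length (x * u) = cs.length x + cs.length u := by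
  intro n
  induction n with
  | zero =>
    intro u _ h
    rw [cs.length_eq_zero_iff] at h
    simp [h]
  | succ n ih =>
    intro u hu h
    have h1 : ¬ asc cs K u := by
      intro h1
      rw [eq_one_of_asc cs K hu h1] at h
      simp at h
    unfold asc at h1
    push Not at h1
    obtain ⟨i, hi, h1⟩ := h1
    have h2 : ¬ cs.length (x * u) < cs.length (x * u * cs.simple i) := by
      rw [lt_iff', N_mul_of_min cs K (min_of_asc cs K hx) hu hi, ← lt_iff']
      omega
    have h3 := cs.length_mul_simple u i
    have h4 := cs.length_mul_simple (x * u) i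
    have h5 := ih (u * cs.simple i) (mul_mem hu (simple_mem cs hi)) (by omega)
    rw [← mul_assoc] at h5
    omega

/-- If `d⁻¹` conjugates `s_k` into `W_I`, `d ∈ X_{KI}`, then the image is simple in `I`. -/
theorem conj_simple (cs : CoxeterSystem M W) {K I : Finset B} {d : W} (hd : memXKI cs K I d)
    {k : B} (hk : k ∈ K) (ht : d⁻¹ * cs.simple k * d ∈ parabolic cs I) :
    ∃ i ∈ I, cs.simple i = d⁻¹ * cs.simple k * d := by
  set t := d⁻¹ * cs.simple k * d with htd
  have h1 := length_add cs I hd.2 _ t ht rfl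
  have h2 : d * t = (d⁻¹ * cs.simple k)⁻¹ := by simp [htd, mul_assoc]
  rw [h2, cs.length_inv] at h1
  have h3 := cs.length_mul_simple d⁻¹ k
  have h4 := hd.1 k hk
  rw [cs.length_inv d] at h3 h4
  have h5 : cs.length t = 1 := by omega
  have h6 : ¬ asc cs I t := by
    intro h6
    rw [eq_one_of_asc cs I ht h6] at h5
    simp at h5
  unfold asc at h6
  push Not at h6
  obtain ⟨i, hi, h6⟩ := h6
  refine ⟨i, hi, ?_⟩
  have h7 := cs.length_mul_simple t i
  have h8 : cs.length (t * cs.simple i) = 0 := by omega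
  rw [cs.length_eq_zero_iff, mul_eq_one_iff_eq_inv, cs.inv_simple] at h8
  exact h8.symm

open scoped Classical in
/-- `I ∩ d⁻¹ K d`. -/
noncomputable def ic (cs : CoxeterSystem M W) (I K : Finset B) (d : W) : Finset B :=
  I.filter (fun i => ∃ k ∈ K, cs.simple i = d⁻¹ * cs.simple k * d)

open scoped Classical in
/-- `K ∩ d I d⁻¹`. -/
noncomputable def kc (cs : CoxeterSystem M W) (K I : Finset B) (d : W) : Finset B :=
  K.filter (fun j => ∃ i ∈ I, cs.simple j = d * cs.simple i * d⁻¹)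

theorem asc_conj (cs : CoxeterSystem M W) {K I : Finset B} {d : W} (hd : memXKI cs K I d) (w : W) :
    asc cs (ic cs I K d) w ↔ asc cs (kc cs K I d) (w * d⁻¹) := by
  have key : ∀ i k, k ∈ K → cs.simple i = d⁻¹ * cs.simple k * d →
      N cs (w * d⁻¹) (cs.simple k) = N cs w (cs.simple i) := by
    intro i k hk e
    rw [N_mul, (lt_iff' cs k).mp (hd.1 k hk), zero_add, inv_inv, e]
  rw [asc_iff, asc_iff]
  simp only [ic, kc, Finset.mem_filter]
  constructor
  · rintro h k ⟨hk, i, hi, e⟩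
    have e' : cs.simple i = d⁻¹ * cs.simple k * d := by rw [e]; simp [mul_assoc]
    rw [key i k hk e', h i ⟨hi, k, hk, e'⟩]
  · rintro h i ⟨hi, k, hk, e⟩
    rw [← key i k hk e, h k ⟨hk, i, hi, by rw [e]; simp [mul_assoc]⟩]

/-- For `d⁻¹` minimal in `W_I d⁻¹` and `u ∈ W_I`: `u d⁻¹ ∈ X_K` iff `d ∈ X_{KI}` and
`u ∈ X_{I ∩ d⁻¹ K d}`. -/
theorem asc_mul_inv (cs : CoxeterSystem M W) (K I : Finset B) {d u : W} (hd : asc cs I d)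
    (hu : u ∈ parabolic cs I) :
    asc cs K (u * d⁻¹) ↔ memXKI cs K I d ∧ asc cs (ic cs I K d) u := by
  have hmul : ∀ k, N cs (u * d⁻¹) (cs.simple k) =
      N cs d⁻¹ (cs.simple k) + N cs u (d⁻¹ * cs.simple k * d) := by
    intro k; rw [N_mul, inv_inv]
  constructor
  · intro h
    rw [asc_iff] at h
    have h1 : ∀ k ∈ K, N cs d⁻¹ (cs.simple k) = 0 := by
      intro k hk
      by_cases h2 : N cs u (d⁻¹ * cs.simple k * d) = 0
      · have := h k hk
        rwa [hmul, h2, add_zero] at this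
      · have h3 := mem_of_N cs I hu h2
        have h4 := min_of_asc cs I hd _ h3
        rw [show d * (d⁻¹ * cs.simple k * d) = (d⁻¹ * cs.simple k)⁻¹ by simp [mul_assoc],
          cs.length_inv, ← cs.length_inv d] at h4
        rw [← lt_iff']
        exact lt_of_le_of_ne h4 (cs.length_mul_simple_ne _ _).symm
    refine ⟨⟨fun k hk => (lt_iff' cs k).mpr (h1 k hk), hd⟩, ?_⟩
    rw [asc_iff]
    intro i hi
    simp only [ic, Finset.mem_filter] at hi
    obtain ⟨hi, k, hk, e⟩ := hi
    have := h k hk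
    rwa [hmul, h1 k hk, zero_add, ← e] at this
  · rintro ⟨hX, h⟩
    rw [asc_iff] at h ⊢
    intro k hk
    rw [hmul, (lt_iff' cs k).mp (hX.1 k hk), zero_add]
    by_contra h2
    obtain ⟨i, hi, e⟩ := conj_simple cs hX hk (mem_of_N cs I hu h2)
    rw [← e] at h2
    exact h2 (h i (by simp only [ic, Finset.mem_filter]; exact ⟨hi, k, hk, e⟩))

theorem exists_class (cs : CoxeterSystem M W) (J : Finset B) :
    ∃ w : W, ∀ I : Finset B, asc cs I w ↔ Disjoint I J := by
  obtain ⟨w, hw, h⟩ := Set.exists_max_image (parabolic cs J : Set W)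
    (fun v => cs.length v) (Set.toFinite _) ⟨1, one_mem _⟩
  refine ⟨w, fun I => ?_⟩
  have key : ∀ i, cs.length w < cs.length (w * cs.simple i) ↔ i ∉ J := by
    intro i
    constructor
    · intro h1 h2
      have := h _ (mul_mem hw (simple_mem cs h2))
      omega
    · intro h1
      rw [lt_iff']
      by_contra h2
      have h3 := mem_of_N cs J hw h2
      have h4 : ¬ asc cs J (cs.simple i) := by
        intro h4
        have := cs.length_simple i
        rw [eq_one_of_asc cs J h3 h4] at this
        simp at this
      rw [asc_iff] at h4
      push Not at h4
      obtain ⟨j, hj, h4⟩ := h4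
      rw [N_simple] at h4
      have h5 : cs.simple j = cs.simple i := by
        by_contra h5; simp [h5] at h4
      exact h1 (simple_inj cs h5 ▸ hj)
  rw [Finset.disjoint_left]
  exact forall₂_congr fun i _ => key i

end par
end RK

namespace RK
section alg
set_option linter.unusedSectionVars false
variable {B W : Type*} [DecidableEq B] [Fintype B] [Group W] [Fintype W] [DecidableEq W]
  {M : CoxeterMatrix B}

open scoped Classical in
theorem db_eq (cs : CoxeterSystem M W) (I : Finset B) :
    descentBasis cs I = ∑ w ∈ Finset.univ.filter (asc cs I), MonoidAlgebra.single w (1 : ℚ) := by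
  rw [Finset.sum_filter, descentBasis]
  refine Finset.sum_congr rfl fun w _ => ?_
  unfold asc
  congr

open scoped Classical in
theorem pdb_eq (cs : CoxeterSystem M W) (K I : Finset B) :
    parDescentBasis cs K I = ∑ w ∈ Finset.univ.filter
      (fun w => w ∈ parabolic cs K ∧ asc cs I w), MonoidAlgebra.single w (1 : ℚ) := by
  rw [Finset.sum_filter, parDescentBasis]
  refine Finset.sum_congr rfl fun w _ => ?_
  unfold asc
  congr

theorem db_mul_pdb (cs : CoxeterSystem M W) {K J : Finset B} (hJ : J ⊆ K) :
    descentBasis cs K * parDescentBasis cs K J = descentBasis cs J := by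
  classical
  rw [db_eq, pdb_eq, db_eq, Finset.sum_mul_sum, ← Finset.sum_product']
  have hN : ∀ {x u : W}, asc cs K x → u ∈ parabolic cs K →
      (asc cs J (x * u) ↔ asc cs J u) := by
    intro x u hx hu
    rw [asc_iff, asc_iff]
    refine forall₂_congr fun i hi => ?_
    rw [N_mul_of_min cs K (min_of_asc cs K hx) hu (hJ hi)]
  refine Finset.sum_bij (fun p _ => p.1 * p.2) ?_ ?_ ?_ ?_
  · rintro ⟨x, u⟩ h
    simp only [Finset.mem_product, Finset.mem_filter, Finset.mem_univ, true_and] at h ⊢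
    exact (hN h.1 h.2.1).mpr h.2.2
  · rintro ⟨x, u⟩ h ⟨x', u'⟩ h' e
    simp only [Finset.mem_product, Finset.mem_filter, Finset.mem_univ, true_and] at h h' e
    obtain ⟨rfl, rfl⟩ := decomp_unique cs K h.1 h.2.1 h'.1 h'.2.1 e
    rfl
  · intro w hw
    simp only [Finset.mem_filter, Finset.mem_univ, true_and] at hw
    obtain ⟨x, u, hx, hu, rfl⟩ := exists_decomp cs K w
    refine ⟨(x, u), ?_, rfl⟩
    simp only [Finset.mem_product, Finset.mem_filter, Finset.mem_univ, true_and]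
    exact ⟨hx, hu, (hN hx hu).mp hw⟩
  · rintro ⟨x, u⟩ _
    simp [MonoidAlgebra.single_mul_single]

open scoped Classical in
theorem db_decomp (cs : CoxeterSystem M W) (K I : Finset B) :
    descentBasis cs K = ∑ d ∈ Finset.univ.filter (memXKI cs K I),
      parDescentBasis cs I (ic cs I K d) * MonoidAlgebra.single d⁻¹ (1 : ℚ) := by
  simp only [pdb_eq, Finset.sum_mul, MonoidAlgebra.single_mul_single, mul_one]
  rw [db_eq, Finset.sum_sigma']
  symm
  refine Finset.sum_bij (fun p _ => p.2 * p.1⁻¹) ?_ ?_ ?_ ?_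
  · rintro ⟨d, u⟩ h
    simp only [Finset.mem_sigma, Finset.mem_filter, Finset.mem_univ, true_and] at h ⊢
    exact (asc_mul_inv cs K I h.1.2 h.2.1).mpr ⟨h.1, h.2.2⟩
  · rintro ⟨d, u⟩ h ⟨d', u'⟩ h' e
    simp only [Finset.mem_sigma, Finset.mem_filter, Finset.mem_univ, true_and] at h h' e
    have e' : d * u⁻¹ = d' * u'⁻¹ := by simpa using congrArg (·⁻¹) e
    obtain ⟨rfl, h2⟩ := decomp_unique cs I h.1.2 (inv_mem h.2.1) h'.1.2 (inv_mem h'.2.1) e'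
    rw [inv_inj] at h2
    subst h2
    rfl
  · intro w hw
    simp only [Finset.mem_filter, Finset.mem_univ, true_and] at hw
    obtain ⟨d, u, hd, hu, e⟩ := exists_decomp cs I w⁻¹
    have e' : w = u⁻¹ * d⁻¹ := by rw [← mul_inv_rev, e, inv_inv]
    subst e'
    obtain ⟨h1, h2⟩ := (asc_mul_inv cs K I hd (inv_mem hu)).mp hw
    refine ⟨⟨d, u⁻¹⟩, ?_, rfl⟩
    simp only [Finset.mem_sigma, Finset.mem_filter, Finset.mem_univ, true_and]
    exact ⟨h1, inv_mem hu, h2⟩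
  · rintro ⟨d, u⟩ _
    rfl

theorem db_conj (cs : CoxeterSystem M W) {K I : Finset B} {d : W} (hd : memXKI cs K I d) :
    descentBasis cs (ic cs I K d) * MonoidAlgebra.single d⁻¹ (1 : ℚ) =
      descentBasis cs (kc cs K I d) := by
  classical
  rw [db_eq, db_eq, Finset.sum_mul]
  simp only [MonoidAlgebra.single_mul_single, mul_one]
  refine Finset.sum_bij (fun w _ => w * d⁻¹) ?_ ?_ ?_ ?_
  · intro w hw
    simp only [Finset.mem_filter, Finset.mem_univ, true_and] at hw ⊢
    exact (asc_conj cs hd w).mp hw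
  · intro a _ b _ e
    exact mul_right_cancel e
  · intro w hw
    simp only [Finset.mem_filter, Finset.mem_univ, true_and] at hw
    refine ⟨w * d, ?_, by simp⟩
    simp only [Finset.mem_filter, Finset.mem_univ, true_and]
    rw [asc_conj cs hd]
    simpa using hw
  · intro a _
    rfl

theorem solomon (cs : CoxeterSystem M W) (K : Finset B)
    (R : MonoidAlgebra ℚ W →ₗ[ℚ] MonoidAlgebra ℚ W) (hR : IsResK cs K R) (I : Finset B) :
    descentBasis cs I * descentBasis cs K = descentBasis cs K * R (descentBasis cs I) := by
  classical
  have h1 : R (descentBasis cs I) = ∑ d ∈ Finset.univ.filter (memXKI cs K I),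
      parDescentBasis cs K (kc cs K I d) := by
    rw [hR I, Finset.sum_filter]
    refine Finset.sum_congr rfl fun w _ => ?_
    unfold kc
    congr
  rw [h1, Finset.mul_sum, db_decomp cs K I, Finset.mul_sum]
  refine Finset.sum_congr rfl fun d hd => ?_
  rw [← db_decomp cs K I]
  rw [Finset.mem_filter] at hd
  rw [← mul_assoc, db_mul_pdb cs (show ic cs I K d ⊆ I from Finset.filter_subset _ _),
    db_conj cs hd.2, db_mul_pdb cs (show kc cs K I d ⊆ K from Finset.filter_subset _ _)]

theorem db_coeff (cs : CoxeterSystem M W) (I : Finset B) (w : W) [Decidable (asc cs I w)] :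
    (descentBasis cs I).coeff w = if asc cs I w then 1 else 0 := by
  classical
  rw [db_eq, MonoidAlgebra.coeff_sum, Finsupp.finsetSum_apply]
  simp [MonoidAlgebra.coeff_single, Finsupp.single_apply]

theorem db_linInd (cs : CoxeterSystem M W) : LinearIndependent ℚ (descentBasis cs) := by
  classical
  rw [Fintype.linearIndependent_iff]
  intro c hc
  have h1 : ∀ J : Finset B, ∑ I ∈ J.powerset, c I = 0 := by
    intro J
    obtain ⟨w, hw⟩ := exists_class cs Jᶜ
    have h2 := congrArg (fun x => x.coeff w) hc
    simp only [MonoidAlgebra.coeff_sum, Finsupp.finsetSum_apply, MonoidAlgebra.coeff_smul,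
      Finsupp.smul_apply, db_coeff, hw, MonoidAlgebra.coeff_zero, Finsupp.zero_apply,
      smul_eq_mul, mul_ite, mul_one, mul_zero] at h2
    rw [← Finset.sum_filter] at h2
    rw [← h2]
    refine Finset.sum_congr ?_ fun _ _ => rfl
    ext I
    simp [disjoint_compl_right_iff]
  intro I
  induction I using Finset.strongInduction with
  | H I ih =>
    have h := h1 I
    rw [← Finset.sum_erase_add _ _ (Finset.mem_powerset_self I)] at h
    rw [Finset.sum_eq_zero, zero_add] at h
    · exact h
    · intro J hJ
      rw [Finset.mem_erase, Finset.mem_powerset] at hJ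
      exact ih J (lt_of_le_of_ne hJ.2 hJ.1)

end alg
end RK

set_option synthInstance.maxHeartbeats 1000000 in
set_option maxHeartbeats 1000000 in
/-- The following are equivalent: (1) `Res_K : Σ(W) → Σ(W_K)` is surjective;
(2) `dim_ℚ Σ(W)x_K = 2^{|K|}`; (3) `Σ(W)x_K` equals the span of `{x_I : I ⊆ K}`. -/
theorem resK_surjective_tfae {M : CoxeterMatrix B}
    (cs : CoxeterSystem M W) (A : Subalgebra ℚ (MonoidAlgebra ℚ W))
    (hA : IsDescentAlgebra cs A) (K : Finset B)
    (R : MonoidAlgebra ℚ W →ₗ[ℚ] MonoidAlgebra ℚ W) (hR : IsResK cs K R) :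
    ((∀ y ∈ Submodule.span ℚ (parDescentBasis cs K '' {I : Finset B | I ⊆ K}),
        ∃ x ∈ A, R x = y) ↔
      Module.finrank ℚ
        (Submodule.map (LinearMap.mulRight ℚ (descentBasis cs K))
          (Subalgebra.toSubmodule A)) = 2 ^ K.card) ∧
    (Module.finrank ℚ
        (Submodule.map (LinearMap.mulRight ℚ (descentBasis cs K))
          (Subalgebra.toSubmodule A)) = 2 ^ K.card ↔
      Submodule.map (LinearMap.mulRight ℚ (descentBasis cs K))
          (Subalgebra.toSubmodule A) =
        Submodule.span ℚ (descentBasis cs '' {I : Finset B | I ⊆ K})) := by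
  classical
  set x := descentBasis cs K with hx
  set P := Submodule.span ℚ (parDescentBasis cs K '' {I : Finset B | I ⊆ K}) with hP
  set Q := Submodule.span ℚ (descentBasis cs '' {I : Finset B | I ⊆ K}) with hQ
  set L := LinearMap.mulLeft ℚ x with hL
  have hAspan : Subalgebra.toSubmodule A = Submodule.span ℚ (Set.range (descentBasis cs)) :=
    SetLike.coe_injective hA
  set S := (Subalgebra.toSubmodule A).map R with hS
  -- `Σ(W) x_K = x_K Res_K(Σ(W))`
  have hmap : (Subalgebra.toSubmodule A).map (LinearMap.mulRight ℚ x) = S.map L := by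
    rw [hS, hAspan, Submodule.map_span, Submodule.map_span, Submodule.map_span, ← Set.range_comp,
      ← Set.range_comp, ← Set.range_comp]
    congr 2
    funext I
    exact RK.solomon cs K R hR I
  have hSP : S ≤ P := by
    rw [hS, hAspan, Submodule.map_span, Submodule.span_le]
    rintro _ ⟨_, ⟨I, rfl⟩, rfl⟩
    rw [hR I]
    refine Submodule.sum_mem _ fun d _ => ?_
    split_ifs
    · exact Submodule.subset_span ⟨_, Finset.filter_subset _ _, rfl⟩
    · exact zero_mem _
  have hLp : ∀ I : Finset B, I ⊆ K → L (parDescentBasis cs K I) = descentBasis cs I :=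
    fun I hI => RK.db_mul_pdb cs hI
  have hPQ : P.map L = Q := by
    rw [hP, hQ, Submodule.map_span, ← Set.image_comp]
    congr 1
    exact Set.image_congr fun I hI => hLp I hI
  have hcard : Fintype.card {I : Finset B // I ∈ {I : Finset B | I ⊆ K}} = 2 ^ K.card := by
    rw [← Finset.card_powerset, Fintype.card_subtype]
    congr 1
    ext I
    simp
  have hQfr : Module.finrank ℚ Q = 2 ^ K.card := by
    have h := finrank_span_eq_card ((RK.db_linInd cs).comp
      (Subtype.val : {I : Finset B // I ∈ {I : Finset B | I ⊆ K}} → Finset B)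
      Subtype.val_injective)
    rw [Set.range_comp, Subtype.range_val, hcard] at h
    exact h
  have hPfr : Module.finrank ℚ P ≤ 2 ^ K.card := by
    have h := finrank_range_le_card (R := ℚ)
      (fun I : {I : Finset B // I ∈ {I : Finset B | I ⊆ K}} => parDescentBasis cs K I.1)
    rw [hcard, Set.finrank] at h
    rw [hP, Set.image_eq_range]
    exact h
  have hle : S.map L ≤ Q := hPQ ▸ Submodule.map_mono hSP
  have h23 : Module.finrank ℚ (S.map L) = 2 ^ K.card ↔ S.map L = Q := by
    constructor
    · intro h
      exact Submodule.eq_of_le_of_finrank_eq hle (h.trans hQfr.symm)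
    · intro h
      rw [h, hQfr]
  have h1 : (∀ y ∈ P, ∃ x ∈ A, R x = y) ↔ S = P := by
    constructor
    · intro h
      exact le_antisymm hSP fun y hy => h y hy
    · intro h y hy
      rw [← h] at hy
      exact hy
  rw [hmap]
  refine ⟨?_, h23⟩
  rw [h1]
  constructor
  · intro h
    rw [h23, h, hPQ]
  · intro h
    refine Submodule.eq_of_le_of_finrank_le hSP ?_
    exact hPfr.trans (h ▸ Submodule.finrank_map_le L S)
end

section
/- Let K ⊆ S and let W(K) = {w ∈ X_{KK} : wKw⁻¹ = K}, so that N_W(W_K) = W(K) ⋉ W_K. Then the image of Res_K : Σ(W) → Σ(W_K) is contained in the W(K)-fixed subalgebra Σ(W_K)^{W(K)}. Consequently, if Res_K is surjective then W(K) acts trivially on W_K and the natural map Λ_K → Λ is injective. -/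
open MonoidAlgebra

variable {B W : Type*} [DecidableEq B] [Fintype B] [Group W] [Fintype W] [DecidableEq W]

/-- `w ∈ W(K)`: `w ∈ X_{KK}` and `wKw⁻¹ = K`. -/
def memWK {M : CoxeterMatrix B} (cs : CoxeterSystem M W) (K : Finset B) (d : W) : Prop :=
  memXKI cs K K d ∧ (fun x => d * x * d⁻¹) '' (cs.simple '' (K : Set B)) =
    cs.simple '' (K : Set B)

namespace ResKAux

set_option linter.unusedSectionVars false

section Coxeter

variable {M : CoxeterMatrix B} (cs : CoxeterSystem M W)

lemma end_mul_apply {α : Type*} (f g : Function.End α) (p : α) : (f * g) p = f (g p) := rfl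

lemma end_one_apply {α : Type*} (p : α) : (1 : Function.End α) p = p := rfl

/-- The elementary map `(t, e) ↦ (s t s, e + [t = s])`. -/
def flip (i : B) : Function.End (W × ZMod 2) :=
  fun p => (cs.simple i * p.1 * cs.simple i, p.2 + if p.1 = cs.simple i then 1 else 0)

lemma simple_mul_pow (i j : B) (n : ℕ) :
    cs.simple j * (cs.simple i * cs.simple j) ^ n =
      ((cs.simple i * cs.simple j) ^ n)⁻¹ * cs.simple j := by
  have h : cs.simple j * (cs.simple i * cs.simple j) ^ n * (cs.simple j)⁻¹ =
      ((cs.simple i * cs.simple j) ^ n)⁻¹ := by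
    rw [← conj_pow, ← inv_pow]
    congr 1
    simp [mul_assoc]
  rw [← h]
  simp

lemma flip_pow (i j : B) (n : ℕ) (p : W × ZMod 2) :
    ((flip cs i * flip cs j) ^ n) p =
      ((cs.simple i * cs.simple j) ^ n * p.1 * ((cs.simple i * cs.simple j) ^ n)⁻¹,
        p.2 + ∑ l ∈ Finset.range (2 * n),
          if p.1 = ((cs.simple i * cs.simple j) ^ l)⁻¹ * cs.simple j then 1 else 0) := by
  induction n with
  | zero => simp [end_one_apply]
  | succ n ih =>
    rw [pow_succ', end_mul_apply, ih, end_mul_apply]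
    have hA := simple_mul_pow cs i j n
    set r := cs.simple i * cs.simple j with hr
    have hji : cs.simple j * cs.simple i = r⁻¹ := by simp [hr]
    have e1 : r ^ n * p.1 * (r ^ n)⁻¹ = cs.simple j ↔ p.1 = (r ^ (2 * n))⁻¹ * cs.simple j := by
      rw [mul_inv_eq_iff_eq_mul, hA, ← eq_inv_mul_iff_mul_eq, two_mul, pow_add, mul_inv_rev,
        mul_assoc]
    have e2 : cs.simple j * (r ^ n * p.1 * (r ^ n)⁻¹) * cs.simple j = cs.simple i ↔
        p.1 = (r ^ (2 * n + 1))⁻¹ * cs.simple j := by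
      have h1 : cs.simple j * (r ^ n * p.1 * (r ^ n)⁻¹) * cs.simple j = cs.simple i ↔
          r ^ n * p.1 * (r ^ n)⁻¹ = r⁻¹ * cs.simple j := by
        rw [← hji]
        constructor
        · intro h
          rw [← h]
          simp [mul_assoc]
        · intro h
          rw [h]
          simp [mul_assoc]
      rw [h1, mul_inv_eq_iff_eq_mul, mul_assoc, hA, ← eq_inv_mul_iff_mul_eq]
      have : (r ^ (2 * n + 1))⁻¹ = (r ^ n)⁻¹ * (r⁻¹ * (r ^ n)⁻¹) := by
        rw [← mul_inv_rev, ← mul_inv_rev, ← pow_succ, ← pow_add]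
        congr 2
        omega
      rw [this]
      simp [mul_assoc]
    have e3 : 2 * (n + 1) = 2 * n + 1 + 1 := by omega
    rw [e3, Finset.sum_range_succ, Finset.sum_range_succ]
    simp only [flip, e1, e2]
    ext
    · simp only [pow_succ', mul_inv_rev]
      simp [hr, mul_assoc]
    · simp [add_assoc]

lemma flip_liftable : M.IsLiftable (flip cs) := by
  intro i j
  funext p
  rw [flip_pow]
  have h := cs.simple_mul_simple_pow i j
  rw [two_mul, Finset.sum_range_add]
  simp only [pow_add, h, one_mul]
  rw [CharTwo.add_self_eq_zero]
  simp [end_one_apply]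

/-- The action on `W × ZMod 2` recording inversion parities. -/
noncomputable def act : W →* Function.End (W × ZMod 2) := cs.lift ⟨flip cs, flip_liftable cs⟩

lemma act_simple (i : B) : act cs (cs.simple i) = flip cs i :=
  cs.lift_apply_simple (flip_liftable cs) i

lemma act_word (ω : List B) (p : W × ZMod 2) :
    act cs (cs.wordProd ω) p = (cs.wordProd ω * p.1 * (cs.wordProd ω)⁻¹,
      p.2 + ((cs.rightInvSeq ω).count p.1 : ZMod 2)) := by
  induction ω with
  | nil => simp [end_one_apply]
  | cons i ω ih =>
    rw [cs.wordProd_cons, map_mul, end_mul_apply, ih, act_simple]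
    have e : cs.wordProd ω * p.1 * (cs.wordProd ω)⁻¹ = cs.simple i ↔
        (cs.wordProd ω)⁻¹ * cs.simple i * cs.wordProd ω = p.1 := by
      constructor
      · intro h
        rw [← h]
        group
      · intro h
        rw [← h]
        group
    simp only [flip, CoxeterSystem.rightInvSeq, List.count_cons, e, beq_iff_eq]
    ext
    · simp [mul_assoc]
    · push_cast
      simp [add_assoc]

/-- The exchange condition. -/
lemma exchange (ω : List B) (i : B)
    (h : cs.length (cs.wordProd ω * cs.simple i) < cs.length (cs.wordProd ω)) :
    ∃ j < ω.length, cs.wordProd ω * cs.simple i = cs.wordProd (ω.eraseIdx j) := by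
  suffices hm : cs.simple i ∈ cs.rightInvSeq ω by
    obtain ⟨j, hj, hj'⟩ := List.mem_iff_getElem.mp hm
    refine ⟨j, by simpa using hj, ?_⟩
    rw [← cs.wordProd_mul_getD_rightInvSeq, List.getD_eq_getElem _ _ hj, hj']
  by_contra hm
  obtain ⟨α, hα, hα'⟩ := cs.exists_isReduced (cs.wordProd ω * cs.simple i)
  have h1 := act_word cs ω (cs.simple i, 0)
  rw [List.count_eq_zero_of_not_mem hm] at h1
  have h2 := act_word cs α (cs.simple i, 0)
  rw [← hα', map_mul, end_mul_apply, act_simple] at h2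
  have h3 : flip cs i (cs.simple i, 0) = (cs.simple i, 1) := by simp [flip]
  rw [h3] at h2
  have h4 := act_word cs ω (cs.simple i, 1)
  rw [List.count_eq_zero_of_not_mem hm] at h4
  rw [h4] at h2
  have h5 := congrArg Prod.snd h2
  have hmem : cs.simple i ∈ cs.rightInvSeq α := by
    by_contra hn
    rw [List.count_eq_zero_of_not_mem hn] at h5
    simp at h5
  have h6 := (cs.isRightInversion_of_mem_rightInvSeq hα hmem).2
  rw [← hα'] at h6
  simp at h6
  omega

lemma simple_mem_parabolic {I : Finset B} {i : B} (hi : i ∈ I) :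
    cs.simple i ∈ parabolic cs I :=
  Subgroup.subset_closure ⟨i, by simpa using hi, rfl⟩

lemma wordProd_mem {I : Finset B} (ω : List B) (h : ∀ i ∈ ω, i ∈ I) :
    cs.wordProd ω ∈ parabolic cs I := by
  induction ω with
  | nil => simp [one_mem]
  | cons i ω ih =>
    rw [cs.wordProd_cons]
    exact mul_mem (simple_mem_parabolic cs (h i (by simp))) (ih fun j hj => h j (by simp [hj]))

/-- Elements of `W_I` have reduced words with letters in `I`. -/
lemma exists_reduced {I : Finset B} {w : W} (hw : w ∈ parabolic cs I) :
    ∃ ω : List B, (∀ i ∈ ω, i ∈ I) ∧ cs.IsReduced ω ∧ cs.wordProd ω = w := by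
  have step : ∀ (x : W) (i : B), i ∈ I →
      (∃ ω : List B, (∀ i ∈ ω, i ∈ I) ∧ cs.IsReduced ω ∧ cs.wordProd ω = x) →
      ∃ ω : List B, (∀ i ∈ ω, i ∈ I) ∧ cs.IsReduced ω ∧ cs.wordProd ω = x * cs.simple i := by
    rintro x i hi ⟨ω, h1, h2, rfl⟩
    rcases cs.length_mul_simple (cs.wordProd ω) i with h | h
    · refine ⟨ω ++ [i], ?_, ?_, ?_⟩
      · intro j hj
        rcases List.mem_append.mp hj with hj | hj
        · exact h1 j hj
        · rw [List.mem_singleton] at hj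
          exact hj ▸ hi
      · unfold CoxeterSystem.IsReduced
        rw [cs.wordProd_append, cs.wordProd_singleton, h, h2.eq]
        simp
      · rw [cs.wordProd_append, cs.wordProd_singleton]
    · obtain ⟨j, hj, hj'⟩ := exchange cs ω i (by omega)
      refine ⟨ω.eraseIdx j, fun k hk => h1 k (List.mem_of_mem_eraseIdx hk), ?_, hj'.symm⟩
      unfold CoxeterSystem.IsReduced
      rw [← hj']
      have := h2.eq
      have := List.length_eraseIdx_add_one hj
      omega
  unfold parabolic at hw
  induction hw using Subgroup.closure_induction_right with
  | one => exact ⟨[], by simp, by simp [CoxeterSystem.IsReduced], by simp⟩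
  | mul_right x hx y hy ih =>
    obtain ⟨i, hi, rfl⟩ := hy
    exact step x i (by simpa using hi) ih
  | mul_inv_cancel x hx y hy ih =>
    obtain ⟨i, hi, rfl⟩ := hy
    rw [cs.inv_simple]
    exact step x i (by simpa using hi) ih

/-- `d ∈ X_I`. -/
def IsMin (I : Finset B) (d : W) : Prop := ∀ i ∈ I, cs.length d < cs.length (d * cs.simple i)

lemma length_mul_of_coset_min {I : Finset B} {f : W}
    (hf : ∀ u ∈ parabolic cs I, cs.length f ≤ cs.length (f * u)) (ω : List B)
    (hω : ∀ i ∈ ω, i ∈ I) (hr : cs.IsReduced ω) :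
    cs.length (f * cs.wordProd ω) = cs.length f + ω.length := by
  induction ω using List.reverseRecOn with
  | nil => simp
  | append_singleton ω i ih =>
    have hωI : ∀ i ∈ ω, i ∈ I := fun j hj => hω j (by simp [hj])
    have hi : i ∈ I := hω i (by simp)
    have hr' : cs.IsReduced ω := by simpa using hr.take ω.length
    have ih := ih hωI hr'
    rw [cs.wordProd_append, cs.wordProd_singleton, ← mul_assoc]
    have hre := hr.eq
    rw [cs.wordProd_append, cs.wordProd_singleton] at hre
    simp only [List.length_append, List.length_singleton] at hre ⊢
    rcases cs.length_mul_simple (f * cs.wordProd ω) i with h | h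
    · omega
    exfalso
    obtain ⟨α, hα, rfl⟩ := cs.exists_isReduced f
    rw [← cs.wordProd_append] at h
    obtain ⟨j, hj, hj'⟩ := exchange cs (α ++ ω) i (by omega)
    by_cases hjα : j < α.length
    · rw [List.eraseIdx_append_of_lt_length hjα, cs.wordProd_append, cs.wordProd_append] at hj'
      have h1 := hf (cs.wordProd ω * cs.simple i * (cs.wordProd ω)⁻¹)
        (mul_mem (mul_mem (wordProd_mem cs ω hωI) (simple_mem_parabolic cs hi))
          (inv_mem (wordProd_mem cs ω hωI)))
      rw [← mul_assoc, ← mul_assoc, hj', mul_inv_cancel_right] at h1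
      have h2 := cs.length_wordProd_le (α.eraseIdx j)
      have h3 := List.length_eraseIdx_add_one hjα
      have h4 := hα.eq
      omega
    · push Not at hjα
      rw [List.length_append] at hj
      rw [List.eraseIdx_append_of_length_le hjα, cs.wordProd_append, cs.wordProd_append,
        mul_assoc, mul_right_inj] at hj'
      have h2 := cs.length_wordProd_le (ω.eraseIdx (j - α.length))
      have h3 := List.length_eraseIdx_add_one (l := ω) (i := j - α.length) (by omega)
      rw [← hj'] at h2
      omega

lemma exists_decomp_aux (I : Finset B) (w : W) :
    ∃ f, ∃ v ∈ parabolic cs I, w = f * v ∧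
      (∀ u ∈ parabolic cs I, cs.length f ≤ cs.length (f * u)) := by
  obtain ⟨v, hv, hmin⟩ := Set.exists_min_image (parabolic cs I : Set W)
    (fun v => cs.length (w * v)) (Set.toFinite _) ⟨1, one_mem _⟩
  refine ⟨w * v, v⁻¹, inv_mem hv, by simp, fun u hu => ?_⟩
  rw [mul_assoc]
  exact hmin (v * u) (mul_mem hv hu)

lemma coset_min_of_isMin {I : Finset B} {f : W} (hf : IsMin cs I f) :
    ∀ u ∈ parabolic cs I, cs.length f ≤ cs.length (f * u) := by
  obtain ⟨g, v, hv, rfl, hg⟩ := exists_decomp_aux cs I f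
  obtain ⟨ω, hω, hr, rfl⟩ := exists_reduced cs hv
  rcases List.eq_nil_or_concat ω with rfl | ⟨ω', i, rfl⟩
  · simpa using hg
  · exfalso
    have hi := hf i (hω i (by simp))
    have h1 := length_mul_of_coset_min cs hg _ hω hr
    have hr' : cs.IsReduced ω' := by simpa using hr.take ω'.length
    have h2 := length_mul_of_coset_min cs hg ω' (fun j hj => hω j (by simp [hj])) hr'
    rw [h1, List.concat_eq_append, cs.wordProd_append, cs.wordProd_singleton, mul_assoc, mul_assoc,
      cs.simple_mul_simple_self, mul_one, h2] at hi
    simp at hi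

lemma length_mul_of_isMin {I : Finset B} {f u : W} (hf : IsMin cs I f)
    (hu : u ∈ parabolic cs I) : cs.length (f * u) = cs.length f + cs.length u := by
  obtain ⟨ω, hω, hr, rfl⟩ := exists_reduced cs hu
  rw [length_mul_of_coset_min cs (coset_min_of_isMin cs hf) ω hω hr, hr.eq]

lemma length_mul_of_isMin_inv {I : Finset B} {f u : W} (hf : IsMin cs I f⁻¹)
    (hu : u ∈ parabolic cs I) : cs.length (u * f) = cs.length u + cs.length f := by
  have h := length_mul_of_isMin cs hf (inv_mem hu)
  rw [← mul_inv_rev, cs.length_inv, cs.length_inv, cs.length_inv] at h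
  omega

lemma exists_decomp (I : Finset B) (w : W) :
    ∃ f, ∃ v ∈ parabolic cs I, w = f * v ∧ IsMin cs I f := by
  obtain ⟨g, v, hv, rfl, hg⟩ := exists_decomp_aux cs I w
  refine ⟨g, v, hv, rfl, fun i hi => ?_⟩
  have := hg _ (simple_mem_parabolic cs hi)
  have := cs.length_mul_simple_ne g i
  omega

lemma isMin_unique {I : Finset B} {f g u : W} (hf : IsMin cs I f) (hg : IsMin cs I g)
    (hu : u ∈ parabolic cs I) (h : f = g * u) : f = g := by
  have h1 := length_mul_of_isMin cs hg hu
  have h2 := length_mul_of_isMin cs hf (inv_mem hu)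
  rw [← h] at h1
  rw [cs.length_inv, h, mul_inv_cancel_right, ← h] at h2
  have h3 : u = 1 := cs.length_eq_zero_iff.mp (by omega)
  simpa [h3] using h

lemma eq_simple_of_length_one {I : Finset B} {u : W} (hu : u ∈ parabolic cs I)
    (h : cs.length u = 1) : ∃ i ∈ I, u = cs.simple i := by
  obtain ⟨ω, hω, hr, rfl⟩ := exists_reduced cs hu
  rw [hr.eq] at h
  obtain ⟨i, rfl⟩ := List.length_eq_one_iff.mp h
  exact ⟨i, hω i (by simp), by simp⟩

lemma deodhar {d : W} {i j : B} (h1 : cs.length d < cs.length (d * cs.simple j))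
    (h2 : cs.length (cs.simple i * d * cs.simple j) < cs.length (cs.simple i * d)) :
    cs.simple i * d = d * cs.simple j := by
  obtain ⟨ω, hω, rfl⟩ := cs.exists_isReduced d
  rw [← cs.wordProd_cons] at h2
  obtain ⟨k, hk, hk'⟩ := exchange cs (i :: ω) j h2
  rcases k with _ | k
  · rw [List.eraseIdx_zero, List.tail_cons, cs.wordProd_cons] at hk'
    have h3 := congrArg (· * cs.simple j) hk'
    simpa using h3
  · exfalso
    rw [List.eraseIdx_cons_succ, cs.wordProd_cons, cs.wordProd_cons, mul_assoc,
      mul_right_inj] at hk'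
    have h3 := cs.length_wordProd_le (ω.eraseIdx k)
    have h4 := List.length_eraseIdx_add_one (l := ω) (i := k) (by simpa using hk)
    have := hω.eq
    rw [← hk'] at h3
    omega

/-- Kilmoyer-type lemma. -/
lemma kilmoyer {K I : Finset B} {d e : W} (hd : IsMin cs I d) (hdK : IsMin cs K d⁻¹)
    (he : IsMin cs I e) (heK : IsMin cs K e⁻¹)
    (ω : List B) (hω : ∀ i ∈ ω, i ∈ K) (hr : cs.IsReduced ω) (u : W) (hu : u ∈ parabolic cs I)
    (h : cs.wordProd ω * d = e * u) :
    d = e ∧ ∀ k ∈ ω, ∃ i ∈ I, cs.simple k = e * cs.simple i * e⁻¹ := by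
  induction ω generalizing u with
  | nil => exact ⟨isMin_unique cs hd he hu (by simpa using h), by simp⟩
  | cons k ω ih =>
    have hr' : cs.IsReduced ω := by simpa using hr.drop 1
    have hωK : ∀ i ∈ ω, i ∈ K := fun j hj => hω j (by simp [hj])
    have l1 := length_mul_of_isMin_inv cs hdK (wordProd_mem cs _ hω)
    have l2 := length_mul_of_isMin_inv cs hdK (wordProd_mem cs _ hωK)
    rw [hr.eq, h] at l1
    rw [hr'.eq] at l2
    have h' : cs.wordProd ω * d = cs.simple k * e * u := by
      rw [mul_assoc, ← h, cs.wordProd_cons]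
      simp [mul_assoc]
    have key : ∃ i ∈ I, cs.simple k * e = e * cs.simple i := by
      by_contra hcon
      have hmin : IsMin cs I (cs.simple k * e) := by
        intro i hi
        by_contra hlt
        have hne := cs.length_mul_simple_ne (cs.simple k * e) i
        exact hcon ⟨i, hi, deodhar cs (he i hi) (by omega)⟩
      have l3 := length_mul_of_isMin cs hmin hu
      have l4 := length_mul_of_isMin cs he hu
      rw [h', l3] at l2
      rw [l4, List.length_cons] at l1
      rcases cs.length_simple_mul e k with h5 | h5
      · omega
      · have h6 := heK k (hω k (by simp))
        rw [← cs.length_inv (e⁻¹ * _), mul_inv_rev, cs.length_inv, cs.inv_simple, inv_inv] at h6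
        omega
    obtain ⟨i, hi, hki⟩ := key
    have h2 : cs.wordProd ω * d = e * (cs.simple i * u) := by
      rw [h', hki, mul_assoc]
    obtain ⟨r1, r2⟩ := ih hωK hr' _ (mul_mem (simple_mem_parabolic cs hi) hu) h2
    refine ⟨r1, fun j hj => ?_⟩
    rcases List.mem_cons.mp hj with rfl | hj
    · exact ⟨i, hi, by rw [← hki]; simp⟩
    · exact r2 j hj

lemma memXKI_iff {K I : Finset B} {d : W} :
    memXKI cs K I d ↔ IsMin cs K d⁻¹ ∧ IsMin cs I d := Iff.rfl

lemma IsMin.inv_lt {K : Finset B} {e : W} (h : IsMin cs K e⁻¹) {k : B} (hk : k ∈ K) :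
    cs.length e < cs.length (cs.simple k * e) := by
  have h6 := h k hk
  rwa [← cs.length_inv (e⁻¹ * _), mul_inv_rev, cs.length_inv, cs.inv_simple, inv_inv] at h6

lemma isMin_inv_of_lt {K : Finset B} {e : W}
    (h : ∀ k ∈ K, cs.length e < cs.length (cs.simple k * e)) : IsMin cs K e⁻¹ := by
  intro k hk
  rw [← cs.length_inv (e⁻¹ * _), mul_inv_rev, cs.length_inv, cs.inv_simple, inv_inv]
  exact h k hk

open scoped Classical in
/-- `K ∩ d I d⁻¹` -/
noncomputable def dset (K I : Finset B) (d : W) : Finset B :=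
  K.filter (fun j => ∃ i ∈ I, cs.simple j = d * cs.simple i * d⁻¹)

lemma dset_subset (K I : Finset B) (d : W) : dset cs K I d ⊆ K := by
  classical
  exact Finset.filter_subset _ _

lemma mem_dset {K I : Finset B} {d : W} {k : B} :
    k ∈ dset cs K I d ↔ k ∈ K ∧ ∃ i ∈ I, cs.simple k = d * cs.simple i * d⁻¹ := by
  classical
  exact Finset.mem_filter

open scoped Classical in
lemma resK_eq {K : Finset B} {R : MonoidAlgebra ℚ W →ₗ[ℚ] MonoidAlgebra ℚ W}
    (hR : IsResK cs K R) (I : Finset B) :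
    R (descentBasis cs I) = ∑ d : W with memXKI cs K I d,
      parDescentBasis cs K (dset cs K I d) := by
  rw [hR I, Finset.sum_filter]
  rfl

lemma mem_dset_iff {K I : Finset B} {d : W} (hd : memXKI cs K I d) {k : B} (hk : k ∈ K) :
    k ∈ dset cs K I d ↔ d⁻¹ * cs.simple k * d ∈ parabolic cs I := by
  rw [mem_dset]
  constructor
  · rintro ⟨_, i, hi, h⟩
    rw [h]
    have : d⁻¹ * (d * cs.simple i * d⁻¹) * d = cs.simple i := by group
    rw [this]
    exact simple_mem_parabolic cs hi
  · intro h
    refine ⟨hk, ?_⟩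
    have h1 := length_mul_of_isMin cs hd.2 h
    have h2 := length_mul_of_isMin_inv cs hd.1 (simple_mem_parabolic cs hk)
    have e : d * (d⁻¹ * cs.simple k * d) = cs.simple k * d := by group
    rw [e, h2, cs.length_simple] at h1
    obtain ⟨i, hi, h3⟩ := eq_simple_of_length_one cs h (by omega)
    exact ⟨i, hi, by rw [← h3]; group⟩

lemma memWK_spec {K : Finset B} {d : W} (hd : memWK cs K d) :
    (∀ k ∈ K, ∃ k' ∈ K, d * cs.simple k * d⁻¹ = cs.simple k') ∧
    (∀ k' ∈ K, ∃ k ∈ K, d * cs.simple k * d⁻¹ = cs.simple k') := by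
  obtain ⟨_, h⟩ := hd
  constructor
  · intro k hk
    have : d * cs.simple k * d⁻¹ ∈ cs.simple '' (K : Set B) := by
      rw [← h]
      exact ⟨_, ⟨k, hk, rfl⟩, rfl⟩
    obtain ⟨k', hk', e⟩ := this
    exact ⟨k', hk', e.symm⟩
  · intro k' hk'
    have : cs.simple k' ∈ cs.simple '' (K : Set B) := ⟨k', hk', rfl⟩
    rw [← h] at this
    obtain ⟨_, ⟨k, hk, rfl⟩, e⟩ := this
    exact ⟨k, hk, e⟩

lemma memWK_inv {K : Finset B} {d : W} (hd : memWK cs K d) : memWK cs K d⁻¹ := by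
  obtain ⟨h1, h2⟩ := memWK_spec cs hd
  refine ⟨⟨by simpa using hd.1.2, hd.1.1⟩, ?_⟩
  ext x
  constructor
  · rintro ⟨_, ⟨k, hk, rfl⟩, rfl⟩
    obtain ⟨k', hk', e⟩ := h2 k hk
    refine ⟨k', hk', ?_⟩
    dsimp only
    rw [← e]
    group
  · rintro ⟨k, hk, rfl⟩
    obtain ⟨k', hk', e⟩ := h1 k hk
    refine ⟨_, ⟨k', hk', rfl⟩, ?_⟩
    dsimp only
    rw [← e]
    group

lemma conj_mem {K : Finset B} {d : W} (hd : memWK cs K d) {u : W} (hu : u ∈ parabolic cs K) :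
    d * u * d⁻¹ ∈ parabolic cs K := by
  have hle : parabolic cs K ≤ (parabolic cs K).comap (MulAut.conj d).toMonoidHom := by
    conv_lhs => unfold parabolic
    rw [Subgroup.closure_le]
    rintro _ ⟨k, hk, rfl⟩
    obtain ⟨k', hk', e⟩ := (memWK_spec cs hd).1 k hk
    change d * cs.simple k * d⁻¹ ∈ parabolic cs K
    rw [e]
    exact simple_mem_parabolic cs hk'
  exact hle hu

lemma conj_mem_iff {K : Finset B} {d : W} (hd : memWK cs K d) {u : W} :
    d * u * d⁻¹ ∈ parabolic cs K ↔ u ∈ parabolic cs K := by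
  refine ⟨fun h => ?_, conj_mem cs hd⟩
  have h1 := conj_mem cs (memWK_inv cs hd) h
  have e : d⁻¹ * (d * u * d⁻¹) * d⁻¹⁻¹ = u := by group
  rwa [e] at h1

lemma length_conj {K : Finset B} {d : W} (hd : memWK cs K d) {u : W} (hu : u ∈ parabolic cs K) :
    cs.length (d * u * d⁻¹) = cs.length u := by
  have h1 := length_mul_of_isMin cs hd.1.2 hu
  have h2 := length_mul_of_isMin_inv cs hd.1.1 (conj_mem cs hd hu)
  rw [inv_mul_cancel_right] at h2
  omega

lemma conj_parDescentBasis {K J J' : Finset B} {d : W} (hd : memWK cs K d) (hJ : J ⊆ K)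
    (h1 : ∀ k ∈ J, ∃ k' ∈ J', d * cs.simple k * d⁻¹ = cs.simple k')
    (h2 : ∀ k' ∈ J', ∃ k ∈ J, d * cs.simple k * d⁻¹ = cs.simple k') :
    MonoidAlgebra.single d (1 : ℚ) * parDescentBasis cs K J * MonoidAlgebra.single d⁻¹ (1 : ℚ) =
      parDescentBasis cs K J' := by
  classical
  unfold parDescentBasis
  rw [Finset.mul_sum, Finset.sum_mul]
  refine Fintype.sum_equiv (MulAut.conj d).toEquiv _ _ fun w => ?_
  have hw : (MulAut.conj d).toEquiv w = d * w * d⁻¹ := rfl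
  rw [hw]
  have hiff : (w ∈ parabolic cs K ∧ ∀ i ∈ J, cs.length w < cs.length (w * cs.simple i)) ↔
      (d * w * d⁻¹ ∈ parabolic cs K ∧
        ∀ i ∈ J', cs.length (d * w * d⁻¹) < cs.length (d * w * d⁻¹ * cs.simple i)) := by
    rw [conj_mem_iff cs hd]
    refine and_congr_right fun hwK => ?_
    have key : ∀ k ∈ J, ∀ k', d * cs.simple k * d⁻¹ = cs.simple k' →
        (cs.length w < cs.length (w * cs.simple k) ↔
          cs.length (d * w * d⁻¹) < cs.length (d * w * d⁻¹ * cs.simple k')) := by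
      intro k hk k' e
      have e2 : d * w * d⁻¹ * cs.simple k' = d * (w * cs.simple k) * d⁻¹ := by
        rw [← e]
        group
      rw [e2, length_conj cs hd hwK,
        length_conj cs hd (mul_mem hwK (simple_mem_parabolic cs (hJ hk)))]
    constructor
    · intro h k' hk'
      obtain ⟨k, hk, e⟩ := h2 k' hk'
      exact (key k hk k' e).1 (h k hk)
    · intro h k hk
      obtain ⟨k', hk', e⟩ := h1 k hk
      exact (key k hk k' e).2 (h k' hk')
  by_cases hc : w ∈ parabolic cs K ∧ ∀ i ∈ J, cs.length w < cs.length (w * cs.simple i)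
  · rw [if_pos hc, if_pos (hiff.1 hc)]
    simp
  · rw [if_neg hc, if_neg (fun h => hc (hiff.2 h))]
    simp

/-- The `X_I`-part of `w`. -/
noncomputable def red (I : Finset B) (w : W) : W := (exists_decomp cs I w).choose

lemma red_isMin (I : Finset B) (w : W) : IsMin cs I (red cs I w) := by
  obtain ⟨v, hv, h1, h2⟩ := (exists_decomp cs I w).choose_spec
  exact h2

lemma red_mem (I : Finset B) (w : W) : (red cs I w)⁻¹ * w ∈ parabolic cs I := by
  obtain ⟨v, hv, h1, h2⟩ := (exists_decomp cs I w).choose_spec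
  change w = red cs I w * v at h1
  have : (red cs I w)⁻¹ * w = v := by
    rw [inv_mul_eq_iff_eq_mul]
    exact h1
  rwa [this]

lemma red_unique {I : Finset B} {w f : W} (hf : IsMin cs I f) (h : f⁻¹ * w ∈ parabolic cs I) :
    red cs I w = f := by
  refine isMin_unique cs (red_isMin cs I w) hf
    (mul_mem h (inv_mem (red_mem cs I w))) ?_
  group

lemma isMin_inv_mul {K : Finset B} {d e : W} (hd : memWK cs K d) (he : IsMin cs K e⁻¹) :
    IsMin cs K (d * e)⁻¹ := by
  intro k hk
  by_contra hlt
  have hne := cs.length_mul_simple_ne (d * e)⁻¹ k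
  have hlt' : cs.length ((d * e)⁻¹ * cs.simple k) < cs.length (d * e)⁻¹ := by omega
  rw [mul_inv_rev] at hlt'
  obtain ⟨k', hk', hkk⟩ := (memWK_spec cs hd).2 k hk
  have hdk := hd.1.1 k hk
  have hek := he k' hk'
  obtain ⟨δ, hδ, hδ'⟩ := cs.exists_isReduced d⁻¹
  obtain ⟨ε, hε, hε'⟩ := cs.exists_isReduced e⁻¹
  have hkk' : d⁻¹ * cs.simple k = cs.simple k' * d⁻¹ := by
    rw [← hkk]
    group
  rw [hδ', hε', ← cs.wordProd_append] at hlt'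
  obtain ⟨j, hj, hj'⟩ := exchange cs (ε ++ δ) k hlt'
  by_cases hjα : j < ε.length
  · rw [List.eraseIdx_append_of_lt_length hjα, cs.wordProd_append, cs.wordProd_append,
      mul_assoc, ← hδ', hkk', ← mul_assoc, mul_left_inj, ← hε'] at hj'
    have h2 := cs.length_wordProd_le (ε.eraseIdx j)
    have h3 := List.length_eraseIdx_add_one hjα
    have h4 := hε.eq
    rw [← hj'] at h2
    rw [← hε'] at h4
    omega
  · push Not at hjα
    rw [List.length_append] at hj
    rw [List.eraseIdx_append_of_length_le hjα, cs.wordProd_append, cs.wordProd_append,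
      mul_assoc, mul_right_inj] at hj'
    have h2 := cs.length_wordProd_le (δ.eraseIdx (j - ε.length))
    have h3 := List.length_eraseIdx_add_one (l := δ) (i := j - ε.length) (by omega)
    have h4 := hδ.eq
    rw [← hj', ← hδ'] at h2
    rw [← hδ'] at h4
    omega

lemma red_memXKI {K I : Finset B} {d e : W} (hd : memWK cs K d) (he : memXKI cs K I e) :
    memXKI cs K I (red cs I (d * e)) := by
  refine ⟨isMin_inv_of_lt cs fun k hk => ?_, red_isMin cs I _⟩
  have h1 := IsMin.inv_lt cs (isMin_inv_mul cs hd he.1) hk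
  have hv := red_mem cs I (d * e)
  have hf := red_isMin cs I (d * e)
  set f := red cs I (d * e)
  have h2 := length_mul_of_isMin cs hf hv
  have h3 := cs.length_mul_le (cs.simple k * f) (f⁻¹ * (d * e))
  have e1 : f * (f⁻¹ * (d * e)) = d * e := by group
  have e2 : cs.simple k * f * (f⁻¹ * (d * e)) = cs.simple k * (d * e) := by group
  rw [e1] at h2
  rw [e2] at h3
  omega

lemma mem_dset_red {K I : Finset B} {d e : W} (hd : memWK cs K d) (he : memXKI cs K I e)
    {k k' : B} (hk : k ∈ K) (hk' : k' ∈ K) (h : d * cs.simple k * d⁻¹ = cs.simple k') :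
    k' ∈ dset cs K I (red cs I (d * e)) ↔ k ∈ dset cs K I e := by
  rw [mem_dset_iff cs (red_memXKI cs hd he) hk', mem_dset_iff cs he hk, ← h]
  have hv := red_mem cs I (d * e)
  set f := red cs I (d * e)
  have e1 : f⁻¹ * (d * cs.simple k * d⁻¹) * f =
      (f⁻¹ * (d * e)) * (e⁻¹ * cs.simple k * e) * (f⁻¹ * (d * e))⁻¹ := by group
  rw [e1, Subgroup.mul_mem_cancel_right _ (inv_mem hv), Subgroup.mul_mem_cancel_left _ hv]

lemma res_fixed {K : Finset B} {R : MonoidAlgebra ℚ W →ₗ[ℚ] MonoidAlgebra ℚ W}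
    (hR : IsResK cs K R) (I : Finset B) {d : W} (hd : memWK cs K d) :
    MonoidAlgebra.single d (1 : ℚ) * R (descentBasis cs I) * MonoidAlgebra.single d⁻¹ (1 : ℚ) =
      R (descentBasis cs I) := by
  classical
  rw [resK_eq cs hR, Finset.mul_sum, Finset.sum_mul]
  have hinv : ∀ {d : W}, memWK cs K d → ∀ e, memXKI cs K I e →
      red cs I (d⁻¹ * red cs I (d * e)) = e := by
    intro d hd e he
    refine red_unique cs he.2 ?_
    have e1 : e⁻¹ * (d⁻¹ * red cs I (d * e)) = ((red cs I (d * e))⁻¹ * (d * e))⁻¹ := by group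
    rw [e1]
    exact inv_mem (red_mem cs I _)
  refine Finset.sum_nbij' (fun e => red cs I (d * e)) (fun e => red cs I (d⁻¹ * e))
    ?_ ?_ ?_ ?_ ?_
  · intro e he
    simp only [Finset.mem_filter, Finset.mem_univ, true_and] at he ⊢
    exact red_memXKI cs hd he
  · intro e he
    simp only [Finset.mem_filter, Finset.mem_univ, true_and] at he ⊢
    exact red_memXKI cs (memWK_inv cs hd) he
  · intro e he
    simp only [Finset.mem_filter, Finset.mem_univ, true_and] at he
    exact hinv hd e he
  · intro e he
    simp only [Finset.mem_filter, Finset.mem_univ, true_and] at he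
    simpa using hinv (memWK_inv cs hd) e he
  · intro e he
    simp only [Finset.mem_filter, Finset.mem_univ, true_and] at he
    obtain ⟨s1, s2⟩ := memWK_spec cs hd
    refine conj_parDescentBasis cs hd (dset_subset cs K I e) ?_ ?_
    · intro k hk
      have hkK := dset_subset cs K I e hk
      obtain ⟨k', hk', h⟩ := s1 k hkK
      exact ⟨k', (mem_dset_red cs hd he hkK hk' h).2 hk, h⟩
    · intro k' hk
      have hkK := dset_subset cs K I _ hk
      obtain ⟨k, hk', h⟩ := s2 k' hkK
      exact ⟨k, (mem_dset_red cs hd he hk' hkK h).1 hk, h⟩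

lemma res_fixed_all {A : Subalgebra ℚ (MonoidAlgebra ℚ W)} (hA : IsDescentAlgebra cs A)
    {K : Finset B} {R : MonoidAlgebra ℚ W →ₗ[ℚ] MonoidAlgebra ℚ W}
    (hR : IsResK cs K R) {d : W} (hd : memWK cs K d) {x : MonoidAlgebra ℚ W} (hx : x ∈ A) :
    MonoidAlgebra.single d (1 : ℚ) * R x * MonoidAlgebra.single d⁻¹ (1 : ℚ) = R x := by
  have hx' : x ∈ Submodule.span ℚ (Set.range (descentBasis cs)) := by
    have : x ∈ (A : Set (MonoidAlgebra ℚ W)) := hx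
    rw [hA] at this
    exact this
  clear hx
  induction hx' using Submodule.span_induction with
  | mem x h =>
    obtain ⟨I, rfl⟩ := h
    exact res_fixed cs hR I hd
  | zero => simp
  | add x y hx hy h1 h2 => rw [map_add, mul_add, add_mul, h1, h2]
  | smul a x hx h => rw [map_smul, mul_smul_comm, smul_mul_assoc, h]

open scoped Classical in
lemma coeff_par (K I : Finset B) (w : W) : (parDescentBasis cs K I).coeff w =
    if w ∈ parabolic cs K ∧ ∀ i ∈ I, cs.length w < cs.length (w * cs.simple i)
      then (1 : ℚ) else 0 := by
  unfold parDescentBasis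
  rw [MonoidAlgebra.coeff_sum, Finsupp.finsetSum_apply, Finset.sum_eq_single w]
  · split_ifs <;> simp
  · intro v _ hv
    split_ifs
    · simp [hv]
    · simp
  · simp

lemma acts_trivially {K : Finset B} {d : W} (hd : memWK cs K d)
    (hfix : ∀ I ⊆ K, MonoidAlgebra.single d (1 : ℚ) * parDescentBasis cs K I *
      MonoidAlgebra.single d⁻¹ (1 : ℚ) = parDescentBasis cs K I) :
    ∀ u ∈ parabolic cs K, d * u * d⁻¹ = u := by
  classical
  have hs : ∀ k ∈ K, d * cs.simple k * d⁻¹ = cs.simple k := by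
    intro k hk
    obtain ⟨k', hk', e⟩ := (memWK_spec cs hd).1 k hk
    have hkK : ({k} : Finset B) ⊆ K := by simpa using hk
    have h1 := hfix {k} hkK
    rw [conj_parDescentBasis cs hd (J' := {k'}) hkK (by simpa using e) (by simpa using e)] at h1
    rw [e]
    by_contra hne
    have h2 := congrArg (fun x => x.coeff (cs.simple k')) h1
    simp only [coeff_par, simple_mem_parabolic cs hk', true_and, Finset.mem_singleton,
      forall_eq] at h2
    have h3 : cs.length (cs.simple k') < cs.length (cs.simple k' * cs.simple k) := by
      have hne' := cs.length_mul_simple (cs.simple k') k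
      rw [cs.length_simple] at hne' ⊢
      rcases hne' with h | h
      · omega
      · exfalso
        have h4 : cs.length (cs.simple k' * cs.simple k) = 0 := by omega
        rw [cs.length_eq_zero_iff] at h4
        apply hne
        rw [mul_eq_one_iff_eq_inv, cs.inv_simple] at h4
        exact h4
    rw [if_pos h3, if_neg (by simp)] at h2
    exact zero_ne_one h2
  intro u hu
  unfold parabolic at hu
  induction hu using Subgroup.closure_induction with
  | mem x hx =>
    obtain ⟨k, hk, rfl⟩ := hx
    exact hs k hk
  | one => simp
  | mul x y _ _ h1 h2 =>
    have : d * (x * y) * d⁻¹ = (d * x * d⁻¹) * (d * y * d⁻¹) := by group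
    rw [this, h1, h2]
  | inv x _ h =>
    have : d * x⁻¹ * d⁻¹ = (d * x * d⁻¹)⁻¹ := by group
    rw [this, h]

/-- `I ⊆ K` is saturated: closed under equality of simple reflections indexed by `K`. -/
def Sat (K I : Finset B) : Prop :=
  I ⊆ K ∧ ∀ i ∈ I, ∀ j ∈ K, cs.simple i = cs.simple j → j ∈ I

lemma dset_sat (K I : Finset B) (d : W) : Sat cs K (dset cs K I d) := by
  refine ⟨dset_subset cs K I d, fun i hi j hj h => ?_⟩
  rw [mem_dset] at hi ⊢
  exact ⟨hj, h ▸ hi.2⟩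

lemma exists_sat {K I : Finset B} (hI : I ⊆ K) :
    ∃ I', Sat cs K I' ∧ parabolic cs I' = parabolic cs I := by
  classical
  refine ⟨K.filter (fun j => ∃ i ∈ I, cs.simple i = cs.simple j), ⟨Finset.filter_subset _ _, ?_⟩, ?_⟩
  · intro i hi j hj h
    rw [Finset.mem_filter] at hi ⊢
    obtain ⟨_, k, hk, e⟩ := hi
    exact ⟨hj, k, hk, e.trans h⟩
  · unfold parabolic
    congr 1
    ext x
    constructor
    · rintro ⟨j, hj, rfl⟩
      rw [Finset.mem_coe, Finset.mem_filter] at hj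
      obtain ⟨_, k, hk, e⟩ := hj
      exact ⟨k, hk, e⟩
    · rintro ⟨j, hj, rfl⟩
      refine ⟨j, ?_, rfl⟩
      rw [Finset.mem_coe, Finset.mem_filter]
      exact ⟨hI hj, j, hj, rfl⟩

lemma parabolic_mono {I K : Finset B} (h : I ⊆ K) : parabolic cs I ≤ parabolic cs K :=
  Subgroup.closure_mono (Set.image_mono (by exact_mod_cast h))

/-- Longest elements. -/
lemma exists_longest {K D : Finset B} (hD : Sat cs K D) :
    ∃ w ∈ parabolic cs K, ∀ k ∈ K, cs.length w < cs.length (w * cs.simple k) ↔ k ∉ D := by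
  obtain ⟨w, hw, hmax⟩ := Set.exists_max_image (parabolic cs D : Set W)
    (fun v => cs.length v) (Set.toFinite _) ⟨1, one_mem _⟩
  refine ⟨w, parabolic_mono cs hD.1 hw, fun k hk => ⟨fun h hkD => ?_, fun h => ?_⟩⟩
  · have := hmax (w * cs.simple k) (mul_mem hw (simple_mem_parabolic cs hkD))
    omega
  · by_contra hlt
    have hne := cs.length_mul_simple_ne w k
    obtain ⟨ω, hω, hr, rfl⟩ := exists_reduced cs hw
    obtain ⟨j, hj, hj'⟩ := exchange cs ω k (by omega)
    have hm : cs.simple k ∈ parabolic cs D := by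
      rw [← eq_inv_mul_iff_mul_eq] at hj'
      rw [hj']
      exact mul_mem (inv_mem (wordProd_mem cs _ hω))
        (wordProd_mem cs _ fun i hi => hω i (List.mem_of_mem_eraseIdx hi))
    obtain ⟨i, hi, e⟩ := eq_simple_of_length_one cs hm (cs.length_simple k)
    exact h (hD.2 i hi k hk e.symm)

lemma linIndep (K : Finset B) :
    LinearIndependent ℚ (fun I : {I : Finset B // Sat cs K I} => parDescentBasis cs K I.1) := by
  classical
  rw [Fintype.linearIndependent_iff]
  intro a ha
  have key : ∀ n : ℕ, ∀ I : {I : Finset B // Sat cs K I}, I.1.card = n → a I = 0 := by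
    intro n
    induction n using Nat.strong_induction_on with
    | _ n ih =>
      intro I hI
      have hD : Sat cs K (K \ I.1) := by
        refine ⟨Finset.sdiff_subset, fun i hi j hj h => ?_⟩
        rw [Finset.mem_sdiff] at hi ⊢
        exact ⟨hj, fun hjI => hi.2 (I.2.2 j hjI i hi.1 h.symm)⟩
      obtain ⟨w, hw, hwd⟩ := exists_longest cs hD
      have h1 := congrArg (fun x => x.coeff w) ha
      simp only [MonoidAlgebra.coeff_sum, Finsupp.finsetSum_apply, MonoidAlgebra.coeff_smul,
        Finsupp.smul_apply, coeff_par, MonoidAlgebra.coeff_zero, Finsupp.coe_zero,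
        Pi.zero_apply] at h1
      rw [Finset.sum_eq_single I] at h1
      · rw [if_pos] at h1
        · simpa using h1
        · refine ⟨hw, fun i hi => (hwd i (I.2.1 hi)).2 ?_⟩
          simp [hi]
      · intro J _ hJ
        split_ifs with hc
        · have hsub : J.1 ⊆ I.1 := by
            intro j hj
            have h2 := (hwd j (J.2.1 hj)).1 (hc.2 j hj)
            by_contra hjI
            exact h2 (Finset.mem_sdiff.2 ⟨J.2.1 hj, hjI⟩)
          have hss : J.1 ⊂ I.1 := by
            refine lt_of_le_of_ne hsub fun h => hJ (Subtype.ext h)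
          rw [ih J.1.card (hI ▸ Finset.card_lt_card hss) J rfl, zero_smul]
        · simp
      · simp
  exact fun I => key _ I rfl

lemma exists_functional (K : Finset B) (g : Finset B → ℚ) :
    ∃ φ : MonoidAlgebra ℚ W →ₗ[ℚ] ℚ, ∀ I, Sat cs K I → φ (parDescentBasis cs K I) = g I := by
  have hli := linIndep cs K
  obtain ⟨ψ, hψ⟩ := LinearMap.exists_leftInverse_of_injective
    (Finsupp.linearCombination ℚ
      (fun I : {I : Finset B // Sat cs K I} => parDescentBasis cs K I.1))
    (LinearMap.ker_eq_bot.2 hli)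
  refine ⟨(Finsupp.linearCombination ℚ (fun I : {I : Finset B // Sat cs K I} => g I.1)).comp ψ,
    fun I hI => ?_⟩
  have h1 := LinearMap.congr_fun hψ (Finsupp.single ⟨I, hI⟩ 1)
  simp only [LinearMap.comp_apply, Finsupp.linearCombination_single, one_smul,
    LinearMap.id_apply] at h1
  rw [LinearMap.comp_apply, h1]
  simp

open scoped Classical in
/-- Cardinality as a rational number. -/
noncomputable def qcard (Q : Subgroup W) : ℚ := ∑ x : W, if x ∈ Q then 1 else 0

open scoped Classical in
/-- Number of `x ∈ P` with `x⁻¹ H x ⊆ Q`. -/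
noncomputable def qcount (H P Q : Subgroup W) : ℚ :=
  ∑ x : W, if x ∈ P ∧ ∀ h ∈ H, x⁻¹ * h * x ∈ Q then 1 else 0

lemma qcard_pos (Q : Subgroup W) : 0 < qcard Q := by
  classical
  unfold qcard
  refine Finset.sum_pos' (fun x _ => by split_ifs <;> simp) ⟨1, Finset.mem_univ _, ?_⟩
  simp [one_mem]

lemma qcount_pos_iff (H P Q : Subgroup W) :
    0 < qcount H P Q ↔ ∃ x ∈ P, ∀ h ∈ H, x⁻¹ * h * x ∈ Q := by
  classical
  unfold qcount
  rw [Finset.sum_pos_iff_of_nonneg (fun x _ => by split_ifs <;> simp)]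
  constructor
  · rintro ⟨x, _, hx⟩
    by_cases hc : x ∈ P ∧ ∀ h ∈ H, x⁻¹ * h * x ∈ Q
    · exact ⟨x, hc⟩
    · rw [if_neg hc] at hx
      exact absurd hx (lt_irrefl _)
  · rintro ⟨x, hx⟩
    refine ⟨x, Finset.mem_univ _, ?_⟩
    rw [if_pos hx]
    exact one_pos

lemma qcard_translate (Q : Subgroup W) (y : W) : (open scoped Classical in
    ∑ x : W, if y⁻¹ * x ∈ Q then (1 : ℚ) else 0) = qcard Q := by
  classical
  unfold qcard
  exact Fintype.sum_equiv (Equiv.mulLeft y⁻¹) _ _ fun x => rfl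

lemma mem_parabolic_dset {K I : Finset B} {d y : W} (hd : memXKI cs K I d)
    (hy : y ∈ parabolic cs K) :
    y ∈ parabolic cs (dset cs K I d) ↔ d⁻¹ * y * d ∈ parabolic cs I := by
  constructor
  · intro h
    have hle : parabolic cs (dset cs K I d) ≤
        (parabolic cs I).comap (MulAut.conj d⁻¹).toMonoidHom := by
      conv_lhs => unfold parabolic
      rw [Subgroup.closure_le]
      rintro _ ⟨k, hk, rfl⟩
      change d⁻¹ * cs.simple k * d⁻¹⁻¹ ∈ parabolic cs I
      rw [inv_inv]
      exact (mem_dset_iff cs hd (dset_subset cs K I d hk)).1 hk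
    have h1 : d⁻¹ * y * d⁻¹⁻¹ ∈ parabolic cs I := hle h
    rwa [inv_inv] at h1
  · intro h
    obtain ⟨ω, hω, hr, rfl⟩ := exists_reduced cs hy
    have h1 := (kilmoyer cs hd.2 hd.1 hd.2 hd.1 ω hω hr _ h (by group)).2
    exact wordProd_mem cs ω fun k hk => (mem_dset cs).2 ⟨hω k hk, h1 k hk⟩

lemma exists_double (K I : Finset B) (x : W) :
    ∃ d, memXKI cs K I d ∧ ∃ y ∈ parabolic cs K, (y * d)⁻¹ * x ∈ parabolic cs I := by
  obtain ⟨⟨y, v⟩, ⟨hy, hv⟩, hmin⟩ := Set.exists_min_image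
    {p : W × W | p.1 ∈ parabolic cs K ∧ p.2 ∈ parabolic cs I}
    (fun p => cs.length (p.1 * x * p.2)) (Set.toFinite _) ⟨(1, 1), one_mem _, one_mem _⟩
  dsimp only at hy hv hmin
  refine ⟨y * x * v, ⟨isMin_inv_of_lt cs fun k hk => ?_, fun i hi => ?_⟩, y⁻¹, inv_mem hy, ?_⟩
  · have h1 := hmin (cs.simple k * y, v) ⟨mul_mem (simple_mem_parabolic cs hk) hy, hv⟩
    have h2 := cs.length_simple_mul_ne (y * x * v) k
    simp only [mul_assoc] at h1 h2 ⊢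
    omega
  · have h1 := hmin (y, v * cs.simple i) ⟨hy, mul_mem hv (simple_mem_parabolic cs hi)⟩
    have h2 := cs.length_mul_simple_ne (y * x * v) i
    simp only [mul_assoc] at h1 h2 ⊢
    omega
  · have : (y⁻¹ * (y * x * v))⁻¹ * x = v⁻¹ := by group
    rw [this]
    exact inv_mem hv

lemma double_unique {K I : Finset B} {d e x y z : W} (hd : memXKI cs K I d)
    (he : memXKI cs K I e) (hy : y ∈ parabolic cs K) (hz : z ∈ parabolic cs K)
    (h1 : (y * d)⁻¹ * x ∈ parabolic cs I) (h2 : (z * e)⁻¹ * x ∈ parabolic cs I) : d = e := by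
  obtain ⟨ω, hω, hr, h⟩ := exists_reduced cs (mul_mem (inv_mem hz) hy)
  refine (kilmoyer cs hd.2 hd.1 he.2 he.1 ω hω hr _ (mul_mem h2 (inv_mem h1)) ?_).1
  rw [h]
  group

open scoped Classical in
lemma inner_one (K I : Finset B) (x : W) :
    ∑ d : W with memXKI cs K I d, (qcard (parabolic cs (dset cs K I d)))⁻¹ *
      (∑ y : W, if y ∈ parabolic cs K ∧ (y * d)⁻¹ * x ∈ parabolic cs I then (1 : ℚ) else 0) = 1 := by
  obtain ⟨d, hd, y, hy, hx⟩ := exists_double cs K I x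
  rw [Finset.sum_eq_single d]
  · have : (∑ y : W, if y ∈ parabolic cs K ∧ (y * d)⁻¹ * x ∈ parabolic cs I then (1 : ℚ) else 0) =
        qcard (parabolic cs (dset cs K I d)) := by
      rw [← qcard_translate _ y]
      refine Finset.sum_congr rfl fun z _ => ?_
      have hiff : (z ∈ parabolic cs K ∧ (z * d)⁻¹ * x ∈ parabolic cs I) ↔
          y⁻¹ * z ∈ parabolic cs (dset cs K I d) := by
        have e : d⁻¹ * (y⁻¹ * z) * d = ((y * d)⁻¹ * x) * ((z * d)⁻¹ * x)⁻¹ := by group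
        constructor
        · rintro ⟨h1, h2⟩
          rw [mem_parabolic_dset cs hd (mul_mem (inv_mem hy) h1), e]
          exact mul_mem hx (inv_mem h2)
        · intro h
          have h1 : y⁻¹ * z ∈ parabolic cs K := parabolic_mono cs (dset_subset cs K I d) h
          rw [mem_parabolic_dset cs hd h1, e, Subgroup.mul_mem_cancel_left _ hx, inv_mem_iff] at h
          exact ⟨(Subgroup.mul_mem_cancel_left _ (inv_mem hy)).1 h1, h⟩
      simp only [hiff]
    rw [this]
    exact inv_mul_cancel₀ (qcard_pos _).ne'
  · intro e he hne
    rw [Finset.mem_filter] at he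
    rw [Finset.sum_eq_zero, mul_zero]
    intro z _
    rw [if_neg]
    rintro ⟨h1, h2⟩
    exact hne (double_unique cs he.2 hd h1 hy h2 hx)
  · intro h
    exact absurd (Finset.mem_filter.2 ⟨Finset.mem_univ _, hd⟩) h

open scoped Classical in
/-- Mackey formula for marks. -/
lemma mackey {K I : Finset B} {H : Subgroup W} (hH : H ≤ parabolic cs K) :
    qcount H ⊤ (parabolic cs I) / qcard (parabolic cs I) =
      ∑ d : W with memXKI cs K I d, qcount H (parabolic cs K) (parabolic cs (dset cs K I d)) /
        qcard (parabolic cs (dset cs K I d)) := by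
  rw [div_eq_iff (qcard_pos _).ne', Finset.sum_mul]
  have step : ∀ d ∈ Finset.univ.filter (fun d => memXKI cs K I d),
      qcount H (parabolic cs K) (parabolic cs (dset cs K I d)) /
        qcard (parabolic cs (dset cs K I d)) * qcard (parabolic cs I) =
      ∑ x : W, (if ∀ h ∈ H, x⁻¹ * h * x ∈ parabolic cs I then (1 : ℚ) else 0) *
        ((qcard (parabolic cs (dset cs K I d)))⁻¹ *
          (∑ y : W, if y ∈ parabolic cs K ∧ (y * d)⁻¹ * x ∈ parabolic cs I
            then (1 : ℚ) else 0)) := by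
    intro d hd
    replace hd := (Finset.mem_filter.1 hd).2
    rw [div_mul_eq_mul_div, div_eq_inv_mul]
    simp only [mul_left_comm _ (qcard (parabolic cs (dset cs K I d)))⁻¹]
    rw [← Finset.mul_sum]
    congr 1
    unfold qcount
    simp only [Finset.mul_sum]
    rw [Finset.sum_comm, Finset.sum_mul]
    refine Finset.sum_congr rfl fun y _ => ?_
    rw [← qcard_translate _ (y * d), Finset.mul_sum]
    refine Finset.sum_congr rfl fun x _ => ?_
    by_cases hy : y ∈ parabolic cs K
    · by_cases hx : (y * d)⁻¹ * x ∈ parabolic cs I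
      · have hiff : (∀ h ∈ H, y⁻¹ * h * y ∈ parabolic cs (dset cs K I d)) ↔
            ∀ h ∈ H, x⁻¹ * h * x ∈ parabolic cs I := by
          refine forall₂_congr fun h hh => ?_
          rw [mem_parabolic_dset cs hd (mul_mem (mul_mem (inv_mem hy) (hH hh)) hy)]
          have e : x⁻¹ * h * x = ((y * d)⁻¹ * x)⁻¹ * (d⁻¹ * (y⁻¹ * h * y) * d) *
            ((y * d)⁻¹ * x) := by group
          rw [e, Subgroup.mul_mem_cancel_right _ hx, Subgroup.mul_mem_cancel_left _ (inv_mem hx)]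
        simp only [hy, hx, hiff, true_and]
      · simp only [hx, and_false, if_false, mul_zero]
    · simp [hy]
  rw [Finset.sum_congr rfl step, Finset.sum_comm]
  unfold qcount
  refine Finset.sum_congr rfl fun x _ => ?_
  rw [← Finset.mul_sum, inner_one, mul_one]
  simp

lemma qcount_conj (H Q : Subgroup W) (w : W) :
    qcount (H.map (MulAut.conj w).toMonoidHom) ⊤ Q = qcount H ⊤ Q := by
  classical
  unfold qcount
  refine (Fintype.sum_equiv (Equiv.mulLeft w) _ _ fun x => ?_).symm
  have hiff : (∀ h ∈ H.map (MulAut.conj w).toMonoidHom,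
      (Equiv.mulLeft w x)⁻¹ * h * (Equiv.mulLeft w x) ∈ Q) ↔ ∀ h ∈ H, x⁻¹ * h * x ∈ Q := by
    have e : ∀ h, (w * x)⁻¹ * (w * h * w⁻¹) * (w * x) = x⁻¹ * h * x := fun h => by group
    constructor
    · intro h1 h hh
      rw [← e]
      exact h1 _ ⟨h, hh, rfl⟩
    · rintro h1 _ ⟨h, hh, rfl⟩
      have := h1 h hh
      rw [← e] at this
      exact this
  simp only [hiff, Subgroup.mem_top, true_and]

lemma lambda_injective {A : Subalgebra ℚ (MonoidAlgebra ℚ W)} (hA : IsDescentAlgebra cs A)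
    {K : Finset B} {R : MonoidAlgebra ℚ W →ₗ[ℚ] MonoidAlgebra ℚ W} (hR : IsResK cs K R)
    (hsurj : ∀ I ⊆ K, ∃ x ∈ A, R x = parDescentBasis cs K I)
    {I J : Finset B} (hI : I ⊆ K) (hJ : J ⊆ K) {w : W}
    (hw : parabolic cs J = (parabolic cs I).map (MulAut.conj w).toMonoidHom) :
    ∃ w ∈ parabolic cs K, parabolic cs J =
      (parabolic cs I).map (MulAut.conj w).toMonoidHom := by
  classical
  obtain ⟨φ, hφ⟩ := exists_functional cs K fun L =>
    qcount (parabolic cs I) (parabolic cs K) (parabolic cs L) / qcard (parabolic cs L)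
  obtain ⟨ψ, hψ⟩ := exists_functional cs K fun L =>
    qcount (parabolic cs J) (parabolic cs K) (parabolic cs L) / qcard (parabolic cs L)
  have hbasis : ∀ L, φ (R (descentBasis cs L)) = ψ (R (descentBasis cs L)) := by
    intro L
    rw [resK_eq cs hR, map_sum, map_sum]
    simp only [hφ _ (dset_sat cs K L _), hψ _ (dset_sat cs K L _)]
    rw [← mackey cs (parabolic_mono cs hI), ← mackey cs (parabolic_mono cs hJ), hw, qcount_conj]
  have hall : ∀ x ∈ A, φ (R x) = ψ (R x) := by
    intro x hx
    have hx' : x ∈ Submodule.span ℚ (Set.range (descentBasis cs)) := by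
      have : x ∈ (A : Set (MonoidAlgebra ℚ W)) := hx
      rw [hA] at this
      exact this
    clear hx
    induction hx' using Submodule.span_induction with
    | mem x h =>
      obtain ⟨L, rfl⟩ := h
      exact hbasis L
    | zero => simp
    | add x y hx hy h1 h2 => simp only [map_add, h1, h2]
    | smul a x hx h => simp only [map_smul, h]
  obtain ⟨I', hI', hpar⟩ := exists_sat cs hI
  obtain ⟨x, hx, hRx⟩ := hsurj I' hI'.1
  have h1 := hall x hx
  rw [hRx, hφ _ hI', hψ _ hI', hpar, div_left_inj' (qcard_pos _).ne'] at h1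
  have h2 : 0 < qcount (parabolic cs I) (parabolic cs K) (parabolic cs I) :=
    (qcount_pos_iff _ _ _).2 ⟨1, one_mem _, fun h hh => by simpa using hh⟩
  rw [h1, qcount_pos_iff] at h2
  obtain ⟨u, hu, hsub⟩ := h2
  refine ⟨u, hu, ?_⟩
  have hcard : ∀ v : W, Nat.card ((parabolic cs I).map (MulAut.conj v).toMonoidHom) =
      Nat.card (parabolic cs I) := fun v =>
    Subgroup.card_map_of_injective (MulAut.conj v).injective
  refine Subgroup.eq_of_le_of_card_ge ?_ ?_
  · intro h hh
    refine ⟨u⁻¹ * h * u, hsub h hh, ?_⟩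
    change u * (u⁻¹ * h * u) * u⁻¹ = h
    group
  · rw [hcard u, hw, hcard w]

end Coxeter

end ResKAux

set_option synthInstance.maxHeartbeats 1000000 in
set_option maxHeartbeats 1000000 in
/-- The image of `Res_K : Σ(W) → Σ(W_K)` is contained in the subalgebra
`Σ(W_K)^{W(K)}` of fixed points of the conjugation action of
`W(K) = {w ∈ X_{KK} : wKw⁻¹ = K}`.  Consequently, if `Res_K` is surjective onto
`Σ(W_K)`, then `W(K)` acts trivially on `W_K` and the natural map `Λ_K → Λ` is
injective (subsets of `K` whose parabolics are conjugate in `W` are already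
conjugate in `W_K`). -/
theorem resK_image_fixedPoints {M : CoxeterMatrix B}
    (cs : CoxeterSystem M W) (A : Subalgebra ℚ (MonoidAlgebra ℚ W))
    (hA : IsDescentAlgebra cs A) (K : Finset B)
    (R : MonoidAlgebra ℚ W →ₗ[ℚ] MonoidAlgebra ℚ W) (hR : IsResK cs K R) :
    (∀ x ∈ A, ∀ d : W, memWK cs K d →
      MonoidAlgebra.single d (1 : ℚ) * R x * MonoidAlgebra.single d⁻¹ (1 : ℚ) = R x) ∧
    ((∀ y ∈ Submodule.span ℚ (parDescentBasis cs K '' {I : Finset B | I ⊆ K}),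
        ∃ x ∈ A, R x = y) →
      (∀ d : W, memWK cs K d → ∀ u ∈ parabolic cs K, d * u * d⁻¹ = u) ∧
      (∀ I J : Finset B, I ⊆ K → J ⊆ K →
        (∃ w : W, parabolic cs J =
          Subgroup.map (MulAut.conj w).toMonoidHom (parabolic cs I)) →
        ∃ w ∈ parabolic cs K, parabolic cs J =
          Subgroup.map (MulAut.conj w).toMonoidHom (parabolic cs I))) := by
  refine ⟨fun x hx d hd => ResKAux.res_fixed_all cs hA hR hd hx, fun hsurj => ?_⟩
  have hs : ∀ I ⊆ K, ∃ x ∈ A, R x = parDescentBasis cs K I := fun I hI =>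
    hsurj _ (Submodule.subset_span ⟨I, hI, rfl⟩)
  refine ⟨fun d hd => ResKAux.acts_trivially cs hd fun I hI => ?_, ?_⟩
  · obtain ⟨x, hx, h⟩ := hs I hI
    rw [← h]
    exact ResKAux.res_fixed_all cs hA hR hd hx
  · rintro I J hI hJ ⟨w, hw⟩
    exact ResKAux.lambda_injective cs hA hR hs hI hJ hw
end

section
/- Let (W_n, S_n) be the Coxeter system of type B_n with S_n = {t, s₁, …, s_{n−1}}, and W′_n = ⟨S′_n⟩ the reflection subgroup of type D_n with S′_n = {s′₁ = ts₁t, s₁, …, s_{n−1}}, so W_n = ⟨t⟩ ⋉ W′_n. Define Res_n : Σ(W_n) → Σ(W′_n) on the basis by Res_n(x_I) = x^{D}_{W_I ∩ S′_n} if t ∈ I, and Res_n(x_I) = x^{D}_I + x^{D}_{tIt} if t ∉ I. Then Res_n is an algebra homomorphism satisfying (1+t)·Res_n(x) = x·(1+t) for all x ∈ Σ(W_n), and its image is exactly Σ(W′_n)^{σ_n}, the fixed subalgebra under the diagram automorphism σ_n given by conjugation by t. -/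
open MonoidAlgebra

variable {B W : Type*} [DecidableEq B] [Fintype B] [Group W] [Fintype W] [DecidableEq W]

variable {n : ℕ}

/-- The generator `t` of the Coxeter system of type `Bₙ₊₁` (the end of the diagram
carrying the bond labelled 4, following the convention of `CoxeterMatrix.Bₙ`). -/
def typeBt (cs : CoxeterSystem (CoxeterMatrix.Bₙ (n + 1)) W) : W :=
  cs.simple (Fin.last n)

/-- The simple system `S′ = {s₁′ = t s₁ t, s₁, …}` of the reflection subgroup of type
`Dₙ₊₁` inside type `Bₙ₊₁`: the generator indexed by `Fin.last n` (the index of `t`)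
is replaced by `s₁′ = t s₁ t`, where `s₁` is the neighbour of `t`. -/
def typeDGen (cs : CoxeterSystem (CoxeterMatrix.Bₙ (n + 1)) W) (i : Fin (n + 1)) : W :=
  if i = Fin.last n then
    typeBt cs * cs.simple (⟨n - 1, Nat.lt_succ_of_le (Nat.sub_le n 1)⟩ : Fin (n + 1)) *
      typeBt cs
  else cs.simple i

/-- The reflection subgroup `W′` of type `Dₙ₊₁` of the group `W` of type `Bₙ₊₁`. -/
def typeDSubgroup (cs : CoxeterSystem (CoxeterMatrix.Bₙ (n + 1)) W) : Subgroup W :=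
  Subgroup.closure (Set.range (typeDGen cs))

open scoped Classical in
/-- `x^D_I`: the basis element of the descent algebra `Σ(W′)` of the type `D`
subgroup `W′`, viewed inside `ℚW`: the sum of the `w ∈ W′` with `ws > w` for all
`s ∈ I ⊆ S′` (descents with respect to `S′`, which are detected by the ambient
length function). -/
noncomputable def typeDDescentBasis (cs : CoxeterSystem (CoxeterMatrix.Bₙ (n + 1)) W)
    (I : Finset (Fin (n + 1))) : MonoidAlgebra ℚ W :=
  ∑ w : W, if w ∈ typeDSubgroup cs ∧
      ∀ i ∈ I, cs.length w < cs.length (w * typeDGen cs i)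
    then MonoidAlgebra.single w (1 : ℚ) else 0

open scoped Classical in
/-- The defining formula, on the basis `x_I` of `Σ(Wₙ)`, of the restriction map
`Res_n : Σ(Wₙ) → Σ(Wₙ′)` from type `B` to type `D`:
`Res_n(x_I) = x^D_{W_I ∩ S′}` if `t ∈ I`, and `Res_n(x_I) = x^D_I + x^D_{tIt}`
if `t ∉ I`. -/
def IsResBD (cs : CoxeterSystem (CoxeterMatrix.Bₙ (n + 1)) W)
    (R : MonoidAlgebra ℚ W →ₗ[ℚ] MonoidAlgebra ℚ W) : Prop :=
  ∀ I : Finset (Fin (n + 1)), R (descentBasis cs I) =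
    if Fin.last n ∈ I then
      typeDDescentBasis cs (Finset.univ.filter (fun j => typeDGen cs j ∈ parabolic cs I))
    else
      typeDDescentBasis cs I +
        typeDDescentBasis cs (Finset.univ.filter (fun j =>
          ∃ i ∈ I, typeDGen cs j = typeBt cs * cs.simple i * (typeBt cs)⁻¹))

namespace ResBD

section general

variable {B W : Type*} [Group W] {M : CoxeterMatrix B} (cs : CoxeterSystem M W)

open Classical in
/-- The generators of the reflection permutation representation. -/
noncomputable def refl (i : B) : Function.End (W × ZMod 2) :=
  fun p => (cs.simple i * p.1 * cs.simple i, p.2 + if p.1 = cs.simple i then 1 else 0)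

theorem dihedral_aux {a b : W} (ha : a * a = 1) (hb : b * b = 1) (k : ℕ) (x : W) :
    (((a * b) ^ k * x * ((a * b) ^ k)⁻¹ = b) ↔ x = (b * a) ^ (2 * k) * b) ∧
    ((b * ((a * b) ^ k * x * ((a * b) ^ k)⁻¹) * b = a) ↔ x = (b * a) ^ (2 * k + 1) * b) := by
  have ha' : a⁻¹ = a := inv_eq_of_mul_eq_one_left ha
  have hb' : b⁻¹ = b := inv_eq_of_mul_eq_one_left hb
  have hba : b * a = (a * b)⁻¹ := by rw [mul_inv_rev, ha', hb']
  have hsc : SemiconjBy b (a * b) (b * a) := by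
    simp [SemiconjBy, mul_assoc]
  have hsk : b * (a * b) ^ k = (b * a) ^ k * b := hsc.pow_right k
  have hk : ((a * b) ^ k)⁻¹ = (b * a) ^ k := by rw [hba, inv_pow]
  have h1 : (b * a) ^ (2 * k) * b = ((a * b) ^ k)⁻¹ * b * (a * b) ^ k := by
    rw [hk, mul_assoc, hsk, two_mul, pow_add, mul_assoc]
  have h2 : (b * a) ^ (2 * k + 1) * b = ((a * b) ^ k)⁻¹ * (b * a * b) * (a * b) ^ k := by
    rw [hk, mul_assoc, mul_assoc, hsk, two_mul, add_assoc, pow_add, pow_succ']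
    simp only [mul_assoc]
  rw [h1, h2]
  clear h1 h2 hk hsk
  generalize (a * b) ^ k = c
  constructor
  · constructor
    · intro h; subst h; group
    · intro h; rw [h]; group
  · constructor
    · intro h
      have : b * a * b = c * x * c⁻¹ := by
        rw [← h]
        simp only [← mul_assoc, hb, one_mul]
        simp only [mul_assoc, hb, mul_one]
      rw [this]; group
    · intro h
      have : c * x * c⁻¹ = b * a * b := by rw [h]; group
      rw [this]
      simp only [← mul_assoc, hb, one_mul]
      simp only [mul_assoc, hb, mul_one]

open Classical in
theorem refl_pow (i j : B) (k : ℕ) (x : W) (e : ZMod 2) :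
    ((refl cs i * refl cs j) ^ k) (x, e) =
      ((cs.simple i * cs.simple j) ^ k * x * ((cs.simple i * cs.simple j) ^ k)⁻¹,
        e + ∑ l ∈ Finset.range (2 * k),
          if x = (cs.simple j * cs.simple i) ^ l * cs.simple j then 1 else 0) := by
  induction k with
  | zero => simp; rfl
  | succ k ih =>
    rw [pow_succ']
    change refl cs i (refl cs j (((refl cs i * refl cs j) ^ k) (x, e))) = _
    rw [ih]
    obtain ⟨h1, h2⟩ := dihedral_aux (cs.simple_mul_simple_self i) (cs.simple_mul_simple_self j) k x
    unfold refl
    simp only [h1, h2, mul_add, mul_one, Finset.sum_range_succ, Prod.mk.injEq]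
    constructor
    · simp only [pow_succ', mul_inv_rev, CoxeterSystem.inv_simple, mul_assoc]
    · simp only [add_assoc]

theorem refl_liftable : M.IsLiftable (refl cs) := by
  classical
  intro i j
  funext p
  obtain ⟨x, e⟩ := p
  rw [refl_pow, cs.simple_mul_simple_pow]
  rw [two_mul, Finset.sum_range_add]
  have h : ∀ l, (cs.simple j * cs.simple i) ^ (M i j + l) = (cs.simple j * cs.simple i) ^ l := by
    intro l
    rw [pow_add, cs.simple_mul_simple_pow', one_mul]
  simp only [h, CharTwo.add_self_eq_zero]
  simp
  rfl

/-- The reflection permutation representation. -/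
noncomputable def reflRep : W →* Function.End (W × ZMod 2) :=
  cs.lift ⟨refl cs, refl_liftable cs⟩

/-- The reflection cocycle. -/
noncomputable def eta (w x : W) : ZMod 2 := (reflRep cs w (x, 0)).2

theorem reflRep_simple (i : B) : reflRep cs (cs.simple i) = refl cs i :=
  cs.lift_apply_simple _ i

theorem reflRep_apply (w x : W) (e : ZMod 2) :
    reflRep cs w (x, e) = (w * x * w⁻¹, e + eta cs w x) := by
  induction w using cs.simple_induction_left generalizing x e with
  | one => simp [eta]; exact Prod.ext rfl (add_zero e).symm
  | mul_simple_left w i ih =>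
    have h : ∀ x e, reflRep cs (cs.simple i * w) (x, e) =
        refl cs i (w * x * w⁻¹, e + eta cs w x) := by
      intro x e
      rw [map_mul, reflRep_simple, ← ih]; rfl
    unfold eta
    rw [h, h]
    simp [refl, mul_assoc, add_assoc]

theorem eta_mul (w v x : W) : eta cs (w * v) x = eta cs v x + eta cs w (v * x * v⁻¹) := by
  conv_lhs => unfold eta
  rw [map_mul]
  change (reflRep cs w (reflRep cs v (x, 0))).2 = _
  rw [reflRep_apply, reflRep_apply]
  simp

theorem eta_one (x : W) : eta cs 1 x = 0 := by
  unfold eta; rw [map_one]; rfl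

open Classical in
theorem eta_simple (i : B) (x : W) :
    eta cs (cs.simple i) x = if x = cs.simple i then 1 else 0 := by
  unfold eta; rw [reflRep_simple]; simp [refl]

theorem eta_self {r : W} (hr : cs.IsReflection r) : eta cs r r = 1 := by
  obtain ⟨u, i, rfl⟩ := hr
  have h := eta_mul cs u u⁻¹ (u * cs.simple i * u⁻¹)
  have e1 : u⁻¹ * (u * cs.simple i * u⁻¹) * u⁻¹⁻¹ = cs.simple i := by group
  rw [mul_inv_cancel, eta_one, e1] at h
  rw [eta_mul cs (u * cs.simple i) u⁻¹, e1, eta_mul, eta_simple, if_pos rfl]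
  simp only [CoxeterSystem.inv_simple, CoxeterSystem.simple_mul_simple_self, one_mul]
  linear_combination -h

theorem exchange (ω : List B) (x : W) (h : eta cs (cs.wordProd ω) x ≠ 0) :
    ∃ ω1 i ω2, ω = ω1 ++ i :: ω2 ∧ cs.wordProd ω * x = cs.wordProd (ω1 ++ ω2) := by
  induction ω with
  | nil => simp [eta_one] at h
  | cons i ω ih =>
    by_cases h0 : eta cs (cs.wordProd ω) x = 0
    · rw [cs.wordProd_cons, eta_mul, h0, eta_simple, zero_add] at h
      have h1 : cs.wordProd ω * x * (cs.wordProd ω)⁻¹ = cs.simple i := by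
        by_contra h2
        simp [h2] at h
      refine ⟨[], i, ω, rfl, ?_⟩
      rw [mul_inv_eq_iff_eq_mul] at h1
      rw [cs.wordProd_cons, mul_assoc, h1]
      simp
    · obtain ⟨ω1, j, ω2, rfl, h2⟩ := ih h0
      refine ⟨i :: ω1, j, ω2, rfl, ?_⟩
      rw [cs.wordProd_cons, mul_assoc, h2, ← cs.wordProd_cons]; rfl

theorem lt_of_eta_ne {w x : W} (h : eta cs w x ≠ 0) : cs.length (w * x) < cs.length w := by
  obtain ⟨ω, hω, rfl⟩ := cs.exists_isReduced w
  obtain ⟨ω1, i, ω2, h1, h2⟩ := exchange cs ω x h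
  rw [h2, hω.eq, h1]
  refine lt_of_le_of_lt (cs.length_wordProd_le _) ?_
  simp

theorem zmod2 (a : ZMod 2) (h : a ≠ 0) : a = 1 := by
  revert a; decide

theorem lt_iff_eta {w r : W} (hr : cs.IsReflection r) :
    cs.length w < cs.length (w * r) ↔ eta cs w r = 0 := by
  constructor
  · intro h
    by_contra h0
    exact absurd (lt_of_eta_ne cs h0) (by omega)
  · intro h
    have h1 : eta cs (w * r) r ≠ 0 := by
      rw [eta_mul, eta_self cs hr, mul_inv_cancel_right, h]; decide
    have := lt_of_eta_ne cs h1
    rwa [mul_assoc, hr.mul_self, mul_one] at this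

theorem mem_parabolic_iff (J : Finset B) (v : W) :
    v ∈ parabolic cs J ↔ ∃ ω : List B, (∀ j ∈ ω, j ∈ J) ∧ cs.wordProd ω = v := by
  constructor
  · intro h
    unfold parabolic at h
    induction h using Subgroup.closure_induction with
    | mem x hx =>
      obtain ⟨i, hi, rfl⟩ := hx
      exact ⟨[i], by simpa using hi, by simp⟩
    | one => exact ⟨[], by simp, by simp⟩
    | mul x y _ _ hx hy =>
      obtain ⟨a, ha, rfl⟩ := hx
      obtain ⟨b, hb, rfl⟩ := hy
      refine ⟨a ++ b, ?_, cs.wordProd_append a b⟩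
      intro j hj
      rcases List.mem_append.1 hj with h | h
      · exact ha j h
      · exact hb j h
    | inv x _ hx =>
      obtain ⟨a, ha, rfl⟩ := hx
      exact ⟨a.reverse, by simpa using ha, by simp⟩
  · rintro ⟨ω, hω, rfl⟩
    unfold CoxeterSystem.wordProd
    apply Subgroup.list_prod_mem
    intro x hx
    obtain ⟨i, hi, rfl⟩ := List.mem_map.1 hx
    exact Subgroup.subset_closure ⟨i, hω i hi, rfl⟩

theorem lt_of_min (J : Finset B) (u : W) (hu : ∀ i ∈ J, cs.length u < cs.length (u * cs.simple i))
    (r : W) (hr : cs.IsReflection r) (hrJ : r ∈ parabolic cs J) :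
    cs.length u < cs.length (u * r) := by
  -- a minimal element of the coset
  obtain ⟨v, hv, hmin⟩ : ∃ v ∈ parabolic cs J, ∀ v' ∈ parabolic cs J,
      cs.length (u * v) ≤ cs.length (u * v') := by
    obtain ⟨v, hv, h⟩ := (measure fun v : W => cs.length (u * v)).wf.has_min
      (parabolic cs J : Set W) ⟨1, one_mem _⟩
    exact ⟨v, hv, fun v' hv' => not_lt.1 (h v' hv')⟩
  have hlen : ∃ ω : List B, (∀ j ∈ ω, j ∈ J) ∧ cs.wordProd ω = v⁻¹ :=
    (mem_parabolic_iff cs J _).1 (inv_mem hv)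
  obtain ⟨ω, ⟨hωJ, hωv⟩, hωmin⟩ := (measure (List.length (α := B))).wf.has_min
    {ω : List B | (∀ j ∈ ω, j ∈ J) ∧ cs.wordProd ω = v⁻¹} hlen
  rcases List.eq_nil_or_concat ω with rfl | ⟨ω', j, rfl⟩
  · have : v = 1 := by simpa using hωv.symm
    subst this
    have := hmin r hrJ
    rw [mul_one] at this
    exact lt_of_le_of_ne this (hr.length_mul_left_ne u).symm
  · exfalso
    have hjJ : j ∈ J := hωJ j (by simp)
    have hω'J : ∀ k ∈ ω', k ∈ J := fun k hk => hωJ k (by simp [hk])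
    rw [List.concat_eq_append, cs.wordProd_append, cs.wordProd_singleton] at hωv
    have hu' : u = u * v * cs.wordProd ω' * cs.simple j := by
      rw [mul_assoc, hωv]; group
    have h0 := (lt_iff_eta cs (cs.isReflection_simple j)).1 (hu j hjJ)
    rw [hu', eta_mul, eta_self cs (cs.isReflection_simple j), mul_inv_cancel_right, eta_mul] at h0
    have hr' : cs.IsReflection (cs.wordProd ω' * cs.simple j * (cs.wordProd ω')⁻¹) :=
      (cs.isReflection_simple j).conj _
    have hw' : cs.wordProd ω' ∈ parabolic cs J := (mem_parabolic_iff cs J _).2 ⟨ω', hω'J, rfl⟩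
    have hj' : cs.simple j ∈ parabolic cs J := Subgroup.subset_closure ⟨j, hjJ, rfl⟩
    have h1 : eta cs (u * v) (cs.wordProd ω' * cs.simple j * (cs.wordProd ω')⁻¹) = 0 := by
      rw [← lt_iff_eta cs hr']
      refine lt_of_le_of_ne ?_ (hr'.length_mul_left_ne _).symm
      rw [mul_assoc u v]
      exact hmin _ (mul_mem hv (mul_mem (mul_mem hw' hj') (inv_mem hw')))
    have h2 : eta cs (cs.wordProd ω') (cs.simple j) ≠ 0 := by
      intro h2
      rw [h1, h2] at h0
      exact absurd h0 (by decide)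
    obtain ⟨ω1, i, ω2, h3, h4⟩ := exchange cs ω' _ h2
    refine hωmin (ω1 ++ ω2) ⟨?_, ?_⟩ ?_
    · intro k hk
      apply hω'J
      rw [h3]
      simp only [List.mem_append, List.mem_cons] at hk ⊢
      tauto
    · rw [← h4, hωv]
    · change (ω1 ++ ω2).length < (ω'.concat j).length
      rw [h3]
      simp

end general
end ResBD
namespace ResBD
section typeB
variable {W : Type*} [Group W] {n : ℕ}

/-- Swap of the two end nodes of the type D diagram. -/
def sw (n : ℕ) : Equiv.Perm (Fin (n + 1)) :=
  Equiv.swap (Fin.last n) ⟨n - 1, Nat.lt_succ_of_le (Nat.sub_le n 1)⟩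

theorem sw_sw (j : Fin (n + 1)) : sw n (sw n j) = j := Equiv.swap_apply_self _ _ _

variable (cs : CoxeterSystem (CoxeterMatrix.Bₙ (n + 1)) W)

theorem t_mul_t : typeBt cs * typeBt cs = 1 := cs.simple_mul_simple_self _

theorem t_inv : (typeBt cs)⁻¹ = typeBt cs := cs.inv_simple _

theorem t_t_mul (w : W) : typeBt cs * (typeBt cs * w) = w := by
  rw [← mul_assoc, t_mul_t, one_mul]

theorem mul_t_t (w : W) : w * typeBt cs * typeBt cs = w := by
  rw [mul_assoc, t_mul_t, mul_one]

theorem t_comm (i : Fin (n + 1)) (h1 : i ≠ Fin.last n) (h2 : (i : ℕ) ≠ n - 1) :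
    typeBt cs * cs.simple i * typeBt cs = cs.simple i := by
  have h := cs.simple_mul_simple_pow (Fin.last n) i
  have h1' : (i : ℕ) ≠ n := fun h => h1 (Fin.ext h)
  have hM : (CoxeterMatrix.Bₙ (n + 1)).M (Fin.last n) i = 2 := by
    change (if Fin.last n = i then 1
      else (if (Fin.last n : ℕ) = n + 1 - 1 ∧ (i : ℕ) = n + 1 - 2 ∨
          (i : ℕ) = n + 1 - 1 ∧ (Fin.last n : ℕ) = n + 1 - 2 then 4
        else (if (i : ℕ) + 1 = (Fin.last n : ℕ) ∨ (Fin.last n : ℕ) + 1 = i then 3 else 2))) = 2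
    rw [if_neg (Ne.symm h1), if_neg, if_neg]
    · simp only [Fin.val_last]; omega
    · simp only [Fin.val_last]; omega
  rw [hM, pow_two] at h
  change typeBt cs * cs.simple i * (typeBt cs * cs.simple i) = 1 at h
  rw [← mul_assoc] at h
  have := eq_inv_of_mul_eq_one_left h
  rwa [cs.inv_simple] at this

theorem gen_last : typeDGen cs (Fin.last n) = typeBt cs *
    cs.simple (⟨n - 1, Nat.lt_succ_of_le (Nat.sub_le n 1)⟩ : Fin (n + 1)) * typeBt cs := by
  simp [typeDGen]

theorem gen_of_ne {i : Fin (n + 1)} (h : i ≠ Fin.last n) : typeDGen cs i = cs.simple i := by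
  simp [typeDGen, h]

theorem gen_sw (hn : 1 ≤ n) (j : Fin (n + 1)) :
    typeDGen cs (sw n j) = typeBt cs * typeDGen cs j * typeBt cs := by
  have hne : (⟨n - 1, Nat.lt_succ_of_le (Nat.sub_le n 1)⟩ : Fin (n + 1)) ≠ Fin.last n := by
    intro h
    have := congrArg Fin.val h
    simp at this
    omega
  by_cases h1 : j = Fin.last n
  · subst h1
    rw [sw, Equiv.swap_apply_left, gen_last, gen_of_ne cs hne]
    simp only [mul_assoc, t_t_mul, t_mul_t, mul_one]
  by_cases h2 : j = ⟨n - 1, Nat.lt_succ_of_le (Nat.sub_le n 1)⟩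
  · subst h2
    rw [sw, Equiv.swap_apply_right, gen_last, gen_of_ne cs hne]
  · rw [sw, Equiv.swap_apply_of_ne_of_ne h1 h2, gen_of_ne cs h1, t_comm cs j h1]
    intro h
    exact h2 (Fin.ext h)

theorem gen_refl (j : Fin (n + 1)) : cs.IsReflection (typeDGen cs j) := by
  unfold typeDGen
  split_ifs
  · have := (cs.isReflection_simple
      (⟨n - 1, Nat.lt_succ_of_le (Nat.sub_le n 1)⟩ : Fin (n + 1))).conj (typeBt cs)
    rwa [t_inv] at this
  · exact cs.isReflection_simple j

theorem chi_liftable : (CoxeterMatrix.Bₙ (n + 1)).IsLiftable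
    (fun i : Fin (n + 1) => if i = Fin.last n then (-1 : ℤˣ) else 1) := by
  intro i j
  by_cases hi : i = Fin.last n <;> by_cases hj : j = Fin.last n
  · simp [hi, hj]
  · subst hi
    beta_reduce
    rw [if_pos rfl, if_neg hj, mul_one]
    change (-1 : ℤˣ) ^ (if Fin.last n = j then 1
      else (if (Fin.last n : ℕ) = n + 1 - 1 ∧ (j : ℕ) = n + 1 - 2 ∨
          (j : ℕ) = n + 1 - 1 ∧ (Fin.last n : ℕ) = n + 1 - 2 then 4
        else (if (j : ℕ) + 1 = (Fin.last n : ℕ) ∨ (Fin.last n : ℕ) + 1 = j then 3 else 2))) = 1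
    have hj' : (j : ℕ) ≠ n := fun h => hj (Fin.ext h)
    have hj2 := j.2
    rw [if_neg (Ne.symm hj)]
    split_ifs with h1 h2
    · decide
    · simp only [Fin.val_last] at h1 h2; omega
    · decide
  · subst hj
    beta_reduce
    rw [if_pos rfl, if_neg hi, one_mul]
    change (-1 : ℤˣ) ^ (if i = Fin.last n then 1
      else (if (i : ℕ) = n + 1 - 1 ∧ (Fin.last n : ℕ) = n + 1 - 2 ∨
          (Fin.last n : ℕ) = n + 1 - 1 ∧ (i : ℕ) = n + 1 - 2 then 4
        else (if (Fin.last n : ℕ) + 1 = (i : ℕ) ∨ (i : ℕ) + 1 = (Fin.last n : ℕ)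
          then 3 else 2))) = 1
    have hi' : (i : ℕ) ≠ n := fun h => hi (Fin.ext h)
    have hi2 := i.2
    rw [if_neg hi]
    split_ifs with h1 h2
    · decide
    · simp only [Fin.val_last] at h1 h2; omega
    · decide
  · simp [hi, hj]

/-- The linear character with value `-1` on `t` and `1` on the other generators. -/
noncomputable def chi : W →* ℤˣ := cs.lift ⟨_, chi_liftable⟩

theorem chi_t : chi cs (typeBt cs) = -1 := by
  unfold chi typeBt
  rw [cs.lift_apply_simple]; simp

theorem chi_gen (hn : 1 ≤ n) (j : Fin (n + 1)) : chi cs (typeDGen cs j) = 1 := by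
  have h : ∀ i ≠ Fin.last n, chi cs (cs.simple i) = 1 := by
    intro i hi
    unfold chi
    rw [cs.lift_apply_simple]; simp [hi]
  unfold typeDGen
  split_ifs with hj
  · rw [map_mul, map_mul, h, chi_t]
    · simp
    · intro h
      have := congrArg Fin.val h
      simp at this
      omega
  · exact h j hj

theorem t_not_mem (hn : 1 ≤ n) {w : W} (h : w ∈ typeDSubgroup cs) : chi cs w = 1 := by
  have : typeDSubgroup cs ≤ (chi cs).ker := by
    unfold typeDSubgroup
    rw [Subgroup.closure_le]
    rintro _ ⟨j, rfl⟩
    exact chi_gen cs hn j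
  exact this h

theorem conj_mem (hn : 1 ≤ n) {w : W} (h : w ∈ typeDSubgroup cs) :
    typeBt cs * w * typeBt cs ∈ typeDSubgroup cs := by
  have : typeDSubgroup cs ≤ (typeDSubgroup cs).comap (MulAut.conj (typeBt cs)).toMonoidHom := by
    conv_lhs => unfold typeDSubgroup
    rw [Subgroup.closure_le]
    rintro _ ⟨j, rfl⟩
    change typeBt cs * typeDGen cs j * (typeBt cs)⁻¹ ∈ typeDSubgroup cs
    rw [t_inv, ← gen_sw cs hn]
    exact Subgroup.subset_closure ⟨_, rfl⟩
  have h2 := this h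
  change typeBt cs * w * (typeBt cs)⁻¹ ∈ typeDSubgroup cs at h2
  rwa [t_inv] at h2

theorem conj_mem_iff (hn : 1 ≤ n) (w : W) :
    typeBt cs * w * typeBt cs ∈ typeDSubgroup cs ↔ w ∈ typeDSubgroup cs := by
  refine ⟨fun h => ?_, conj_mem cs hn⟩
  have := conj_mem cs hn h
  simpa only [mul_assoc, t_t_mul, t_mul_t, mul_one] using this

theorem t_mul_mem_iff (hn : 1 ≤ n) (w : W) :
    typeBt cs * w ∈ typeDSubgroup cs ↔ w ∉ typeDSubgroup cs := by
  constructor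
  · intro h h'
    have h1 := t_not_mem cs hn h
    rw [map_mul, t_not_mem cs hn h', chi_t] at h1
    exact absurd h1 (by decide)
  · intro h
    have : w ∈ typeDSubgroup cs ∨ typeBt cs * w ∈ typeDSubgroup cs := by
      clear h
      induction w using cs.simple_induction_left with
      | one => exact Or.inl (one_mem _)
      | mul_simple_left w i ih =>
        by_cases hi : i = Fin.last n
        · subst hi
          change typeBt cs * w ∈ _ ∨ typeBt cs * (typeBt cs * w) ∈ _
          rw [t_t_mul]; exact ih.symm
        · have hs : cs.simple i ∈ typeDSubgroup cs := by
            rw [← gen_of_ne cs hi]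
            exact Subgroup.subset_closure ⟨_, rfl⟩
          rcases ih with ih | ih
          · exact Or.inl (mul_mem hs ih)
          · right
            have := mul_mem (conj_mem cs hn hs) ih
            simpa only [mul_assoc, t_t_mul] using this
    exact this.resolve_left h

theorem lt_left (hn : 1 ≤ n) (w : W) (j : Fin (n + 1)) :
    cs.length (typeBt cs * w) < cs.length (typeBt cs * w * typeDGen cs j) ↔
      cs.length w < cs.length (w * typeDGen cs j) := by
  classical
  rw [lt_iff_eta cs (gen_refl cs j), lt_iff_eta cs (gen_refl cs j), eta_mul]
  unfold typeBt
  rw [eta_simple, if_neg, add_zero]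
  intro h
  have h2 := congrArg (chi cs) h
  change _ = chi cs (typeBt cs) at h2
  rw [chi_t, map_mul, map_mul, map_inv, chi_gen cs hn] at h2
  simp at h2

theorem lt_right (hn : 1 ≤ n) (w : W) (j : Fin (n + 1)) :
    cs.length (w * typeBt cs) < cs.length (w * typeBt cs * typeDGen cs j) ↔
      cs.length w < cs.length (w * typeDGen cs (sw n j)) := by
  classical
  rw [lt_iff_eta cs (gen_refl cs j), lt_iff_eta cs (gen_refl cs _), eta_mul, t_inv, ← gen_sw cs hn]
  unfold typeBt
  rw [eta_simple, if_neg, zero_add]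
  intro h
  have h2 := congrArg (chi cs) h
  change _ = chi cs (typeBt cs) at h2
  rw [chi_t, chi_gen cs hn] at h2
  exact absurd h2 (by decide)

/-- `w` has no descent in `I`, with respect to the simple system of type D. -/
def ND (I : Finset (Fin (n + 1))) (w : W) : Prop :=
  ∀ i ∈ I, cs.length w < cs.length (w * typeDGen cs i)

/-- `w` has no descent in `I`, with respect to the simple system of type B. -/
def NB (I : Finset (Fin (n + 1))) (w : W) : Prop :=
  ∀ i ∈ I, cs.length w < cs.length (w * cs.simple i)

theorem ND_left (hn : 1 ≤ n) (I : Finset (Fin (n + 1))) (w : W) :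
    ND cs I (typeBt cs * w) ↔ ND cs I w := by
  simp only [ND, lt_left cs hn]

theorem ND_right (hn : 1 ≤ n) (I : Finset (Fin (n + 1))) (w : W) :
    ND cs I (w * typeBt cs) ↔ ND cs (I.image (sw n)) w := by
  simp only [ND, lt_right cs hn, Finset.forall_mem_image]

theorem NB_iff_ND (I : Finset (Fin (n + 1))) (hI : Fin.last n ∉ I) (w : W) :
    NB cs I w ↔ ND cs I w := by
  refine forall₂_congr fun i hi => ?_
  rw [gen_of_ne]
  rintro rfl
  exact hI hi

theorem NB_iff_of_lt (I J : Finset (Fin (n + 1)))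
    (h1 : ∀ i ∈ I, i ≠ Fin.last n → i ∈ J) (h2 : ∀ j ∈ J, typeDGen cs j ∈ parabolic cs I)
    (w : W) (hw : cs.length w < cs.length (w * typeBt cs)) :
    NB cs I w ↔ ND cs J w := by
  constructor
  · intro h j hj
    exact lt_of_min cs I w h _ (gen_refl cs j) (h2 j hj)
  · intro h i hi
    by_cases hl : i = Fin.last n
    · subst hl; exact hw
    · rw [← gen_of_ne cs hl]
      exact h i (h1 i hi hl)

end typeB
end ResBD
namespace ResBD
section alg
set_option linter.unusedSectionVars false
variable {W : Type*} [Group W] [Fintype W] [DecidableEq W] {n : ℕ}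
variable (cs : CoxeterSystem (CoxeterMatrix.Bₙ (n + 1)) W)

theorem coeff_sum_ite (P : W → Prop) [DecidablePred P] (v : W) :
    (∑ w : W, if P w then MonoidAlgebra.single w (1 : ℚ) else 0).coeff v =
      if P v then 1 else 0 := by
  rw [MonoidAlgebra.coeff_sum, Finsupp.finsetSum_apply, Finset.sum_eq_single v]
  · split_ifs <;> simp
  · intro w _ hw
    split_ifs
    · rw [MonoidAlgebra.coeff_single, Finsupp.single_eq_of_ne (Ne.symm hw)]
    · simp
  · simp

open Classical in
theorem coeff_B (I : Finset (Fin (n + 1))) (v : W) :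
    (descentBasis cs I).coeff v = if NB cs I v then 1 else 0 := by
  rw [← coeff_sum_ite (NB cs I) v]
  unfold descentBasis
  refine congrArg (fun x : MonoidAlgebra ℚ W => x.coeff v)
    (Finset.sum_congr rfl fun w _ => ?_)
  by_cases h : NB cs I w
  · rw [if_pos h, if_pos (show ∀ i ∈ I, _ from h)]
  · rw [if_neg h, if_neg (show ¬ ∀ i ∈ I, _ from h)]

open Classical in
theorem coeff_D (I : Finset (Fin (n + 1))) (v : W) :
    (typeDDescentBasis cs I).coeff v =
      if v ∈ typeDSubgroup cs ∧ ND cs I v then 1 else 0 := by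
  rw [← coeff_sum_ite (fun v => v ∈ typeDSubgroup cs ∧ ND cs I v) v]
  unfold typeDDescentBasis
  refine congrArg (fun x : MonoidAlgebra ℚ W => x.coeff v)
    (Finset.sum_congr rfl fun w _ => ?_)
  by_cases h : w ∈ typeDSubgroup cs ∧ ND cs I w
  · rw [if_pos h, if_pos (show _ ∧ ∀ i ∈ I, _ from h)]
  · rw [if_neg h, if_neg (show ¬ (_ ∧ ∀ i ∈ I, _) from h)]

theorem coeff_left (x : MonoidAlgebra ℚ W) (v : W) :
    ((1 + MonoidAlgebra.single (typeBt cs) (1 : ℚ)) * x).coeff v =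
      x.coeff v + x.coeff (typeBt cs * v) := by
  rw [add_mul, one_mul, MonoidAlgebra.coeff_add, Finsupp.add_apply,
    MonoidAlgebra.coeff_single_mul_apply, one_mul, t_inv]

theorem coeff_right (x : MonoidAlgebra ℚ W) (v : W) :
    (x * (1 + MonoidAlgebra.single (typeBt cs) (1 : ℚ))).coeff v =
      x.coeff v + x.coeff (v * typeBt cs) := by
  rw [mul_add, mul_one, MonoidAlgebra.coeff_add, Finsupp.add_apply,
    MonoidAlgebra.coeff_mul_single_apply, mul_one, t_inv]

theorem coeff_conj (x : MonoidAlgebra ℚ W) (v : W) :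
    (MonoidAlgebra.single (typeBt cs) (1 : ℚ) * x *
      MonoidAlgebra.single (typeBt cs) (1 : ℚ)).coeff v =
      x.coeff (typeBt cs * v * typeBt cs) := by
  rw [MonoidAlgebra.coeff_mul_single_apply, MonoidAlgebra.coeff_single_mul_apply, mul_one,
    one_mul, t_inv, mul_assoc]

theorem D_congr (I J : Finset (Fin (n + 1))) (h : ∀ w, ND cs I w ↔ ND cs J w) :
    typeDDescentBasis cs I = typeDDescentBasis cs J := by
  classical
  ext v
  rw [coeff_D, coeff_D]
  simp only [h]

open Classical in
theorem coeff_left_D (hn : 1 ≤ n) (I : Finset (Fin (n + 1))) (v : W) :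
    ((1 + MonoidAlgebra.single (typeBt cs) (1 : ℚ)) * typeDDescentBasis cs I).coeff v =
      if ND cs I v then 1 else 0 := by
  rw [coeff_left, coeff_D, coeff_D, ND_left cs hn, t_mul_mem_iff cs hn]
  by_cases h1 : v ∈ typeDSubgroup cs <;> by_cases h2 : ND cs I v <;> simp [h1, h2]

theorem conj_D (hn : 1 ≤ n) (I : Finset (Fin (n + 1))) :
    MonoidAlgebra.single (typeBt cs) (1 : ℚ) * typeDDescentBasis cs I *
      MonoidAlgebra.single (typeBt cs) (1 : ℚ) = typeDDescentBasis cs (I.image (sw n)) := by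
  classical
  ext v
  rw [coeff_conj, coeff_D, coeff_D, conj_mem_iff cs hn, mul_assoc, ND_left cs hn, ND_right cs hn]

open Classical in
theorem coeff_right_B (hn : 1 ≤ n) (I J : Finset (Fin (n + 1))) (hI : Fin.last n ∈ I)
    (h1 : ∀ i ∈ I, i ≠ Fin.last n → i ∈ J) (h2 : ∀ j ∈ J, typeDGen cs j ∈ parabolic cs I)
    (h3 : ∀ j ∈ J, sw n j ∈ J) (v : W) :
    (descentBasis cs I * (1 + MonoidAlgebra.single (typeBt cs) (1 : ℚ))).coeff v =
      if ND cs J v then 1 else 0 := by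
  have himg : J.image (sw n) = J := by
    ext j
    simp only [Finset.mem_image]
    constructor
    · rintro ⟨k, hk, rfl⟩
      exact h3 k hk
    · intro hj
      exact ⟨sw n j, h3 j hj, sw_sw j⟩
  rw [coeff_right, coeff_B, coeff_B]
  have hne : cs.length (v * typeBt cs) ≠ cs.length v := cs.length_mul_simple_ne v _
  rcases lt_or_gt_of_ne hne with h | h
  · have hv : ¬ NB cs I v := fun hv => absurd (hv _ hI) (not_lt.2 h.le)
    have hvt : cs.length (v * typeBt cs) < cs.length (v * typeBt cs * typeBt cs) := by
      rwa [mul_t_t]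
    rw [if_neg hv, zero_add, NB_iff_of_lt cs I J h1 h2 _ hvt, ND_right cs hn, himg]
  · have hv : ¬ NB cs I (v * typeBt cs) := by
      intro hv
      have := hv _ hI
      change _ < cs.length (v * typeBt cs * typeBt cs) at this
      rw [mul_t_t] at this
      omega
    rw [if_neg hv, add_zero, NB_iff_of_lt cs I J h1 h2 _ h]

open Classical in
theorem filter_parabolic (hn : 1 ≤ n) (I : Finset (Fin (n + 1))) (hI : Fin.last n ∈ I) (v : W) :
    (descentBasis cs I * (1 + MonoidAlgebra.single (typeBt cs) (1 : ℚ))).coeff v =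
      if ND cs (Finset.univ.filter (fun j => typeDGen cs j ∈ parabolic cs I)) v then 1 else 0 := by
  apply coeff_right_B cs hn I _ hI
  · intro i hi hl
    rw [Finset.mem_filter, gen_of_ne cs hl]
    exact ⟨Finset.mem_univ _, Subgroup.subset_closure ⟨i, hi, rfl⟩⟩
  · intro j hj
    exact (Finset.mem_filter.1 hj).2
  · intro j hj
    rw [Finset.mem_filter] at hj ⊢
    refine ⟨Finset.mem_univ _, ?_⟩
    have ht : typeBt cs ∈ parabolic cs I := Subgroup.subset_closure ⟨_, hI, rfl⟩
    rw [gen_sw cs hn]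
    exact mul_mem (mul_mem ht hj.2) ht

open Classical in
theorem ND_filter (hn : 1 ≤ n) (I : Finset (Fin (n + 1))) (hI : Fin.last n ∉ I) (v : W) :
    ND cs (Finset.univ.filter (fun j =>
          ∃ i ∈ I, typeDGen cs j = typeBt cs * cs.simple i * (typeBt cs)⁻¹)) v ↔
      ND cs (I.image (sw n)) v := by
  have key : ∀ i ∈ I, typeBt cs * cs.simple i * (typeBt cs)⁻¹ = typeDGen cs (sw n i) := by
    intro i hi
    rw [gen_sw cs hn, t_inv, gen_of_ne]
    rintro rfl
    exact hI hi
  constructor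
  · intro h j hj
    obtain ⟨i, hi, rfl⟩ := Finset.mem_image.1 hj
    exact h _ (Finset.mem_filter.2 ⟨Finset.mem_univ _, i, hi, (key i hi).symm⟩)
  · intro h j hj
    obtain ⟨i, hi, hij⟩ := (Finset.mem_filter.1 hj).2
    rw [hij, key i hi]
    exact h _ (Finset.mem_image_of_mem _ hi)

/-- Elements supported on the subgroup of type D. -/
def Supp (x : MonoidAlgebra ℚ W) : Prop := ∀ v ∉ typeDSubgroup cs, x.coeff v = 0

theorem supp_D (I : Finset (Fin (n + 1))) : Supp cs (typeDDescentBasis cs I) := by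
  classical
  intro v hv
  rw [coeff_D, if_neg (fun h => hv h.1)]

theorem supp_span {x : MonoidAlgebra ℚ W}
    (hx : x ∈ Submodule.span ℚ (Set.range (typeDDescentBasis cs))) : Supp cs x := by
  induction hx using Submodule.span_induction with
  | mem x h => obtain ⟨I, rfl⟩ := h; exact supp_D cs I
  | zero => intro v _; rfl
  | add x y _ _ hx hy =>
    intro v hv
    rw [MonoidAlgebra.coeff_add, Finsupp.add_apply, hx v hv, hy v hv, add_zero]
  | smul a x _ hx =>
    intro v hv
    rw [MonoidAlgebra.coeff_smul_apply, hx v hv, smul_zero]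

theorem supp_mul {x y : MonoidAlgebra ℚ W} (hx : Supp cs x) (hy : Supp cs y) :
    Supp cs (x * y) := by
  intro v hv
  rw [MonoidAlgebra.coeff_mul_apply_left]
  apply Finset.sum_eq_zero
  intro g _
  by_cases hg : g ∈ typeDSubgroup cs
  · have : g⁻¹ * v ∉ typeDSubgroup cs := by
      rwa [Subgroup.mul_mem_cancel_left _ (inv_mem hg)]
    simp [hy _ this]
  · simp [hx _ hg]

theorem supp_conj (hn : 1 ≤ n) {x : MonoidAlgebra ℚ W} (hx : Supp cs x) :
    Supp cs (MonoidAlgebra.single (typeBt cs) (1 : ℚ) * x *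
      MonoidAlgebra.single (typeBt cs) (1 : ℚ)) := by
  intro v hv
  rw [coeff_conj]
  exact hx _ (by rwa [conj_mem_iff cs hn])

theorem supp_one : Supp cs (1 : MonoidAlgebra ℚ W) := by
  intro v hv
  rw [MonoidAlgebra.one_def, MonoidAlgebra.coeff_single, Finsupp.single_eq_of_ne]
  rintro rfl
  exact hv (one_mem _)

theorem left_inj (hn : 1 ≤ n) {x y : MonoidAlgebra ℚ W} (hx : Supp cs x) (hy : Supp cs y)
    (h : (1 + MonoidAlgebra.single (typeBt cs) (1 : ℚ)) * x =
      (1 + MonoidAlgebra.single (typeBt cs) (1 : ℚ)) * y) : x = y := by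
  ext v
  by_cases hv : v ∈ typeDSubgroup cs
  · have h2 := congrArg (fun z => z.coeff v) h
    have hv' : typeBt cs * v ∉ typeDSubgroup cs := by
      rw [t_mul_mem_iff cs hn]; exact not_not.2 hv
    simp only [coeff_left, hx _ hv', hy _ hv', add_zero] at h2
    exact h2
  · rw [hx v hv, hy v hv]

variable (R : MonoidAlgebra ℚ W →ₗ[ℚ] MonoidAlgebra ℚ W)

theorem intertwine_basis (hn : 1 ≤ n) (hR : IsResBD cs R) (I : Finset (Fin (n + 1))) :
    (1 + MonoidAlgebra.single (typeBt cs) (1 : ℚ)) * R (descentBasis cs I) =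
      descentBasis cs I * (1 + MonoidAlgebra.single (typeBt cs) (1 : ℚ)) := by
  classical
  rw [hR I]
  ext v
  split_ifs with hI
  · rw [coeff_left_D cs hn]
    convert (filter_parabolic cs hn I hI v).symm
  · rw [mul_add, MonoidAlgebra.coeff_add, Finsupp.add_apply, coeff_left_D cs hn,
      coeff_left_D cs hn, coeff_right, coeff_B, coeff_B, NB_iff_ND cs I hI, NB_iff_ND cs I hI,
      ND_right cs hn]
    congr 2
    have := ND_filter cs hn I hI v
    convert propext this

theorem R_mem_span (hR : IsResBD cs R) {x : MonoidAlgebra ℚ W}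
    (hx : x ∈ Submodule.span ℚ (Set.range (descentBasis cs))) :
    R x ∈ Submodule.span ℚ (Set.range (typeDDescentBasis cs)) := by
  induction hx using Submodule.span_induction with
  | mem x h =>
    obtain ⟨I, rfl⟩ := h
    rw [hR I]
    split_ifs
    · exact Submodule.subset_span ⟨_, rfl⟩
    · exact add_mem (Submodule.subset_span ⟨_, rfl⟩) (Submodule.subset_span ⟨_, rfl⟩)
  | zero => rw [map_zero]; exact zero_mem _
  | add x y _ _ hx hy => rw [map_add]; exact add_mem hx hy
  | smul a x _ hx => rw [map_smul]; exact Submodule.smul_mem _ _ hx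

theorem intertwine (hn : 1 ≤ n) (hR : IsResBD cs R) {x : MonoidAlgebra ℚ W}
    (hx : x ∈ Submodule.span ℚ (Set.range (descentBasis cs))) :
    (1 + MonoidAlgebra.single (typeBt cs) (1 : ℚ)) * R x =
      x * (1 + MonoidAlgebra.single (typeBt cs) (1 : ℚ)) := by
  induction hx using Submodule.span_induction with
  | mem x h => obtain ⟨I, rfl⟩ := h; exact intertwine_basis cs R hn hR I
  | zero => rw [map_zero, mul_zero, zero_mul]
  | add x y _ _ hx hy => rw [map_add, mul_add, hx, hy, add_mul]
  | smul a x _ hx => rw [map_smul, mul_smul_comm, hx, smul_mul_assoc]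

theorem basis_surj_aux (hn : 1 ≤ n) (hR : IsResBD cs R) (I : Finset (Fin (n + 1)))
    (hI : Fin.last n ∉ I) :
    R (descentBasis cs I) =
      typeDDescentBasis cs I + typeDDescentBasis cs (I.image (sw n)) := by
  classical
  rw [hR I, if_neg hI]
  congr 1
  apply D_congr
  intro w
  convert ND_filter cs hn I hI w

theorem basis_surj (hn : 1 ≤ n) (hR : IsResBD cs R) (I : Finset (Fin (n + 1))) :
    ∃ x ∈ Submodule.span ℚ (Set.range (descentBasis cs)),
      R x = typeDDescentBasis cs I + typeDDescentBasis cs (I.image (sw n)) := by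
  classical
  by_cases h1 : Fin.last n ∈ I
  swap
  · exact ⟨_, Submodule.subset_span ⟨I, rfl⟩, basis_surj_aux cs R hn hR I h1⟩
  have hii : (I.image (sw n)).image (sw n) = I := by
    rw [Finset.image_image, show (⇑(sw n) ∘ ⇑(sw n)) = id from funext sw_sw, Finset.image_id]
  by_cases h2 : sw n (Fin.last n) ∈ I
  swap
  · refine ⟨_, Submodule.subset_span ⟨I.image (sw n), rfl⟩, ?_⟩
    rw [basis_surj_aux cs R hn hR, hii, add_comm]
    intro h
    obtain ⟨k, hk, hk2⟩ := Finset.mem_image.1 h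
    rw [← hk2, sw_sw] at h2
    exact h2 hk
  · have hsw : ∀ j ∈ I, sw n j ∈ I := by
      intro j hj
      by_cases hj1 : j = Fin.last n
      · rw [hj1]; exact h2
      by_cases hj2 : j = sw n (Fin.last n)
      · rw [hj2, sw_sw]; exact h1
      · unfold sw at hj2 ⊢
        rw [Equiv.swap_apply_left] at hj2
        rwa [Equiv.swap_apply_of_ne_of_ne hj1 hj2]
    have himg : I.image (sw n) = I := by
      ext j
      simp only [Finset.mem_image]
      constructor
      · rintro ⟨k, hk, rfl⟩
        exact hsw k hk
      · intro hj
        exact ⟨sw n j, hsw j hj, sw_sw j⟩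
    have hsne : sw n (Fin.last n) ≠ Fin.last n := by
      unfold sw
      rw [Equiv.swap_apply_left]
      intro h
      have := congrArg Fin.val h
      simp at this
      omega
    have ht : typeBt cs ∈ parabolic cs I := Subgroup.subset_closure ⟨_, h1, rfl⟩
    have hgen : ∀ j ∈ I, j ≠ Fin.last n → typeDGen cs j ∈ parabolic cs I := by
      intro j hj hl
      rw [gen_of_ne cs hl]
      exact Subgroup.subset_closure ⟨j, hj, rfl⟩
    have hRI : R (descentBasis cs I) = typeDDescentBasis cs I := by
      refine left_inj cs hn ?_ (supp_D cs I) ?_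
      · exact supp_span cs (R_mem_span cs R hR (Submodule.subset_span ⟨I, rfl⟩))
      rw [intertwine_basis cs R hn hR]
      ext v
      rw [coeff_left_D cs hn, coeff_right_B cs hn I I h1 (fun i hi _ => hi) ?_ hsw]
      intro j hj
      by_cases hl : j = Fin.last n
      · have := gen_sw cs hn (sw n (Fin.last n))
        rw [sw_sw] at this
        rw [hl, this]
        exact mul_mem (mul_mem ht (hgen _ h2 hsne)) ht
      · exact hgen j hj hl
    refine ⟨descentBasis cs I + descentBasis cs I,
      add_mem (Submodule.subset_span ⟨I, rfl⟩) (Submodule.subset_span ⟨I, rfl⟩), ?_⟩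
    rw [map_add, hRI, himg]

theorem span_surj (hn : 1 ≤ n) (hR : IsResBD cs R) {y : MonoidAlgebra ℚ W}
    (hy : y ∈ Submodule.span ℚ (Set.range (typeDDescentBasis cs))) :
    ∃ x ∈ Submodule.span ℚ (Set.range (descentBasis cs)),
      R x = y + MonoidAlgebra.single (typeBt cs) (1 : ℚ) * y *
        MonoidAlgebra.single (typeBt cs) (1 : ℚ) := by
  induction hy using Submodule.span_induction with
  | mem x h =>
    obtain ⟨I, rfl⟩ := h
    rw [conj_D cs hn]
    exact basis_surj cs R hn hR I
  | zero => exact ⟨0, zero_mem _, by simp⟩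
  | add y z _ _ hy hz =>
    obtain ⟨a, ha, ha'⟩ := hy
    obtain ⟨b, hb, hb'⟩ := hz
    refine ⟨a + b, add_mem ha hb, ?_⟩
    rw [map_add, ha', hb', mul_add, add_mul]
    abel
  | smul c y _ hy =>
    obtain ⟨a, ha, ha'⟩ := hy
    refine ⟨c • a, Submodule.smul_mem _ _ ha, ?_⟩
    rw [map_smul, ha', smul_add, mul_smul_comm, smul_mul_assoc]

end alg
end ResBD

set_option synthInstance.maxHeartbeats 1000000 in
set_option maxHeartbeats 1000000 in
/-- The restriction map `Res_n : Σ(Wₙ) → Σ(Wₙ′)` from the descent algebra of type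
`Bₙ₊₁` to that of type `Dₙ₊₁` satisfies `(1+t)·Res_n(x) = x·(1+t)`, is a unital
algebra homomorphism, and its image is exactly `Σ(Wₙ′)^{σₙ}`, the fixed subalgebra
of the automorphism `σₙ` given by conjugation by `t`. -/
theorem resBD_algHom_image (hn : 1 ≤ n)
    (cs : CoxeterSystem (CoxeterMatrix.Bₙ (n + 1)) W)
    (A : Subalgebra ℚ (MonoidAlgebra ℚ W)) (hA : IsDescentAlgebra cs A)
    (R : MonoidAlgebra ℚ W →ₗ[ℚ] MonoidAlgebra ℚ W) (hR : IsResBD cs R) :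
    (∀ x ∈ A, (1 + MonoidAlgebra.single (typeBt cs) (1 : ℚ)) * R x =
      x * (1 + MonoidAlgebra.single (typeBt cs) (1 : ℚ))) ∧
    (R 1 = 1 ∧ ∀ x ∈ A, ∀ y ∈ A, R (x * y) = R x * R y) ∧
    {y : MonoidAlgebra ℚ W | ∃ x ∈ A, R x = y} =
      {y : MonoidAlgebra ℚ W |
        y ∈ Submodule.span ℚ (Set.range (typeDDescentBasis cs)) ∧
        MonoidAlgebra.single (typeBt cs) (1 : ℚ) * y *
          MonoidAlgebra.single (typeBt cs) (1 : ℚ) = y} := by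
  have hmem : ∀ x, x ∈ A ↔ x ∈ Submodule.span ℚ (Set.range (descentBasis cs)) := by
    intro x
    rw [← SetLike.mem_coe, hA, SetLike.mem_coe]
  have hinter : ∀ x ∈ A, (1 + MonoidAlgebra.single (typeBt cs) (1 : ℚ)) * R x =
      x * (1 + MonoidAlgebra.single (typeBt cs) (1 : ℚ)) :=
    fun x hx => ResBD.intertwine cs R hn hR ((hmem x).1 hx)
  have hspan : ∀ x ∈ A, R x ∈ Submodule.span ℚ (Set.range (typeDDescentBasis cs)) :=
    fun x hx => ResBD.R_mem_span cs R hR ((hmem x).1 hx)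
  have hsupp : ∀ x ∈ A, ResBD.Supp cs (R x) := fun x hx => ResBD.supp_span cs (hspan x hx)
  refine ⟨hinter, ⟨?_, ?_⟩, ?_⟩
  · refine ResBD.left_inj cs hn (hsupp 1 (one_mem A)) (ResBD.supp_one cs) ?_
    rw [hinter 1 (one_mem A), one_mul, mul_one]
  · intro x hx y hy
    refine ResBD.left_inj cs hn (hsupp _ (mul_mem hx hy))
      (ResBD.supp_mul cs (hsupp x hx) (hsupp y hy)) ?_
    rw [hinter _ (mul_mem hx hy), mul_assoc, ← hinter y hy, ← mul_assoc, ← hinter x hx, mul_assoc]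
  · ext y
    constructor
    · rintro ⟨x, hx, rfl⟩
      refine ⟨hspan x hx, ?_⟩
      refine ResBD.left_inj cs hn (ResBD.supp_conj cs hn (hsupp x hx)) (hsupp x hx) ?_
      have htt : MonoidAlgebra.single (typeBt cs) (1 : ℚ) *
          MonoidAlgebra.single (typeBt cs) (1 : ℚ) = 1 := by
        rw [MonoidAlgebra.single_mul_single, ResBD.t_mul_t, mul_one, MonoidAlgebra.one_def]
      have h1 : (1 + MonoidAlgebra.single (typeBt cs) (1 : ℚ)) *
          MonoidAlgebra.single (typeBt cs) (1 : ℚ) =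
          1 + MonoidAlgebra.single (typeBt cs) (1 : ℚ) := by
        rw [add_mul, htt, one_mul, add_comm]
      rw [← mul_assoc, ← mul_assoc, h1, hinter x hx, mul_assoc, h1]
    · rintro ⟨hy, hfix⟩
      obtain ⟨x, hx, hxy⟩ := ResBD.span_surj cs R hn hR hy
      refine ⟨(1 / 2 : ℚ) • x, A.smul_mem ((hmem x).2 hx) _, ?_⟩
      rw [map_smul, hxy, hfix, ← two_smul ℚ y, smul_smul]
      norm_num
end
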